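/- Let n ≡ 1 (mod 2k). There exists an almost resolvable k-cycle system of order n for every odd k ≥ 3 and for every even k ∈ {4, 6, 8, 10, 14}, except for (k, n) ∈ {(3, 7), (3, 13), (4, 9)} and except possibly for (k, n) ∈ {(8, 33), (14, 57)}. -/

import Mathlib

/-- The set of edges of the closed walk `c 0, c 1, …, c (k-1), c 0`.
When `c` is injective, this is a cycle of length `k`. -/
def cycleEdgeSet {V : Type*} {k : ℕ} (c : ZMod k → V) : Set (Sym2 V) :=
  {e | ∃ i : ZMod k, e = s(c i, c (i + 1))}

/-- `HasARCS k v` asserts the existence of an almost resolvable `k`-cycle system of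
order `v`: a collection of `k`-cycles whose edge sets partition the edge set of the
complete graph on `v` vertices, partitioned into `(v-1)/2` almost parallel classes
(each consisting of `(v-1)/k` pairwise vertex-disjoint `k`-cycles) together with one
half-parallel class (consisting of `(v-1)/(2k)` pairwise vertex-disjoint `k`-cycles). -/
def HasARCS (k v : ℕ) : Prop :=
  ∃ (apc : Fin ((v - 1) / 2) → Fin ((v - 1) / k) → ZMod k → Fin v)
    (hpc : Fin ((v - 1) / (2 * k)) → ZMod k → Fin v),
    (∀ i j, Function.Injective (apc i j)) ∧
    (∀ j, Function.Injective (hpc j)) ∧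
    (∀ i, ∀ j₁ j₂, j₁ ≠ j₂ →
      Disjoint (Set.range (apc i j₁)) (Set.range (apc i j₂))) ∧
    (∀ j₁ j₂, j₁ ≠ j₂ → Disjoint (Set.range (hpc j₁)) (Set.range (hpc j₂))) ∧
    (∀ e : Sym2 (Fin v), ¬ e.IsDiag →
      ∃! p : (Fin ((v - 1) / 2) × Fin ((v - 1) / k)) ⊕ Fin ((v - 1) / (2 * k)),
        e ∈ Sum.elim (fun q => cycleEdgeSet (apc q.1 q.2))
              (fun j => cycleEdgeSet (hpc j)) p)

namespace ARCS

variable {V W : Type*}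

/-! ### Classes of vertex-disjoint cycles

A cycle is represented by the list of its vertices in cyclic order. -/

/-- `y` follows `x` on the closed walk `L`. -/
def Follows (L : List V) (x y : V) : Prop := [x, y] <:+: L ++ L.take 1

/-- `x` and `y` are joined by an edge of one of the cycles in `T`. -/
def Covers (T : Set (List V)) (x y : V) : Prop :=
  ∃ L ∈ T, Follows L x y ∨ Follows L y x

/-- `T` consists of vertex-disjoint cycles with lengths satisfying `K`,
which together visit exactly the points of `S`. -/
structure IsFactor (K : ℕ → Prop) (T : Set (List V)) (S : Set V) : Prop where
  len : ∀ L ∈ T, K L.length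
  nodup : ∀ L ∈ T, L.Nodup
  uniq : ∀ L ∈ T, ∀ L' ∈ T, ∀ x ∈ L, x ∈ L' → L = L'
  mem : ∀ x, x ∈ S ↔ ∃ L ∈ T, x ∈ L

theorem Follows.map (f : V → W) {L : List V} {x y : V} (h : Follows L x y) :
    Follows (L.map f) (f x) (f y) := by
  have := List.IsInfix.map f h
  simpa [Follows, List.map_take] using this

theorem Follows.exists_index {L : List V} {x y : V} (h : Follows L x y) :
    ∃ (i : ℕ) (hi : i < L.length),
      L[i] = x ∧ L[(i + 1) % L.length]'(Nat.mod_lt _ (by omega)) = y := by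
  obtain ⟨s, t, h⟩ := h
  have hlen := congrArg List.length h
  simp only [List.length_append, List.length_cons, List.length_nil, List.length_take] at hlen
  have hi : s.length < L.length := by omega
  have h0 : ∀ j : ℕ, (s ++ [x, y] ++ t)[j]? = (L ++ L.take 1)[j]? := fun j => by rw [h]
  have hx := h0 s.length
  have hy := h0 (s.length + 1)
  simp only [List.append_assoc, le_refl, List.getElem?_append_right, tsub_self, List.cons_append,
    List.getElem?_cons_zero, List.nil_append, List.getElem?_append_left hi,
    List.getElem?_eq_getElem hi, Option.some.injEq] at hx
  refine ⟨s.length, hi, hx.symm, ?_⟩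
  rw [List.append_assoc, List.getElem?_append_right (by omega)] at hy
  simp only [add_tsub_cancel_left, List.cons_append, List.getElem?_cons_succ,
    List.getElem?_cons_zero] at hy
  by_cases hlt : s.length + 1 < L.length
  · rw [List.getElem?_append_left hlt, List.getElem?_eq_getElem hlt, Option.some.injEq] at hy
    simp only [Nat.mod_eq_of_lt hlt, hy]
  · have he : s.length + 1 = L.length := by omega
    rw [List.getElem?_append_right (by omega), he, Nat.sub_self,
      List.getElem?_take_of_lt (by omega), List.getElem?_eq_getElem (by omega),
      Option.some.injEq] at hy
    simp only [he, Nat.mod_self, hy]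

theorem Covers.symm {T : Set (List V)} {x y : V} (h : Covers T x y) : Covers T y x := by
  obtain ⟨L, hL, h⟩ := h
  exact ⟨L, hL, h.symm⟩

theorem Covers.image (f : V → W) {T : Set (List V)} {x y : V} (h : Covers T x y) :
    Covers (List.map f '' T) (f x) (f y) := by
  obtain ⟨L, hL, h⟩ := h
  exact ⟨_, Set.mem_image_of_mem _ hL, h.imp (Follows.map f) (Follows.map f)⟩

theorem Covers.mono {T T' : Set (List V)} (hT : T ⊆ T') {x y : V} (h : Covers T x y) :
    Covers T' x y := by
  obtain ⟨L, hL, h⟩ := h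
  exact ⟨L, hT hL, h⟩

theorem IsFactor.image {K : ℕ → Prop} {T : Set (List V)} {S : Set V} (h : IsFactor K T S)
    {f : V → W} (hf : Set.InjOn f S) : IsFactor K (List.map f '' T) (f '' S) := by
  have hS : ∀ L ∈ T, ∀ x ∈ L, x ∈ S := fun L hL x hx => (h.mem x).2 ⟨L, hL, hx⟩
  refine ⟨?_, ?_, ?_, ?_⟩
  · rintro _ ⟨L, hL, rfl⟩
    simpa using h.len L hL
  · rintro _ ⟨L, hL, rfl⟩
    exact (h.nodup L hL).map_on fun x hx y hy hxy => hf (hS L hL x hx) (hS L hL y hy) hxy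
  · rintro _ ⟨L, hL, rfl⟩ _ ⟨L', hL', rfl⟩ x hx hx'
    obtain ⟨y, hy, rfl⟩ := List.mem_map.1 hx
    obtain ⟨z, hz, hzy⟩ := List.mem_map.1 hx'
    obtain rfl := hf (hS L' hL' z hz) (hS L hL y hy) hzy
    rw [h.uniq L hL L' hL' z hy hz]
  · intro x
    constructor
    · rintro ⟨y, hy, rfl⟩
      obtain ⟨L, hL, hyL⟩ := (h.mem y).1 hy
      exact ⟨_, ⟨L, hL, rfl⟩, List.mem_map_of_mem hyL⟩
    · rintro ⟨_, ⟨L, hL, rfl⟩, hx⟩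
      obtain ⟨y, hy, rfl⟩ := List.mem_map.1 hx
      exact ⟨y, hS L hL y hy, rfl⟩

theorem IsFactor.iUnion {ι : Type*} {K : ℕ → Prop} {T : ι → Set (List V)} {S : ι → Set V}
    (h : ∀ i, IsFactor K (T i) (S i)) (hS : ∀ i j x, x ∈ S i → x ∈ S j → i = j) :
    IsFactor K (⋃ i, T i) (⋃ i, S i) := by
  refine ⟨?_, ?_, ?_, ?_⟩
  · simp only [Set.mem_iUnion]
    rintro L ⟨i, hL⟩
    exact (h i).len L hL
  · simp only [Set.mem_iUnion]
    rintro L ⟨i, hL⟩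
    exact (h i).nodup L hL
  · simp only [Set.mem_iUnion]
    rintro L ⟨i, hL⟩ L' ⟨j, hL'⟩ x hx hx'
    obtain rfl := hS i j x (((h i).mem x).2 ⟨L, hL, hx⟩) (((h j).mem x).2 ⟨L', hL', hx'⟩)
    exact (h i).uniq L hL L' hL' x hx hx'
  · intro x
    simp only [Set.mem_iUnion, (h _).mem]
    constructor
    · rintro ⟨i, L, hL, hx⟩
      exact ⟨L, ⟨i, hL⟩, hx⟩
    · rintro ⟨L, ⟨i, hL⟩, hx⟩
      exact ⟨i, L, hL, hx⟩

theorem IsFactor.union {K : ℕ → Prop} {T T' : Set (List V)} {S S' : Set V}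
    (h : IsFactor K T S) (h' : IsFactor K T' S') (hS : Disjoint S S') :
    IsFactor K (T ∪ T') (S ∪ S') := by
  have hd := Set.disjoint_left.1 hS
  have := IsFactor.iUnion (T := fun b : Bool => cond b T T') (S := fun b : Bool => cond b S S')
    (K := K) (by rintro (_ | _) <;> assumption) (by
      rintro (_ | _) (_ | _) x h1 h2
      · rfl
      · exact absurd h1 (hd h2)
      · exact absurd h2 (hd h1)
      · rfl)
  rwa [← Set.union_eq_iUnion, ← Set.union_eq_iUnion] at this

theorem IsFactor.mono {K K' : ℕ → Prop} {T : Set (List V)} {S : Set V} (h : IsFactor K T S)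
    (hK : ∀ m, K m → K' m) : IsFactor K' T S :=
  ⟨fun L hL => hK _ (h.len L hL), h.nodup, h.uniq, h.mem⟩

theorem IsFactor.empty (K : ℕ → Prop) : IsFactor K (∅ : Set (List V)) ∅ :=
  ⟨by simp, by simp, by simp, by simp⟩

theorem IsFactor.of_nodup_flatten {K : ℕ → Prop} {Ls : List (List V)} {S : Set V}
    (hlen : ∀ L ∈ Ls, K L.length) (hnd : Ls.flatten.Nodup) (hmem : ∀ x, x ∈ S ↔ x ∈ Ls.flatten) :
    IsFactor K {L | L ∈ Ls} S := by
  rw [List.nodup_flatten] at hnd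
  refine ⟨hlen, hnd.1, ?_, fun x => by simp [hmem]⟩
  intro L hL L' hL' x hx hy
  by_contra hne
  have : Std.Symm (List.Disjoint (α := V)) := ⟨fun _ _ h => h.symm⟩
  exact (hnd.2.forall hL hL' hne) hx hy

/-- Disjointness and inclusion come for free from counting. -/
theorem IsFactor.of_card {K : ℕ → Prop} {Ls : List (List V)} {S : Finset V}
    (hlen : ∀ L ∈ Ls, K L.length) (hcard : Ls.flatten.length ≤ S.card)
    (hcov : ∀ x ∈ S, x ∈ Ls.flatten) : IsFactor K {L | L ∈ Ls} (S : Set V) := by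
  classical
  have hsub : S ⊆ Ls.flatten.toFinset := fun x hx => List.mem_toFinset.2 (hcov x hx)
  have h1 := Finset.card_le_card hsub
  have h2 := List.toFinset_card_le Ls.flatten
  have heq : S = Ls.flatten.toFinset := Finset.eq_of_subset_of_card_le hsub (by omega)
  refine IsFactor.of_nodup_flatten hlen ?_ fun x => ?_
  · rw [← Multiset.coe_nodup, ← Multiset.toFinset_card_eq_card_iff_nodup]
    simp only [Multiset.coe_card, List.toFinset_coe]
    omega
  · rw [heq]
    simp

/-- In a factor by `k`-cycles every point is uniquely an entry of a unique cycle. -/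
theorem IsFactor.bijective_entry {k : ℕ} {T : Set (List V)} {S : Set V}
    (h : IsFactor (· = k) T S) :
    Function.Bijective (fun p : T × Fin k =>
      (⟨p.1.1[p.2.1]'((h.len _ p.1.2).symm ▸ p.2.2),
        (h.mem _).2 ⟨_, p.1.2, List.getElem_mem _⟩⟩ : S)) := by
  constructor
  · rintro ⟨⟨L, hL⟩, i⟩ ⟨⟨L', hL'⟩, j⟩ hij
    simp only [Subtype.mk.injEq] at hij
    have hi : i.1 < L.length := (h.len _ hL).symm ▸ i.2
    have hj : j.1 < L'.length := (h.len _ hL').symm ▸ j.2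
    have : L = L' := h.uniq L hL L' hL' _ (List.getElem_mem hi) (hij ▸ List.getElem_mem hj)
    subst this
    have := (List.Nodup.getElem_inj_iff (h.nodup L hL)).1 hij
    simp [Fin.ext_iff, this]
  · rintro ⟨x, hx⟩
    obtain ⟨L, hL, hxL⟩ := (h.mem x).1 hx
    obtain ⟨i, hi, rfl⟩ := List.getElem_of_mem hxL
    exact ⟨⟨⟨L, hL⟩, ⟨i, (h.len L hL) ▸ hi⟩⟩, rfl⟩

theorem IsFactor.card_mul {k : ℕ} {T : Set (List V)} {S : Set V}
    (h : IsFactor (· = k) T S) : Nat.card T * k = S.ncard := by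
  have := Nat.card_congr (Equiv.ofBijective _ h.bijective_entry)
  simpa [Nat.card_prod] using this

/-! ### Almost resolvable cycle systems, by coverage -/

/-- A system of almost parallel classes of `k`-cycles, indexed by `C`, together with a class of
`k`-cycles on the set `S`, covering all pairs of points. -/
def System (k : ℕ) (V C : Type) (S : Set V) : Prop :=
  ∃ (F : C → Set (List V)) (H : Set (List V)),
    (∀ c, ∃ p, IsFactor (· = k) (F c) {p}ᶜ) ∧ IsFactor (· = k) H S ∧
    ∀ x y, x ≠ y → (∃ c, Covers (F c) x y) ∨ Covers H x y

/-- A `k`-ARCS of order `2 * k * t + 1`. That no pair is covered twice follows by counting. -/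
def Exists (k t : ℕ) : Prop :=
  ∃ (V C : Type) (_ : Finite V) (_ : Finite C) (S : Set V),
    Nat.card V = 2 * k * t + 1 ∧ Nat.card C = k * t ∧ S.ncard = k * t ∧ System k V C S

theorem System.congr {k : ℕ} {V C V' C' : Type} {S : Set V} (h : System k V C S)
    (e : V ≃ V') (f : C' ≃ C) : System k V' C' (e '' S) := by
  obtain ⟨F, H, hF, hH, hc⟩ := h
  refine ⟨fun c => List.map e '' F (f c), List.map e '' H, fun c => ?_,
    hH.image e.injective.injOn, fun x y hxy => ?_⟩
  · obtain ⟨p, hp⟩ := hF (f c)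
    refine ⟨e p, ?_⟩
    have := hp.image (f := e) e.injective.injOn
    rwa [Set.image_compl_eq e.bijective, Set.image_singleton] at this
  · rcases hc (e.symm x) (e.symm y) (by simpa using hxy) with ⟨c, h⟩ | h
    · left
      refine ⟨f.symm c, ?_⟩
      simpa using h.image e
    · right
      simpa using h.image e

/-- The cyclic sequence of the entries of a list of length `k`. -/
def entry {k : ℕ} [NeZero k] (L : List V) (hL : L.length = k) (i : ZMod k) : V :=
  L[i.val]'(hL.symm ▸ ZMod.val_lt i)

theorem entry_injective {k : ℕ} [NeZero k] {L : List V} (hL : L.length = k) (h : L.Nodup) :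
    Function.Injective (entry L hL) := fun _ _ hij =>
  ZMod.val_injective k ((List.Nodup.getElem_inj_iff h).1 hij)

theorem entry_mem {k : ℕ} [NeZero k] {L : List V} (hL : L.length = k) (i : ZMod k) :
    entry L hL i ∈ L := List.getElem_mem _

theorem Follows.exists_entry {k : ℕ} [NeZero k] {L : List V} (hL : L.length = k) {x y : V}
    (h : Follows L x y) : ∃ i : ZMod k, entry L hL i = x ∧ entry L hL (i + 1) = y := by
  obtain ⟨i, hi, h1, h2⟩ := h.exists_index
  subst hL
  refine ⟨(i : ZMod L.length), ?_, ?_⟩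
  · simp only [entry, ZMod.val_natCast, Nat.mod_eq_of_lt hi, h1]
  · have : ((i : ZMod L.length) + 1) = ((i + 1 : ℕ) : ZMod L.length) := by push_cast; rfl
    simp only [entry, this, ZMod.val_natCast, h2]

set_option maxHeartbeats 400000 in
theorem Exists.hasARCS {k t : ℕ} (hk : 3 ≤ k) (h : Exists k t) : HasARCS k (2 * k * t + 1) := by
  obtain ⟨V, C, _, _, S, hV, hC, hS, hsys⟩ := h
  have : NeZero k := ⟨by omega⟩
  have hk0 : 0 < k := by omega
  have e1 : (2 * k * t + 1 - 1) / 2 = k * t := by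
    rw [Nat.add_sub_cancel, mul_assoc, Nat.mul_div_cancel_left _ two_pos]
  have e2 : (2 * k * t + 1 - 1) / k = 2 * t := by
    rw [Nat.add_sub_cancel, mul_comm 2 k, mul_assoc, Nat.mul_div_cancel_left _ hk0]
  have e3 : (2 * k * t + 1 - 1) / (2 * k) = t := by
    rw [Nat.add_sub_cancel, Nat.mul_div_cancel_left _ (by omega)]
  obtain ⟨F, H, hF, hH, hc⟩ := hsys.congr (Finite.equivFinOfCardEq hV)
    (Finite.equivFinOfCardEq hC).symm
  generalize hS' : (Finite.equivFinOfCardEq hV) '' S = S' at *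
  have hS'c : S'.ncard = k * t := by
    rw [← hS', Set.ncard_image_of_injective _ (Equiv.injective _), hS]
  clear hS' hsys
  have cF : ∀ c, ∃ _ : Finite (F c), Nat.card (F c) = 2 * t := by
    intro c
    obtain ⟨p, hp⟩ := hF c
    have h1 := hp.card_mul
    have h2 : ({p}ᶜ : Set (Fin (2 * k * t + 1))).ncard = 2 * k * t := by
      rw [Set.ncard_compl, Set.ncard_singleton, Nat.card_eq_fintype_card, Fintype.card_fin]
      simp
    have : Finite (F c) := by
      have := Finite.of_injective _ hp.bijective_entry.1
      exact Finite.of_injective (fun L : F c => (L, (0 : Fin k))) fun a b hab => by simpa using hab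
    refine ⟨this, ?_⟩
    rw [h2] at h1
    exact Nat.eq_of_mul_eq_mul_right hk0 (by rw [h1]; ring)
  have cH : ∃ _ : Finite H, Nat.card H = t := by
    have h1 := hH.card_mul
    have : Finite H := by
      have := Finite.of_injective _ hH.bijective_entry.1
      exact Finite.of_injective (fun L : H => (L, (0 : Fin k))) fun a b hab => by simpa using hab
    refine ⟨this, ?_⟩
    rw [hS'c] at h1
    exact Nat.eq_of_mul_eq_mul_right hk0 (by rw [h1]; ring)
  obtain ⟨fH, cH⟩ := cH
  choose fF cF using cF
  let eF := fun c => Finite.equivFinOfCardEq (cF c)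
  let eH := Finite.equivFinOfCardEq cH
  have lF : ∀ c, ∀ L ∈ F c, L.length = k ∧ L.Nodup := fun c L hL => by
    obtain ⟨p, hp⟩ := hF c
    exact ⟨hp.len L hL, hp.nodup L hL⟩
  have lH : ∀ L ∈ H, L.length = k ∧ L.Nodup := fun L hL => ⟨hH.len L hL, hH.nodup L hL⟩
  unfold HasARCS
  rw [e1, e2, e3]
  let apc : Fin (k * t) → Fin (2 * t) → ZMod k → Fin (2 * k * t + 1) := fun c j =>
    entry ((eF c).symm j).1 (lF c _ ((eF c).symm j).2).1
  let hpc : Fin t → ZMod k → Fin (2 * k * t + 1) := fun j =>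
    entry (eH.symm j).1 (lH _ (eH.symm j).2).1
  have iA : ∀ i j, Function.Injective (apc i j) := fun c j =>
    entry_injective _ (lF c _ ((eF c).symm j).2).2
  have iH : ∀ j, Function.Injective (hpc j) := fun j => entry_injective _ (lH _ (eH.symm j).2).2
  have : Fact (1 < k) := ⟨by omega⟩
  have ndA : ∀ i j x, ¬ (s(apc i j x, apc i j (x + 1))).IsDiag := fun i j x hd => by
    have := iA i j (Sym2.mk_isDiag_iff.1 hd)
    simp at this
  have ndH : ∀ j x, ¬ (s(hpc j x, hpc j (x + 1))).IsDiag := fun j x hd => by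
    have := iH j (Sym2.mk_isDiag_iff.1 hd)
    simp at this
  let E : ((Fin (k * t) × Fin (2 * t)) ⊕ Fin t) × ZMod k →
      {e : Sym2 (Fin (2 * k * t + 1)) // ¬ e.IsDiag} := fun p => match p with
    | (.inl (c, j), x) => ⟨s(apc c j x, apc c j (x + 1)), ndA c j x⟩
    | (.inr j, x) => ⟨s(hpc j x, hpc j (x + 1)), ndH j x⟩
  have hEs : Function.Surjective E := by
    rintro ⟨e, he⟩
    induction e with | _ x y
    have hxy : x ≠ y := fun h => he (Sym2.mk_isDiag_iff.2 h)
    rcases hc x y hxy with ⟨c, L, hL, h⟩ | ⟨L, hL, h⟩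
    · have key : ∀ u v, Follows L u v → ∃ p, (E p).1 = s(u, v) := by
        intro u v huv
        obtain ⟨i, h1, h2⟩ := huv.exists_entry (lF c L hL).1
        refine ⟨(.inl (c, eF c ⟨L, hL⟩), i), ?_⟩
        simp only [E, apc, Equiv.symm_apply_apply, h1, h2]
      rcases h with h | h
      · obtain ⟨p, hp⟩ := key x y h
        exact ⟨p, Subtype.ext hp⟩
      · obtain ⟨p, hp⟩ := key y x h
        exact ⟨p, Subtype.ext (hp.trans Sym2.eq_swap)⟩
    · have key : ∀ u v, Follows L u v → ∃ p, (E p).1 = s(u, v) := by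
        intro u v huv
        obtain ⟨i, h1, h2⟩ := huv.exists_entry (lH L hL).1
        refine ⟨(.inr (eH ⟨L, hL⟩), i), ?_⟩
        simp only [E, hpc, Equiv.symm_apply_apply, h1, h2]
      rcases h with h | h
      · obtain ⟨p, hp⟩ := key x y h
        exact ⟨p, Subtype.ext hp⟩
      · obtain ⟨p, hp⟩ := key y x h
        exact ⟨p, Subtype.ext (hp.trans Sym2.eq_swap)⟩
  have hEb : Function.Bijective E := by
    rw [Fintype.bijective_iff_surjective_and_card]
    refine ⟨hEs, ?_⟩
    rw [Sym2.card_subtype_not_diag, Fintype.card_fin, Nat.choose_two_right]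
    simp only [Fintype.card_prod, Fintype.card_sum, Fintype.card_fin, ZMod.card,
      Nat.add_sub_cancel]
    rw [show (2 * k * t + 1) * (2 * k * t) = 2 * ((k * t * (2 * t) + t) * k) by ring,
      Nat.mul_div_cancel_left _ two_pos]
  refine ⟨apc, hpc, iA, iH, ?_, ?_, ?_⟩
  · intro c j₁ j₂ hj
    rw [Set.disjoint_left]
    rintro _ ⟨x, rfl⟩ ⟨y, hy⟩
    obtain ⟨p, hp⟩ := hF c
    apply hj
    have := hp.uniq _ ((eF c).symm j₁).2 _ ((eF c).symm j₂).2 (apc c j₁ x) (entry_mem _ _)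
      (hy ▸ entry_mem _ _)
    exact (eF c).symm.injective (Subtype.ext this)
  · intro j₁ j₂ hj
    rw [Set.disjoint_left]
    rintro _ ⟨x, rfl⟩ ⟨y, hy⟩
    apply hj
    have := hH.uniq _ (eH.symm j₁).2 _ (eH.symm j₂).2 (hpc j₁ x) (entry_mem _ _)
      (hy ▸ entry_mem _ _)
    exact eH.symm.injective (Subtype.ext this)
  · intro e he
    have hiff : ∀ p, e ∈ Sum.elim (fun q : Fin (k * t) × Fin (2 * t) =>
        cycleEdgeSet (apc q.1 q.2)) (fun j => cycleEdgeSet (hpc j)) p ↔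
        ∃ i, E (p, i) = ⟨e, he⟩ := by
      rintro (⟨c, j⟩ | j) <;> constructor <;> rintro ⟨i, hi⟩
      exacts [⟨i, Subtype.ext hi.symm⟩, ⟨i, (congrArg Subtype.val hi).symm⟩,
        ⟨i, Subtype.ext hi.symm⟩, ⟨i, (congrArg Subtype.val hi).symm⟩]
    obtain ⟨⟨p, i⟩, hp⟩ := hEs ⟨e, he⟩
    refine ⟨p, (hiff p).2 ⟨i, hp⟩, fun p' hp' => ?_⟩
    obtain ⟨i', hp'⟩ := (hiff p').1 hp'
    have := hEb.1 (hp'.trans hp.symm)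
    exact (Prod.ext_iff.1 this).1

/-! ### Frames and recursive constructions -/

/-- A frame with groups `{y} × Fin 2 × ZMod k`, `y : Y`: for each group there are `k` classes of
`k`-cycles partitioning the complement of the group, and all pairs of points from different
groups are covered. -/
def IsFrame (k : ℕ) (Y : Type) : Prop :=
  ∃ F : Y → Fin k → Set (List (Y × Fin 2 × ZMod k)),
    (∀ y c, IsFactor (· = k) (F y c) {p | p.1 ≠ y}) ∧
    ∀ p q : Y × Fin 2 × ZMod k, p.1 ≠ q.1 → ∃ y c, Covers (F y c) p q

/-- There is a frame with `u` groups of size `2 * k`. -/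
def Frame (k u : ℕ) : Prop := IsFrame k (Fin u)

theorem IsFrame.congr {k : ℕ} {Y Y' : Type} (h : IsFrame k Y) (e : Y ≃ Y') : IsFrame k Y' := by
  obtain ⟨F, hF, hc⟩ := h
  let e' : Y × Fin 2 × ZMod k ≃ Y' × Fin 2 × ZMod k := Equiv.prodCongr e (Equiv.refl _)
  refine ⟨fun y c => List.map e' '' F (e.symm y) c, fun y c => ?_, fun p q hpq => ?_⟩
  · have := (hF (e.symm y) c).image (f := e') e'.injective.injOn
    convert this using 1
    ext p
    rw [Equiv.image_eq_preimage_symm]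
    simp [e']
  · obtain ⟨y, c, h⟩ := hc (e'.symm p) (e'.symm q) (by simpa [e'] using hpq)
    refine ⟨e y, c, ?_⟩
    simpa using h.image e'

theorem Frame.isFrame {k : ℕ} {Y : Type} [Finite Y] (h : Frame k (Nat.card Y)) : IsFrame k Y :=
  IsFrame.congr h (Finite.equivFin Y).symm

theorem exists_zero (k : ℕ) : Exists k 0 := by
  refine ⟨Unit, Empty, inferInstance, inferInstance, ∅, by simp, by simp, by simp,
    fun c => c.elim, ∅, fun c => c.elim, IsFactor.empty _, fun x y h => absurd rfl h⟩

theorem card_option_prod (k : ℕ) [NeZero k] (G : Type) [Finite G] :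
    Nat.card (Option (G × Fin 2 × ZMod k)) = 2 * k * Nat.card G + 1 := by
  rw [Finite.card_option, Nat.card_prod, Nat.card_prod, Nat.card_fin, Nat.card_zmod]
  ring

theorem Exists.system {k : ℕ} (hk : 0 < k) {G : Type} [Finite G] (h : Exists k (Nat.card G)) :
    ∃ S : Set (Option (G × Fin 2 × ZMod k)), none ∉ S ∧ S.ncard = k * Nat.card G ∧
      System k (Option (G × Fin 2 × ZMod k)) (G × Fin k) S := by
  classical
  have : NeZero k := ⟨hk.ne'⟩
  obtain ⟨V, C, _, _, S, hV, hC, hS, h⟩ := h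
  have h0 : ∃ x, x ∉ S := by
    by_contra! h0
    have h1 : S = Set.univ := Set.eq_univ_of_forall h0
    rw [h1, Set.ncard_univ, hV] at hS
    nlinarith [Nat.zero_le (k * Nat.card G)]
  obtain ⟨x, hx⟩ := h0
  obtain ⟨e⟩ : Nonempty (V ≃ Option (G × Fin 2 × ZMod k)) :=
    Finite.card_eq.1 (by rw [hV, card_option_prod])
  obtain ⟨f⟩ : Nonempty ((G × Fin k) ≃ C) :=
    Finite.card_eq.1 (by rw [hC, Nat.card_prod, Nat.card_fin, mul_comm])
  refine ⟨_, ?_, ?_, h.congr (e.trans (Equiv.swap (e x) none)) f⟩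
  · rintro ⟨y, hy, hyx⟩
    have : (e.trans (Equiv.swap (e x) none)) x = none := Equiv.swap_apply_left _ _
    exact hx ((Equiv.injective _ (hyx.trans this.symm)) ▸ hy)
  · rw [Set.ncard_image_of_injective _ (Equiv.injective _), hS]

/-- Fill in the groups and the blocks of a group divisible design. -/
theorem exists_of_gdd {k : ℕ} (hk : 0 < k) {X γ β : Type} [Finite X] [Fintype γ] (grp : X → γ)
    (B : β → Set X)
    (hB : ∀ x y, grp x ≠ grp y → ∃ b, x ∈ B b ∧ y ∈ B b)
    (hu : ∀ b b' x y, x ∈ B b → y ∈ B b → x ∈ B b' → y ∈ B b' → x ≠ y → b = b')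
    (hg : ∀ b x y, x ∈ B b → y ∈ B b → grp x = grp y → x = y)
    (hF : ∀ b, Frame k (Nat.card (B b)))
    (hE : ∀ g, Exists k (Nat.card {x // grp x = g})) : Exists k (Nat.card X) := by
  have : NeZero k := ⟨hk.ne'⟩
  choose S hS0 hSc hsys using fun g => (hE g).system hk
  choose F H hF' hH hFc using hsys
  choose P hP using hF'
  choose A hA hAc using fun b => (hF b).isFrame
  let iG : ∀ g : γ, Option ({x // grp x = g} × Fin 2 × ZMod k) → Option (X × Fin 2 × ZMod k) :=
    fun g => Option.map (Prod.map Subtype.val id)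
  let iB : ∀ b, (B b) × Fin 2 × ZMod k → Option (X × Fin 2 × ZMod k) :=
    fun b p => some (Prod.map Subtype.val id p)
  have hiG : ∀ g, Function.Injective (iG g) := fun g =>
    Option.map_injective (Subtype.val_injective.prodMap Function.injective_id)
  have hiB : ∀ b, Function.Injective (iB b) := fun b =>
    (Option.some_injective _).comp (Subtype.val_injective.prodMap Function.injective_id)
  have rG : ∀ g p, p ∈ Set.range (iG g) ↔ ∀ x w, p = some (x, w) → grp x = g := by
    intro g p
    constructor
    · rintro ⟨q, rfl⟩ x w hq
      obtain ⟨⟨⟨y, hy⟩, w'⟩, -, hq⟩ := Option.map_eq_some_iff.1 hq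
      obtain ⟨rfl, -⟩ := Prod.ext_iff.1 hq
      exact hy
    · intro h
      rcases p with _ | ⟨x, w⟩
      · exact ⟨none, rfl⟩
      · exact ⟨some (⟨x, h x w rfl⟩, w), rfl⟩
  refine ⟨Option (X × Fin 2 × ZMod k), X × Fin k, inferInstance, inferInstance,
    ⋃ g, iG g '' S g, card_option_prod k X, by rw [Nat.card_prod, Nat.card_fin, mul_comm], ?_,
    fun c => List.map (iG (grp c.1)) '' F (grp c.1) (⟨c.1, rfl⟩, c.2) ∪
      ⋃ b : {b // c.1 ∈ B b}, List.map (iB b.1) '' A b.1 ⟨c.1, b.2⟩ c.2,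
    ⋃ g, List.map (iG g) '' H g, ?_, ?_, ?_⟩
  · have key : ∀ g, (iG g '' S g).ncard = k * Nat.card {x // grp x = g} := fun g => by
      rw [Set.ncard_image_of_injective _ (hiG g), hSc]
    have hdisj : Pairwise (Function.onFun Disjoint fun g => iG g '' S g) := by
      intro g g' hgg
      rw [Function.onFun, Set.disjoint_left]
      rintro _ ⟨p, hp, rfl⟩ ⟨q, hq, hqp⟩
      rcases p with _ | ⟨x, w⟩
      · exact hS0 g hp
      · have h1 := (rG g _).1 ⟨some (x, w), rfl⟩ x.1 w rfl
        have h2 := (rG g' _).1 ⟨q, hqp⟩ x.1 w rfl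
        exact hgg (h1.symm.trans h2)
    rw [← Nat.card_coe_set_eq, Nat.card_congr (Set.unionEqSigmaOfDisjoint hdisj), Nat.card_sigma]
    simp only [Nat.card_coe_set_eq, key]
    rw [← Finset.mul_sum, ← Nat.card_sigma, Nat.card_congr (Equiv.sigmaFiberEquiv grp)]
  · rintro ⟨x, c⟩
    refine ⟨iG (grp x) (P (grp x) (⟨x, rfl⟩, c)), ?_⟩
    have h1 := (hP (grp x) (⟨x, rfl⟩, c)).image (hiG _).injOn
    have h2 := IsFactor.iUnion (K := (· = k))
      (T := fun b : {b // x ∈ B b} => List.map (iB b.1) '' A b.1 ⟨x, b.2⟩ c)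
      (fun b => (hA b.1 ⟨x, b.2⟩ c).image (hiB _).injOn) (by
        rintro ⟨b, hb⟩ ⟨b', hb'⟩ _ ⟨⟨⟨y, hy⟩, w⟩, hyx, rfl⟩ ⟨⟨⟨z, hz⟩, w'⟩, -, hzy⟩
        simp only [iB, Prod.map_apply, id_eq, Option.some.injEq, Prod.mk.injEq] at hzy
        obtain ⟨rfl, -⟩ := hzy
        exact Subtype.ext (hu b b' x z hb hy hb' hz fun h => hyx (Subtype.ext h.symm)))
    convert h1.union h2 ?_ using 1
    · ext p
      simp only [Set.mem_compl_iff, Set.mem_singleton_iff, Set.mem_union, Set.mem_iUnion]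
      constructor
      · intro hp
        by_cases hpr : p ∈ Set.range (iG (grp x))
        · obtain ⟨q, rfl⟩ := hpr
          exact .inl ⟨q, fun h => hp (congrArg _ h), rfl⟩
        · right
          rw [rG] at hpr
          push Not at hpr
          obtain ⟨y, w, rfl, hy⟩ := hpr
          obtain ⟨b, hyb, hxb⟩ := hB y x hy
          refine ⟨⟨b, hxb⟩, (⟨y, hyb⟩, w), ?_, rfl⟩
          intro h
          exact hy (congrArg grp (Subtype.ext_iff.1 h))
      · rintro (⟨q, hq, rfl⟩ | ⟨⟨b, hb⟩, ⟨⟨y, hy⟩, w⟩, hyx, rfl⟩) h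
        · exact hq (hiG _ h)
        · have h1 := (rG (grp x) _).1 ⟨_, h.symm⟩ y w rfl
          exact hyx (Subtype.ext (hg b y x hy hb h1))
    · rw [Set.disjoint_left]
      rintro _ ⟨q, -, rfl⟩ hq
      simp only [Set.mem_iUnion] at hq
      obtain ⟨⟨b, hb⟩, ⟨⟨y, hy⟩, w⟩, hyx, hq⟩ := hq
      have h1 := (rG (grp x) _).1 ⟨_, hq.symm⟩ y w rfl
      exact hyx (Subtype.ext (hg b y x hy hb h1))
  · refine IsFactor.iUnion (fun g => (hH g).image (hiG _).injOn) ?_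
    rintro g g' _ ⟨p, hp, rfl⟩ ⟨q, hq, hqp⟩
    rcases p with _ | ⟨x, w⟩
    · exact absurd hp (hS0 g)
    · have h1 := (rG g _).1 ⟨some (x, w), rfl⟩ x.1 w rfl
      have h2 := (rG g' _).1 ⟨q, hqp⟩ x.1 w rfl
      exact h1.symm.trans h2
  · have key : ∀ p q, p ≠ q → ∀ g, p ∈ Set.range (iG g) → q ∈ Set.range (iG g) →
        (∃ c : X × Fin k, Covers (List.map (iG (grp c.1)) '' F (grp c.1) (⟨c.1, rfl⟩, c.2) ∪
      ⋃ b : {b // c.1 ∈ B b}, List.map (iB b.1) '' A b.1 ⟨c.1, b.2⟩ c.2) p q) ∨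
          Covers (⋃ g, List.map (iG g) '' H g) p q := by
      rintro _ _ hpq g ⟨p, rfl⟩ ⟨q, rfl⟩
      rcases hFc g p q (fun h => hpq (congrArg _ h)) with ⟨⟨⟨x, rfl⟩, c⟩, h⟩ | h
      · exact .inl ⟨(x, c), (h.image _).mono Set.subset_union_left⟩
      · exact .inr ((h.image _).mono (Set.subset_iUnion (fun g => List.map (iG g) '' H g) g))
    intro p q hpq
    rcases p with _ | ⟨x, w⟩
    · rcases q with _ | ⟨y, w'⟩
      · exact absurd rfl hpq
      · exact key _ _ hpq (grp y) ((rG _ _).2 (by simp)) ((rG _ _).2 (by simp))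
    · rcases q with _ | ⟨y, w'⟩
      · exact key _ _ hpq (grp x) ((rG _ _).2 (by simp)) ((rG _ _).2 (by simp))
      · by_cases hxy : grp x = grp y
        · exact key _ _ hpq (grp x) ((rG _ _).2 (by simp)) ((rG _ _).2 (by simp [hxy]))
        · obtain ⟨b, hx, hy⟩ := hB x y hxy
          obtain ⟨⟨z, hz⟩, c, h⟩ := hAc b (⟨x, hx⟩, w) (⟨y, hy⟩, w')
            (fun h => hxy (congrArg grp (Subtype.ext_iff.1 h)))
          refine .inl ⟨(z, c), (h.image (iB b)).mono ?_⟩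
          exact (Set.subset_iUnion (fun b : {b // z ∈ B b} =>
            List.map (iB b.1) '' A b.1 ⟨z, b.2⟩ c) ⟨b, hz⟩).trans Set.subset_union_right

/-- The point in group `j` of the block `(m, b)` of the transversal design with slopes `s`. -/
def tdPoint {R : Type} [CommRing R] {r : ℕ} (s : Fin r → R) (b : R × R) : Fin (r + 1) → R :=
  Fin.snoc (fun i => b.1 * s i + b.2) b.1

theorem exists_tdPoint_eq {R : Type} [CommRing R] {r : ℕ} {s : Fin r → R}
    (hs : ∀ i j, i ≠ j → IsUnit (s i - s j)) {i j : Fin (r + 1)} (hij : i ≠ j) (x y : R) :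
    ∃ b, tdPoint s b i = x ∧ tdPoint s b j = y := by
  have key : ∀ (i : Fin r) (x y : R), ∃ b, tdPoint s b i.castSucc = x ∧
      tdPoint s b (Fin.last r) = y := fun i x y => ⟨(y, x - y * s i), by simp [tdPoint]⟩
  induction i using Fin.lastCases with
  | last =>
    induction j using Fin.lastCases with
    | last => exact absurd rfl hij
    | cast j =>
      obtain ⟨b, h1, h2⟩ := key j y x
      exact ⟨b, h2, h1⟩
  | cast i =>
    induction j using Fin.lastCases with
    | last => exact key i x y
    | cast j =>
      obtain ⟨u, hu⟩ := hs i j (fun h => hij (by rw [h]))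
      have h1 : (↑u⁻¹ : R) * (s i - s j) = 1 := by rw [← hu, Units.inv_mul]
      refine ⟨((x - y) * ↑u⁻¹, y - (x - y) * ↑u⁻¹ * s j), ?_⟩
      simp only [tdPoint, Fin.snoc_castSucc]
      constructor
      · linear_combination (x - y) * h1
      · ring

theorem tdPoint_unique {R : Type} [CommRing R] {r : ℕ} {s : Fin r → R}
    (hs : ∀ i j, i ≠ j → IsUnit (s i - s j)) {i j : Fin (r + 1)} (hij : i ≠ j) {b b' : R × R}
    (hi : tdPoint s b i = tdPoint s b' i) (hj : tdPoint s b j = tdPoint s b' j) : b = b' := by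
  obtain ⟨m, b⟩ := b
  obtain ⟨m', b'⟩ := b'
  induction i using Fin.lastCases with
  | last =>
    induction j using Fin.lastCases with
    | last => exact absurd rfl hij
    | cast j =>
      simp only [tdPoint, Fin.snoc_last, Fin.snoc_castSucc] at hi hj
      subst hi
      rw [add_left_cancel hj]
  | cast i =>
    induction j using Fin.lastCases with
    | last =>
      simp only [tdPoint, Fin.snoc_last, Fin.snoc_castSucc] at hi hj
      subst hj
      rw [add_left_cancel hi]
    | cast j =>
      simp only [tdPoint, Fin.snoc_castSucc] at hi hj
      have h0 : (m - m') * (s i - s j) = 0 := by linear_combination hi - hj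
      have h1 : m = m' := by
        rw [(hs i j (fun h => hij (by rw [h]))).mul_left_eq_zero] at h0
        exact sub_eq_zero.1 h0
      subst h1
      rw [add_left_cancel hi]

/-- Fill in a transversal design whose groups have been truncated to the sizes `n j`,
the first `f` of them being kept in full. -/
theorem exists_of_td {k : ℕ} (hk : 0 < k) {R : Type} [CommRing R] [Fintype R] {r : ℕ}
    {s : Fin r → R} (hs : ∀ i j, i ≠ j → IsUnit (s i - s j)) (n : Fin (r + 1) → ℕ)
    (hn : ∀ j, n j ≤ Nat.card R) (f : ℕ) (hf : ∀ j, j.val < f → n j = Nat.card R)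
    (hfr : f ≤ r + 1) (hF : ∀ u, f ≤ u → u ≤ r + 1 → Frame k u) (hE : ∀ j, Exists k (n j)) :
    Exists k (∑ j, n j) := by
  classical
  have hP : ∀ j, ∃ P : Finset R, P.card = n j := fun j => by
    obtain ⟨P, -, hP⟩ := Finset.exists_subset_card_eq (s := (Finset.univ : Finset R)) (n := n j)
      (by simpa using hn j)
    exact ⟨P, hP⟩
  choose P hP using hP
  have hfull : ∀ j : Fin (r + 1), j.val < f → ∀ x, x ∈ P j := fun j hj x => by
    have : P j = Finset.univ := Finset.eq_univ_of_card _ (by rw [hP, hf j hj]; simp)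
    simp [this]
  let X := Σ j, P j
  have hX : Nat.card X = ∑ j, n j := by
    simp [X, hP]
  rw [← hX]
  have hval : ∀ x y : X, x.1 = y.1 → x.2.1 = y.2.1 → x = y := by
    rintro ⟨i, x⟩ ⟨j, y⟩ h1 h2
    simp only at h1 h2
    subst h1
    rw [Subtype.ext h2]
  refine exists_of_gdd hk (X := X) (β := R × R) Sigma.fst
    (fun b => {x | x.2.1 = tdPoint s b x.1}) ?_ ?_ ?_ ?_ ?_
  · intro x y hxy
    obtain ⟨b, h1, h2⟩ := exists_tdPoint_eq hs hxy x.2.1 y.2.1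
    exact ⟨b, h1.symm, h2.symm⟩
  · intro b b' x y hx hy hx' hy' hxy
    simp only [Set.mem_ofPred_eq] at hx hy hx' hy'
    have hij : x.1 ≠ y.1 := fun h => hxy (hval x y h (by rw [hx, hy, h]))
    exact tdPoint_unique hs hij (hx.symm.trans hx') (hy.symm.trans hy')
  · intro b x y hx hy h
    simp only [Set.mem_ofPred_eq] at hx hy
    exact hval x y h (by rw [hx, hy, h])
  · intro b
    apply hF
    · have h1 := Nat.card_le_card_of_injective
        (fun i : Fin f => (⟨⟨⟨i, i.2.trans_le hfr⟩, ⟨tdPoint s b ⟨i, i.2.trans_le hfr⟩,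
          hfull _ i.2 _⟩⟩, rfl⟩ : {x : X | x.2.1 = tdPoint s b x.1})) (by
            intro i j hij
            simpa [Fin.ext_iff] using congrArg (fun z => z.1.1.val) hij)
      rwa [Nat.card_fin] at h1
    · have h1 := Nat.card_le_card_of_injective
        (fun x : {x : X | x.2.1 = tdPoint s b x.1} => x.1.1) (by
            rintro ⟨x, hx⟩ ⟨y, hy⟩ hij
            simp only [Set.mem_ofPred_eq] at hx hy hij
            exact Subtype.ext (hval x y hij (by rw [hx, hy, hij])))
      rwa [Nat.card_fin] at h1
  · intro j
    have : Nat.card {x : X // x.1 = j} = n j := by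
      rw [← hP j, Nat.card_congr (Equiv.sigmaSubtype j), Nat.card_eq_fintype_card,
        Fintype.card_coe]
    rw [this]
    exact hE j

/-- `k` classes of `k`-cycles on `Fin m × ZMod k` which cover all pairs of points from
cyclically consecutive levels. -/
def Gadget (m k : ℕ) : Prop :=
  ∃ G : Fin k → Set (List (Fin m × ZMod k)),
    (∀ c, IsFactor (· = k) (G c) Set.univ) ∧
    ∀ (i : ℕ) (hi : i < m) (x y : ZMod k),
      ∃ c, Covers (G c) (⟨i, hi⟩, x) (⟨(i + 1) % m, Nat.mod_lt _ (by omega)⟩, y)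

/-- A frame with `u` groups of size two and one class of cycles per group; the cycle lengths
satisfy `K`. -/
def TwoFrame (K : ℕ → Prop) (u : ℕ) : Prop :=
  ∃ T : Fin u → Set (List (Fin u × Fin 2)),
    (∀ y, IsFactor K (T y) {p | p.1 ≠ y}) ∧
    ∀ p q : Fin u × Fin 2, p.1 ≠ q.1 → ∃ y, Covers (T y) p q

theorem TwoFrame.frame {k u : ℕ} (h : TwoFrame (Gadget · k) u) : Frame k u := by
  obtain ⟨T, hT, hc⟩ := h
  choose G hG hGc using fun y (L : T y) => (hT y).len L.1 L.2
  let f : ∀ y, ∀ L : T y, Fin L.1.length × ZMod k → Fin u × Fin 2 × ZMod k :=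
    fun y L p => (L.1[p.1].1, L.1[p.1].2, p.2)
  refine ⟨fun y c => ⋃ L : T y, List.map (f y L) '' G y L c, fun y c => ?_, ?_⟩
  · have h1 := IsFactor.iUnion (K := (· = k)) (T := fun L : T y => List.map (f y L) '' G y L c)
      (S := fun L => f y L '' Set.univ) (fun L => (hG y L c).image (f := f y L) ?_) ?_
    · convert h1 using 1
      ext ⟨v, l, x⟩
      simp only [Set.image_univ, Set.mem_iUnion, Set.mem_range, Set.mem_ofPred_eq]
      rw [show v ≠ y ↔ (v, l) ∈ {p : Fin u × Fin 2 | p.1 ≠ y} from Iff.rfl, (hT y).mem]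
      constructor
      · rintro ⟨L, hL, hv⟩
        obtain ⟨i, hi, h⟩ := List.getElem_of_mem hv
        exact ⟨⟨L, hL⟩, (⟨i, hi⟩, x), by simp [f, h]⟩
      · rintro ⟨L, ⟨i, z⟩, h⟩
        refine ⟨L.1, L.2, ?_⟩
        simp only [f, Prod.mk.injEq] at h
        have : L.1[i] = (v, l) := Prod.ext h.1 h.2.1
        rw [← this]
        exact List.getElem_mem _
    · rintro ⟨i, x⟩ - ⟨j, z⟩ - h
      simp only [f, Prod.mk.injEq] at h
      have h1 : L.1[i] = L.1[j] := Prod.ext h.1 h.2.1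
      have h2 := (List.Nodup.getElem_inj_iff ((hT y).nodup _ L.2)).1 h1
      exact Prod.ext (Fin.ext h2) h.2.2
    · rintro L L' _ ⟨⟨i, x⟩, -, rfl⟩ ⟨⟨j, z⟩, -, h⟩
      simp only [f, Prod.mk.injEq] at h
      have h1 : L'.1[j] = L.1[i] := Prod.ext h.1 h.2.1
      exact Subtype.ext ((hT y).uniq _ L.2 _ L'.2 _ (List.getElem_mem _)
        (h1 ▸ List.getElem_mem _))
  · have key : ∀ (y) (L : T y) (p q : Fin u × Fin 2) (x z : ZMod k), Follows L.1 p q →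
        ∃ c, Covers (⋃ L : T y, List.map (f y L) '' G y L c) (p.1, p.2, x) (q.1, q.2, z) := by
      intro y L p q x z h
      obtain ⟨i, hi, h1, h2⟩ := h.exists_index
      obtain ⟨c, hc⟩ := hGc y L i hi x z
      refine ⟨c, ?_⟩
      have h3 := (hc.image (f y L)).mono
        (Set.subset_iUnion (fun L : T y => List.map (f y L) '' G y L c) L)
      simpa [f, h1, h2] using h3
    rintro ⟨v, l, x⟩ ⟨w, l', z⟩ hpq
    obtain ⟨y, L, hL, h | h⟩ := hc (v, l) (w, l') hpq
    · obtain ⟨c, hc⟩ := key y ⟨L, hL⟩ _ _ x z h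
      exact ⟨y, c, hc⟩
    · obtain ⟨c, hc⟩ := key y ⟨L, hL⟩ _ _ z x h
      exact ⟨y, c, hc.symm⟩

/-! ### Combining the recursive constructions -/

/-- A ring of order `q` with `r` elements whose pairwise differences are units. -/
def HasSlopes (r q : ℕ) : Prop :=
  ∃ (R : Type) (_ : CommRing R) (_ : Fintype R) (s : Fin r → R),
    Nat.card R = q ∧ ∀ i j, i ≠ j → IsUnit (s i - s j)

theorem hasSlopes_prime_pow {p n r : ℕ} (hp : p.Prime) (hn : n ≠ 0) (hr : r ≤ p ^ n) :
    HasSlopes r (p ^ n) := by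
  have : Fact p.Prime := ⟨hp⟩
  have hc := GaloisField.card p n hn
  have : Finite (GaloisField p n) := Nat.finite_of_card_ne_zero
    (by rw [hc]; exact pow_ne_zero _ hp.ne_zero)
  let e := Finite.equivFinOfCardEq hc
  refine ⟨GaloisField p n, inferInstance, Fintype.ofFinite _, fun i => e.symm (Fin.castLE hr i),
    hc, fun i j hij => ?_⟩
  rw [isUnit_iff_ne_zero, sub_ne_zero]
  exact fun h => hij (Fin.castLE_injective hr (e.symm.injective h))

theorem hasSlopes_coprime_six {m : ℕ} (hm : m % 6 = 1 ∨ m % 6 = 5) : HasSlopes 5 m := by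
  have : NeZero m := ⟨by omega⟩
  have key : ∀ d : ℕ, 1 ≤ d → d ≤ 4 → IsUnit (d : ZMod m) := by
    intro d h1 h2
    rw [ZMod.isUnit_iff_coprime]
    have c2 : Nat.Coprime 2 m := (Nat.Prime.coprime_iff_not_dvd Nat.prime_two).2 (by omega)
    have c3 : Nat.Coprime 3 m := (Nat.Prime.coprime_iff_not_dvd Nat.prime_three).2 (by omega)
    interval_cases d
    exacts [Nat.coprime_one_left m, c2, c3, Nat.Coprime.mul_left c2 c2]
  refine ⟨ZMod m, inferInstance, inferInstance, fun i => (i.val : ZMod m), by simp,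
    fun i j hij => ?_⟩
  have hij' : i.val ≠ j.val := fun h => hij (Fin.ext h)
  rcases lt_or_gt_of_ne hij' with h | h
  · rw [← neg_sub, IsUnit.neg_iff, ← Nat.cast_sub h.le]
    exact key _ (by omega) (by omega)
  · rw [← Nat.cast_sub h.le]
    exact key _ (by omega) (by omega)

variable {k : ℕ}

theorem exists_td {r q : ℕ} (hk : 0 < k) (h : HasSlopes r q) (n : Fin (r + 1) → ℕ) (f : ℕ)
    (hn : ∀ j, n j ≤ q) (hf : ∀ j, j.val < f → n j = q) (hfr : f ≤ r + 1)
    (hF : ∀ u, f ≤ u → u ≤ r + 1 → Frame k u) (hE : ∀ j, Exists k (n j)) :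
    Exists k (∑ j, n j) := by
  obtain ⟨R, _, _, s, rfl, hs⟩ := h
  exact exists_of_td hk hs n hn f hf hfr hF hE

/-- Six groups, four of them full. -/
theorem exists_td_four {q x y : ℕ} (hk : 0 < k) (hF4 : Frame k 4) (hF5 : Frame k 5)
    (hF6 : Frame k 6) (hq : HasSlopes 5 q) (hx : x ≤ q) (hy : y ≤ q) (h : Exists k q)
    (hEx : Exists k x) (hEy : Exists k y) : Exists k (4 * q + x + y) := by
  have := exists_td hk hq ![q, q, q, q, x, y] 4
    (by simp [Fin.forall_fin_succ, hx, hy]) (by simp [Fin.forall_fin_succ]) (by norm_num)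
    (fun u h1 h2 => by interval_cases u <;> assumption)
    (by simp [Fin.forall_fin_succ, h, hEx, hEy])
  convert this using 1
  simp [Fin.sum_univ_succ]
  ring

/-- Six groups, three of them full. -/
theorem exists_td_three {q x y z : ℕ} (hk : 0 < k) (hF3 : Frame k 3) (hF4 : Frame k 4)
    (hF5 : Frame k 5) (hF6 : Frame k 6) (hq : HasSlopes 5 q) (hx : x ≤ q) (hy : y ≤ q)
    (hz : z ≤ q) (h : Exists k q) (hEx : Exists k x) (hEy : Exists k y) (hEz : Exists k z) :
    Exists k (3 * q + x + y + z) := by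
  have := exists_td hk hq ![q, q, q, x, y, z] 3
    (by simp [Fin.forall_fin_succ, hx, hy, hz]) (by simp [Fin.forall_fin_succ]) (by norm_num)
    (fun u h1 h2 => by interval_cases u <;> assumption)
    (by simp [Fin.forall_fin_succ, h, hEx, hEy, hEz])
  convert this using 1
  simp [Fin.sum_univ_succ]
  ring

theorem exists_td_order_four {x : ℕ} (hk : 0 < k) (hF4 : Frame k 4) (hF5 : Frame k 5)
    (hx : x ≤ 4) (h : Exists k 4) (hEx : Exists k x) : Exists k (16 + x) := by
  have := exists_td hk (hasSlopes_prime_pow (r := 4) Nat.prime_two two_ne_zero le_rfl)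
    ![4, 4, 4, 4, x] 4
    (by simp [Fin.forall_fin_succ, hx]) (by simp [Fin.forall_fin_succ]) (by norm_num)
    (fun u h1 h2 => by interval_cases u <;> assumption)
    (by simp [Fin.forall_fin_succ, h, hEx])
  convert this using 1
  simp [Fin.sum_univ_succ]
  ring

theorem exists_td_order_four_three {x y : ℕ} (hk : 0 < k) (hF3 : Frame k 3) (hF4 : Frame k 4)
    (hF5 : Frame k 5) (hx : x ≤ 4) (hy : y ≤ 4) (h : Exists k 4) (hEx : Exists k x)
    (hEy : Exists k y) : Exists k (12 + x + y) := by
  have := exists_td hk (hasSlopes_prime_pow (r := 4) Nat.prime_two two_ne_zero le_rfl)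
    ![4, 4, 4, x, y] 3
    (by simp [Fin.forall_fin_succ, hx, hy]) (by simp [Fin.forall_fin_succ]) (by norm_num)
    (fun u h1 h2 => by interval_cases u <;> assumption)
    (by simp [Fin.forall_fin_succ, h, hEx, hEy])
  convert this using 1
  simp [Fin.sum_univ_succ]
  ring

theorem exists_td_order_three {x : ℕ} (hk : 0 < k) (hF3 : Frame k 3) (hF4 : Frame k 4)
    (hx : x ≤ 3) (h : Exists k 3) (hEx : Exists k x) : Exists k (9 + x) := by
  have := exists_td hk (hasSlopes_prime_pow (r := 3) (n := 1) Nat.prime_three one_ne_zero le_rfl)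
    ![3, 3, 3, x] 3
    (by simp [Fin.forall_fin_succ, hx]) (by simp [Fin.forall_fin_succ]) (by norm_num)
    (fun u h1 h2 => by interval_cases u <;> assumption)
    (by simp [Fin.forall_fin_succ, h, hEx])
  convert this using 1
  simp [Fin.sum_univ_succ]
  ring

theorem exists_twelve (hk : 0 < k) (hF4 : Frame k 4) (h : Exists k 3) : Exists k 12 := by
  have := exists_td hk (hasSlopes_prime_pow (r := 3) (n := 1) Nat.prime_three one_ne_zero le_rfl)
    ![3, 3, 3, 3] 4
    (by simp [Fin.forall_fin_succ]) (by simp [Fin.forall_fin_succ]) (by norm_num)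
    (fun u h1 h2 => by interval_cases u; assumption)
    (by simp [Fin.forall_fin_succ, h])
  simpa [Fin.sum_univ_succ] using this

theorem exists_add_eq (q z : ℕ) (hq : 5 ≤ q) (hz : 3 ≤ z) (hzq : z ≤ 2 * q) :
    ∃ x y, x + y = z ∧ x ≤ q ∧ y ≤ q ∧ (x = 0 ∨ 3 ≤ x) ∧ (y = 0 ∨ 3 ≤ y) := by
  rcases le_or_gt z q with h | h
  · exact ⟨z, 0, by omega⟩
  · rcases le_or_gt z (q + 2) with h | h
    · exact ⟨z - 3, 3, by omega⟩
    · exact ⟨q, z - q, by omega⟩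

theorem exists_modulus {t : ℕ} (ht : 23 ≤ t) :
    ∃ q, 5 ≤ q ∧ 4 * q + 3 ≤ t ∧ t ≤ 6 * q ∧ HasSlopes 5 q := by
  have h1 : (∃ q, (q % 6 = 1 ∨ q % 6 = 5) ∧ 5 ≤ q ∧ 4 * q + 3 ≤ t ∧ t ≤ 6 * q) ∨
      (43 ≤ t ∧ t ≤ 46) := by
    by_cases h2 : t ≤ 30
    · exact .inl ⟨5, by omega⟩
    by_cases h3 : t ≤ 42
    · exact .inl ⟨7, by omega⟩
    by_cases h4 : t ≤ 46
    · exact .inr (by omega)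
    by_cases h5 : t ≤ 55
    · exact .inl ⟨11, by omega⟩
    left
    have h6 : ∃ m, t ≤ 6 * m ∧ 6 * m ≤ t + 5 := ⟨(t + 5) / 6, by omega, by omega⟩
    obtain ⟨m, h7, h8⟩ := h6
    have h9 : ∃ e ≤ 3, (m + e) % 6 = 1 ∨ (m + e) % 6 = 5 := by
      have := Nat.mod_lt m (show 0 < 6 by norm_num)
      by_cases h10 : m % 6 = 0
      · exact ⟨1, by omega⟩
      by_cases h11 : m % 6 = 1
      · exact ⟨0, by omega⟩
      · exact ⟨5 - m % 6, by omega⟩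
    obtain ⟨e, he, h⟩ := h9
    exact ⟨m + e, h, by omega⟩
  rcases h1 with ⟨q, h1, h2, h3, h4⟩ | ⟨h1, h2⟩
  · exact ⟨q, h2, h3, h4, hasSlopes_coprime_six h1⟩
  · exact ⟨9, by norm_num, by omega, by omega,
      hasSlopes_prime_pow (n := 2) Nat.prime_three two_ne_zero (by norm_num)⟩

theorem exists_of_le_twentyTwo (hk : 0 < k) (hF4 : Frame k 4) (hF5 : Frame k 5)
    (hF6 : Frame k 6) (h : ∀ t, 3 ≤ t → t ≤ 22 → Exists k t) (t : ℕ) (ht : 3 ≤ t) :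
    Exists k t := by
  induction t using Nat.strong_induction_on with
  | _ t ih =>
    by_cases h22 : t ≤ 22
    · exact h t ht h22
    obtain ⟨q, hq, h1, h2, hs⟩ := exists_modulus (t := t) (by omega)
    obtain ⟨x, y, hz, hx, hy, hx3, hy3⟩ := exists_add_eq q (t - 4 * q) hq (by omega) (by omega)
    have key : ∀ x, x ≤ q → (x = 0 ∨ 3 ≤ x) → Exists k x := by
      rintro x hxq (rfl | h3)
      · exact exists_zero k
      · exact ih x (by omega) h3
    have := exists_td_four hk hF4 hF5 hF6 hs hx hy (key q le_rfl (.inr (by omega)))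
      (key x hx hx3) (key y hy hy3)
    rwa [show 4 * q + x + y = t by omega] at this

theorem exists_of_le_fifteen (hk : 0 < k) (hF4 : Frame k 4) (hF5 : Frame k 5) (hF6 : Frame k 6)
    (h1 : Exists k 1) (h : ∀ t, 3 ≤ t → t ≤ 15 → Exists k t) (h18 : Exists k 18) (t : ℕ)
    (ht : 3 ≤ t) : Exists k t := by
  have h0 := exists_zero k
  have h3 := h 3 (by norm_num) (by norm_num)
  have h4 := h 4 (by norm_num) (by norm_num)
  have h5 := h 5 (by norm_num) (by norm_num)
  have s5 : HasSlopes 5 5 := hasSlopes_coprime_six (by norm_num)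
  refine exists_of_le_twentyTwo hk hF4 hF5 hF6 (fun t ht ht' => ?_) t ht
  by_cases h15 : t ≤ 15
  · exact h t ht h15
  have : t = 16 ∨ t = 17 ∨ t = 18 ∨ t = 19 ∨ t = 20 ∨ t = 21 ∨ t = 22 := by omega
  rcases this with rfl | rfl | rfl | rfl | rfl | rfl | rfl
  · exact exists_td_order_four hk hF4 hF5 (by norm_num) h4 h0
  · exact exists_td_order_four hk hF4 hF5 (by norm_num) h4 h1
  · exact h18
  · exact exists_td_order_four hk hF4 hF5 (by norm_num) h4 h3
  · exact exists_td_order_four hk hF4 hF5 (by norm_num) h4 h4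
  · exact exists_td_four hk hF4 hF5 hF6 s5 (by norm_num) (Nat.zero_le _) h5 h1 h0
  · exact exists_td_four hk hF4 hF5 hF6 s5 (by norm_num) (by norm_num) h5 h1 h1

/-- Fill in the groups of a frame. -/
theorem Frame.exists {u : ℕ} (hk : 0 < k) (hF : Frame k u) (h1 : Exists k 1) : Exists k u := by
  have := exists_of_gdd hk (X := Fin u) (β := Unit) id (fun _ => Set.univ)
    (by simp) (by simp) (by simp) (by simpa using hF) (by simpa using fun _ => h1)
  simpa using this

/-- Fill in a group divisible design given explicitly. -/
theorem exists_of_gdd_fin {t g m : ℕ} (hk : 0 < k) (grp : Fin t → Fin g)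
    (B : Fin m → Finset (Fin t))
    (hB : ∀ x y, grp x ≠ grp y → ∃ b, x ∈ B b ∧ y ∈ B b)
    (hu : ∀ x y, x ≠ y → ∀ b b', x ∈ B b → y ∈ B b → x ∈ B b' → y ∈ B b' → b = b')
    (hg : ∀ b, ∀ x ∈ B b, ∀ y ∈ B b, grp x = grp y → x = y)
    (hF : ∀ b, Frame k (B b).card)
    (hE : ∀ j, Exists k (Finset.univ.filter fun x => grp x = j).card) : Exists k t := by
  have := exists_of_gdd hk (X := Fin t) grp (fun b => (B b : Set (Fin t))) hB
    (fun b b' x y h1 h2 h3 h4 h5 => hu x y h5 b b' h1 h2 h3 h4)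
    (fun b x y hx hy => hg b x hx y hy) (fun b => by simpa using hF b)
    (fun j => by simpa [Fintype.card_subtype] using hE j)
  simpa using this

/-! ### Explicit systems

Points are coded by natural numbers below `n`. A class of cycles is given as a list of lists:
its head lists the points missed by the class, its tail lists the cycles. -/

/-- `List.map` in a form that the kernel evaluates quickly. -/
noncomputable def kmap {α β : Type} (f : α → β) (l : List α) : List β :=
  List.rec [] (fun a _ ih => f a :: ih) l

/-- `List.append` in a form that the kernel evaluates quickly. -/
noncomputable def kappend {α : Type} (l m : List α) : List α := List.rec m (fun a _ ih => a :: ih) l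

/-- `List.length` in a form that the kernel evaluates quickly. -/
noncomputable def klength {α : Type} (l : List α) : ℕ := List.rec 0 (fun _ _ ih => Nat.succ ih) l

/-- `List.flatMap` in a form that the kernel evaluates quickly. -/
noncomputable def kbind {α β : Type} (f : α → List β) (l : List α) : List β :=
  List.rec [] (fun a _ ih => kappend (f a) ih) l

/-- `List.filter` in a form that the kernel evaluates quickly. -/
noncomputable def kfilter {α : Type} (f : α → Bool) (l : List α) : List α :=
  List.rec [] (fun a _ ih => Bool.rec ih (a :: ih) (f a)) l

/-- `List.range` in a form that the kernel evaluates quickly. -/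
noncomputable def krange (n : ℕ) : List ℕ :=
  Nat.rec (motive := fun _ => List ℕ → List ℕ) id (fun i ih l => ih (i :: l)) n []

theorem kmap_eq {α β : Type} (f : α → β) (l : List α) : kmap f l = l.map f := by
  induction l with
  | nil => rfl
  | cons a l ih => exact congrArg (f a :: ·) ih

theorem kappend_eq {α : Type} (l m : List α) : kappend l m = l ++ m := by
  induction l with
  | nil => rfl
  | cons a l ih => exact congrArg (a :: ·) ih

theorem klength_eq {α : Type} (l : List α) : klength l = l.length := by
  induction l with
  | nil => rfl
  | cons a l ih => exact congrArg Nat.succ ih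

theorem kbind_eq {α β : Type} (f : α → List β) (l : List α) : kbind f l = l.flatMap f := by
  induction l with
  | nil => rfl
  | cons a l ih => exact (congrArg (kappend (f a)) ih).trans (kappend_eq _ _)

theorem kfilter_eq {α : Type} (f : α → Bool) (l : List α) : kfilter f l = l.filter f := by
  induction l with
  | nil => rfl
  | cons a l ih =>
    have : kfilter f (a :: l) = Bool.rec (kfilter f l) (a :: kfilter f l) (f a) := rfl
    rw [this, List.filter_cons, ih]
    cases f a <;> rfl

theorem krange_eq (n : ℕ) : krange n = List.range n := by
  have h : ∀ l, Nat.rec (motive := fun _ => List ℕ → List ℕ) id (fun i ih l => ih (i :: l)) n l =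
      List.range n ++ l := by
    induction n with
    | zero => exact fun l => rfl
    | succ n ih => exact fun l => (ih (n :: l)).trans (by simp [List.range_succ])
  exact (h []).trans (List.append_nil _)

/-- The set of the entries of a list, as a bit mask. -/
noncomputable def bitsOf (l : List ℕ) : ℕ :=
  List.rec 0 (fun j _ a => Nat.lor (Nat.shiftLeft 1 j) a) l

/-- The set of the entries of a list of lists, as a bit mask. -/
noncomputable def bits (L : List (List ℕ)) : ℕ := List.rec 0 (fun l _ a => Nat.lor (bitsOf l) a) L

theorem testBit_bitsOf (l : List ℕ) (j : ℕ) : (bitsOf l).testBit j = decide (j ∈ l) := by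
  induction l with
  | nil => simp [bitsOf]
  | cons a l ih =>
    have : bitsOf (a :: l) = (1 <<< a) ||| bitsOf l := rfl
    rw [this, Nat.testBit_or, ih, Nat.one_shiftLeft, Nat.testBit_two_pow]
    simp [eq_comm]

theorem testBit_bits (L : List (List ℕ)) (j : ℕ) :
    (bits L).testBit j = decide (∃ l ∈ L, j ∈ l) := by
  induction L with
  | nil => simp [bits]
  | cons a l ih =>
    have : bits (a :: l) = bitsOf a ||| bits l := rfl
    rw [this, Nat.testBit_or, ih, testBit_bitsOf]
    simp

/-- Every entry of a list in `A` is an entry of a list in `B`. -/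
noncomputable def subList (A B : List (List ℕ)) : Bool := Nat.beq (Nat.lor (bits B) (bits A)) (bits B)

theorem subList_spec {A B : List (List ℕ)} (h : subList A B = true) {l : List ℕ} (hl : l ∈ A)
    {j : ℕ} (hj : j ∈ l) : ∃ l' ∈ B, j ∈ l' := by
  have h1 : bits B ||| bits A = bits B := Nat.eq_of_beq_eq_true h
  have h2 := congrArg (fun m => m.testBit j) h1
  simp only [Nat.testBit_or, testBit_bits] at h2
  have h3 : ∃ l ∈ A, j ∈ l := ⟨l, hl, hj⟩
  simpa [h3] using h2

/-- The class has the right cycle lengths, and every point below `n` occurs exactly once. -/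
noncomputable def classOK (K : ℕ → Bool) (n : ℕ) (T : List (List ℕ)) : Bool :=
  T.tail.all (fun c => K (klength c)) && Nat.ble (klength (kbind id T)) n && subList [krange n] T

/-- Codes for the pairs of consecutive entries, in both orders. -/
noncomputable def steps (n : ℕ) (l : List ℕ) : List ℕ :=
  List.rec [] (fun a l ih => List.rec ih (fun b _ _ =>
    Nat.add (Nat.mul a n) b :: Nat.add (Nat.mul b n) a :: ih) l) l

/-- All pairs related by `need` are covered by the classes in `D`. -/
noncomputable def pairsOK (n : ℕ) (need : ℕ → ℕ → Bool) (D : List (List (List ℕ))) : Bool :=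
  subList
    (kmap (fun a => kmap (Nat.add (Nat.mul a n)) (kfilter (need a) (krange n))) (krange n))
    (kmap (fun T => kbind (fun c => steps n (kappend c (c.take 1))) T.tail) D)

/-- Develop each class cyclically modulo `s`, fixing the points from `N` on. -/
noncomputable def develop (s N r : ℕ) (D : List (List (List ℕ))) : List (List (List ℕ)) :=
  kbind (fun T => kmap (fun i => kmap (kmap fun v => Bool.rec v
    (Nat.add (Nat.mul (Nat.div v s) s) (Nat.mod (Nat.add v i) s)) (Nat.blt v N)) T) (krange r)) D

/-- Prepend to a class the list of the points below `n` that it misses. -/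
noncomputable def complete (n : ℕ) (C : List (List ℕ)) : List (List ℕ) :=
  kfilter (fun v => Nat.beq (Nat.land (Nat.shiftRight (bits C) v) 1) 0) (krange n) :: C

theorem mem_steps {n : ℕ} {l : List ℕ} {j : ℕ} (h : j ∈ steps n l) :
    ∃ a b, [a, b] <:+: l ∧ (j = a * n + b ∨ j = b * n + a) := by
  induction l with
  | nil => simp [steps] at h
  | cons a l ih =>
    rcases l with _ | ⟨b, l⟩
    · simp [steps] at h
    · replace h : j ∈ (a * n + b) :: (b * n + a) :: steps n (b :: l) := h
      simp only [List.mem_cons] at h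
      rcases h with h | h | h
      · exact ⟨a, b, ⟨[], l, rfl⟩, .inl h⟩
      · exact ⟨a, b, ⟨[], l, rfl⟩, .inr h⟩
      · obtain ⟨c, d, h1, h2⟩ := ih h
        exact ⟨c, d, h1.trans (List.infix_cons (List.infix_refl _)), h2⟩

theorem classOK_spec {K : ℕ → Bool} {n : ℕ} {T : List (List ℕ)} (h : classOK K n T = true) :
    IsFactor (fun m => K m = true) {L | L ∈ T.tail} {v | v < n ∧ v ∉ T.headD []} ∧
      (T.headD []).Nodup ∧ ∀ v ∈ T.headD [], v < n := by
  simp only [classOK, Bool.and_eq_true, List.all_eq_true, Nat.ble_eq, krange_eq, kbind_eq,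
    klength_eq, List.flatMap_id] at h
  obtain ⟨⟨h1, h2⟩, h3⟩ := h
  have h4 : IsFactor (fun _ => True) {L | L ∈ T} (Finset.range n : Set ℕ) :=
    IsFactor.of_card (fun _ _ => trivial) (by simpa using h2) (fun x hx => by
      rw [List.mem_flatten]
      exact subList_spec h3 (List.mem_singleton_self _)
        (List.mem_range.2 (Finset.mem_range.1 hx)))
  have h5 : T.flatten.Nodup := by
    rw [← Multiset.coe_nodup, ← Multiset.toFinset_card_eq_card_iff_nodup]
    apply le_antisymm
    · exact Multiset.toFinset_card_le _
    · have h6 : Finset.range n ⊆ (T.flatten : Multiset ℕ).toFinset := fun x hx => by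
        rw [Multiset.mem_toFinset, Multiset.mem_coe, List.mem_flatten]
        exact (h4.mem x).1 hx
      have := Finset.card_le_card h6
      rw [Finset.card_range] at this
      exact h2.trans this
  have hlt : ∀ L ∈ T, ∀ v ∈ L, v < n := fun L hL v hv => by
    simpa using (h4.mem v).2 ⟨L, hL, hv⟩
  rcases T with _ | ⟨m, T⟩
  · refine ⟨⟨by simp, by simp, by simp, fun x => ?_⟩, by simp, by simp⟩
    have := h4.mem x
    simpa using this
  · simp only [List.tail_cons, List.headD_cons] at h1 ⊢
    rw [List.flatten_cons, List.nodup_append] at h5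
    refine ⟨IsFactor.of_nodup_flatten h1 h5.2.1 fun x => ?_, h5.1, hlt m List.mem_cons_self⟩
    have := h4.mem x
    simp only [Finset.coe_range, Set.mem_Iio, List.mem_cons, Set.mem_ofPred_eq,
      exists_eq_or_imp] at this
    rw [Set.mem_ofPred_eq, this, List.mem_flatten]
    constructor
    · rintro ⟨h | h, h'⟩
      · exact absurd h h'
      · exact h
    · intro h
      exact ⟨.inr h, fun h' => h5.2.2 x h' x (List.mem_flatten.2 h) rfl⟩

theorem pairsOK_spec {n : ℕ} {need : ℕ → ℕ → Bool} {D : List (List (List ℕ))}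
    (h : pairsOK n need D = true) (hD : ∀ T ∈ D, ∀ c ∈ T.tail, ∀ v ∈ c, v < n)
    {a b : ℕ} (ha : a < n) (hb : b < n) (hab : need a b = true) :
    ∃ T ∈ D, Covers {L | L ∈ T.tail} a b := by
  simp only [pairsOK, krange_eq, kmap_eq, kbind_eq, kfilter_eq, kappend_eq] at h
  obtain ⟨l, hl, hj⟩ := subList_spec h (j := a * n + b)
    (List.mem_map.2 ⟨a, List.mem_range.2 ha, rfl⟩)
    (List.mem_map.2 ⟨b, List.mem_filter.2 ⟨List.mem_range.2 hb, hab⟩, rfl⟩)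
  obtain ⟨T, hT, rfl⟩ := List.mem_map.1 hl
  obtain ⟨c, hc, hj⟩ := List.mem_flatMap.1 hj
  obtain ⟨x, y, hxy, hj⟩ := mem_steps hj
  have hmem : ∀ v ∈ [x, y], v < n := fun v hv => by
    have := hxy.subset hv
    rw [List.mem_append] at this
    exact hD T hT c hc v (this.elim id fun h => List.mem_of_mem_take h)
  have hx := hmem x (by simp)
  have hy := hmem y (by simp)
  have key : ∀ x y, x < n → y < n → a * n + b = x * n + y → a = x ∧ b = y := by
    intro x y hx hy h
    have h1 := congrArg (· / n) h
    have h2 := congrArg (· % n) h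
    simp only [Nat.mul_add_mod', Nat.mod_eq_of_lt hb, Nat.mod_eq_of_lt hy] at h2
    subst h2
    have := Nat.add_right_cancel h
    exact ⟨Nat.eq_of_mul_eq_mul_right (by omega) this, rfl⟩
  refine ⟨T, hT, c, hc, ?_⟩
  rcases hj with hj | hj
  · obtain ⟨rfl, rfl⟩ := key x y hx hy hj
    exact .inl hxy
  · obtain ⟨rfl, rfl⟩ := key y x hy hx hj
    exact .inr hxy

/-- The classes described by explicit data, transported along a numbering of the points. -/
theorem exists_of_data_aux {V : Type} {n : ℕ} (e : Fin n ≃ V) {K : ℕ → Bool}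
    {need : ℕ → ℕ → Bool} {D : List (List (List ℕ))}
    (hD : D.all (classOK K n) = true) (hp : pairsOK n need D = true) :
    ∃ F : List (List ℕ) → Set (List V),
      (∀ T ∈ D, IsFactor (fun m => K m = true) (F T) {x | (e.symm x).val ∉ T.headD []}) ∧
      ∀ x y, need (e.symm x) (e.symm y) = true → ∃ T ∈ D, Covers (F T) x y := by
  rw [List.all_eq_true] at hD
  rcases Nat.eq_zero_or_pos n with rfl | hn
  · refine ⟨fun _ => ∅, fun T hT => ⟨by simp, by simp, by simp, fun x => (e.symm x).elim0⟩,
      fun x => (e.symm x).elim0⟩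
  have : NeZero n := ⟨hn.ne'⟩
  let f : ℕ → V := fun v => e (Fin.ofNat n v)
  have hf : ∀ x : V, f (e.symm x).val = x := fun x => by simp [f]
  have hfv : ∀ v < n, (e.symm (f v)).val = v := fun v hv => by simp [f, Nat.mod_eq_of_lt hv]
  refine ⟨fun T => List.map f '' {L | L ∈ T.tail}, fun T hT => ?_, fun x y hxy => ?_⟩
  · have h1 := (classOK_spec (hD T hT)).1.image (f := f) fun v hv w hw h => by
      rw [← hfv v hv.1, ← hfv w hw.1, h]
    convert h1 using 1
    ext x
    constructor
    · intro hx
      exact ⟨_, ⟨(e.symm x).2, hx⟩, hf x⟩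
    · rintro ⟨v, ⟨hv, hvT⟩, rfl⟩
      rw [Set.mem_ofPred_eq, hfv v hv]
      exact hvT
  · obtain ⟨T, hT, h⟩ := pairsOK_spec hp (fun T hT c hc v hv =>
      (((classOK_spec (hD T hT)).1.mem v).2 ⟨c, hc, hv⟩).1) (e.symm x).2 (e.symm y).2 hxy
    refine ⟨T, hT, ?_⟩
    have := h.image f
    rwa [hf, hf] at this

/-- A check that `D` and `H` are the almost parallel classes and the half-parallel class of
a system of order `2 * k * t + 1`. -/
noncomputable def checkExists (k t : ℕ) (D : List (List (List ℕ))) (H : List (List ℕ)) : Bool :=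
  D.length == k * t && D.all (fun T => (T.headD []).length == 1) &&
    (H.headD []).length == k * t + 1 && (H :: D).all (classOK (Nat.beq k) (2 * k * t + 1)) &&
    pairsOK (2 * k * t + 1) (fun a b => !Nat.beq a b) (H :: D)

theorem exists_of_data {k t : ℕ} {D : List (List (List ℕ))} {H : List (List ℕ)}
    (h : checkExists k t D H = true) : Exists k t := by
  simp only [checkExists, Bool.and_eq_true, beq_iff_eq] at h
  obtain ⟨⟨⟨⟨h1, h2⟩, h3⟩, h4⟩, h5⟩ := h
  rw [List.all_eq_true] at h2
  obtain ⟨F, hF, hc⟩ := exists_of_data_aux (Equiv.refl (Fin (2 * k * t + 1))) h4 h5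
  replace hF := fun T hT => (hF T hT).mono fun m h => (Nat.eq_of_beq_eq_true h).symm
  rw [List.all_eq_true] at h4
  refine ⟨Fin (2 * k * t + 1), Fin D.length, inferInstance, inferInstance,
    {x | x.val ∉ H.headD []}, by simp, by simpa using h1, ?_, fun c => F D[c], F H,
    fun c => ?_, hF H List.mem_cons_self, fun x y hxy => ?_⟩
  · obtain ⟨-, h6, h7⟩ := classOK_spec (h4 H List.mem_cons_self)
    have h8 : ({x : Fin (2 * k * t + 1) | x.val ∉ H.headD []}ᶜ).ncard = k * t + 1 := by
      rw [← h3, ← List.toFinset_card_of_nodup h6, ← Set.ncard_coe_finset]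
      apply Set.ncard_congr (fun x _ => x.val)
      · intro x hx
        simpa using hx
      · intro x y _ _ h
        exact Fin.ext h
      · intro v hv
        have hv' : v ∈ H.headD [] := by simpa using hv
        exact ⟨⟨v, h7 v hv'⟩, by simpa using hv', rfl⟩
    have h9 := Set.ncard_add_ncard_compl {x : Fin (2 * k * t + 1) | x.val ∉ H.headD []}
    rw [h8, Nat.card_fin] at h9
    have : 2 * k * t = k * t + k * t := by ring
    omega
  · have hm : D[c] ∈ D := List.getElem_mem _
    have hl := h2 _ hm
    rw [beq_iff_eq, List.length_eq_one_iff] at hl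
    obtain ⟨p, hp⟩ := hl
    obtain ⟨-, -, h7⟩ := classOK_spec (h4 _ (List.mem_cons_of_mem _ hm))
    rw [hp] at h7
    refine ⟨⟨p, h7 p (List.mem_singleton_self p)⟩, ?_⟩
    have h8 := hF _ (List.mem_cons_of_mem _ hm)
    rw [hp] at h8
    convert h8 using 1
    ext x
    simp [Fin.ext_iff]
  · obtain ⟨T, hT, h⟩ := hc x y (by
      rw [Bool.not_eq_true', ← Bool.not_eq_true]
      exact fun h => hxy (Fin.ext (Nat.eq_of_beq_eq_true h)))
    rcases List.mem_cons.1 hT with rfl | hT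
    · exact .inr h
    · obtain ⟨i, hi, rfl⟩ := List.getElem_of_mem hT
      exact .inl ⟨⟨i, hi⟩, h⟩

/-- A check that `D` gives the classes of a gadget; the point `(i, x)` has code `k * i + x`. -/
noncomputable def checkGadget (m k : ℕ) (D : List (List (List ℕ))) : Bool :=
  D.length == k && D.all (fun T => (T.headD []).isEmpty) &&
    D.all (classOK (Nat.beq k) (m * k)) &&
    pairsOK (m * k) (fun a b => Nat.beq (b / k) ((a / k + 1) % m)) D

theorem gadget_of_data {m k : ℕ} (hk : 0 < k) {D : List (List (List ℕ))}
    (h : checkGadget m k D = true) : Gadget m k := by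
  have : NeZero k := ⟨hk.ne'⟩
  simp only [checkGadget, Bool.and_eq_true, beq_iff_eq] at h
  obtain ⟨⟨⟨h1, h2⟩, h4⟩, h5⟩ := h
  rw [List.all_eq_true] at h2
  let e : Fin (m * k) ≃ Fin m × ZMod k := finProdFinEquiv.symm.trans
    (Equiv.prodCongr (Equiv.refl _) (ZMod.finEquiv k).toEquiv)
  obtain ⟨F, hF, hc⟩ := exists_of_data_aux e h4 h5
  replace hF := fun T hT => (hF T hT).mono fun m h => (Nat.eq_of_beq_eq_true h).symm
  have he : ∀ p : Fin m × ZMod k, (e.symm p).val / k = p.1.val := by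
    rintro ⟨i, x⟩
    obtain ⟨y, rfl⟩ := (ZMod.finEquiv k).surjective x
    simp only [e, Equiv.symm_trans_apply, Equiv.symm_symm, Equiv.prodCongr_symm,
      Equiv.prodCongr_apply, Prod.map_apply, RingEquiv.toEquiv_eq_coe, Equiv.refl_symm,
      Equiv.refl_apply]
    have : (↑(ZMod.finEquiv k) : Fin k ≃ ZMod k).symm ((ZMod.finEquiv k) y) = y :=
      (ZMod.finEquiv k).symm_apply_apply y
    rw [this, finProdFinEquiv_apply_val, Nat.add_mul_div_left _ _ hk,
      Nat.div_eq_of_lt y.2, zero_add]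
  refine ⟨fun c => F (D[c.val]'(h1 ▸ c.2)), fun c => ?_, fun i hi x y => ?_⟩
  · have hm : D[c.val]'(h1 ▸ c.2) ∈ D := List.getElem_mem _
    convert hF _ hm using 1
    ext x
    have := h2 _ hm
    rw [List.isEmpty_iff] at this
    simp only [this, List.not_mem_nil, not_false_eq_true, Set.mem_univ]
    exact (iff_true_right trivial).2 trivial |>.symm
  · obtain ⟨T, hT, h⟩ := hc (⟨i, hi⟩, x) (⟨(i + 1) % m, Nat.mod_lt _ (by omega)⟩, y)
      (by simp [he])
    obtain ⟨c, hc, rfl⟩ := List.getElem_of_mem hT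
    exact ⟨⟨c, h1 ▸ hc⟩, h⟩

/-- A check that `D` gives the classes of a frame with `u` groups of size `g` and `r` classes
for each group; the groups are the residue classes modulo `u`, and the group belonging to
a class is the residue class of its index. -/
noncomputable def checkFrame (K : ℕ → Bool) (u g r : ℕ) (D : List (List (List ℕ))) : Bool :=
  D.length == r * u && (D.zipIdx.all fun T => T.1.headD [] ==
      (List.range g).map fun i => T.2 % u + u * i) &&
    D.all (classOK K (g * u)) && pairsOK (g * u) (fun a b => !Nat.beq (a % u) (b % u)) D

theorem frame_of_data_aux {K : ℕ → Bool} {u g r : ℕ} (hu : 0 < u) {W : Type} (w : Fin g ≃ W)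
    {D : List (List (List ℕ))} (h : checkFrame K u g r D = true) :
    ∃ F : Fin u → Fin r → Set (List (Fin u × W)),
      (∀ y c, IsFactor (fun m => K m = true) (F y c) {p | p.1 ≠ y}) ∧
      ∀ p q : Fin u × W, p.1 ≠ q.1 → ∃ y c, Covers (F y c) p q := by
  simp only [checkFrame, Bool.and_eq_true, beq_iff_eq] at h
  obtain ⟨⟨⟨h1, h2⟩, h4⟩, h5⟩ := h
  rw [List.all_eq_true] at h2
  let e : Fin (g * u) ≃ Fin u × W := finProdFinEquiv.symm.trans
    ((Equiv.prodComm _ _).trans (Equiv.prodCongr (Equiv.refl _) w))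
  obtain ⟨F, hF, hc⟩ := exists_of_data_aux e h4 h5
  have he : ∀ p : Fin u × W, (e.symm p).val = p.1.val + u * (w.symm p.2).val := by
    rintro ⟨i, x⟩
    simp [e, finProdFinEquiv]
  have hem : ∀ p : Fin u × W, (e.symm p).val % u = p.1.val := fun p => by
    rw [he, Nat.add_mul_mod_self_left, Nat.mod_eq_of_lt p.1.2]
  have hidx : ∀ (y : Fin u) (c : Fin r), y.val + u * c.val < D.length := fun y c => by
    have := (finProdFinEquiv (c, y)).2
    simpa [finProdFinEquiv, h1] using this
  refine ⟨fun y c => F (D[y.val + u * c.val]'(hidx y c)), fun y c => ?_, fun p q hpq => ?_⟩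
  · have hm : D[y.val + u * c.val]'(hidx y c) ∈ D := List.getElem_mem _
    convert hF _ hm using 1
    have := h2 (D[y.val + u * c.val]'(hidx y c), y.val + u * c.val) (by
      rw [List.mk_mem_zipIdx_iff_getElem?]
      simp)
    rw [beq_iff_eq] at this
    ext p
    simp only at this
    rw [this, Nat.add_mul_mod_self_left, Nat.mod_eq_of_lt y.2]
    simp only [Set.mem_ofPred_eq, List.mem_map, List.mem_range, not_exists, not_and]
    constructor
    · intro h i _ h'
      have := congrArg (· % u) h'
      simp only [Nat.add_mul_mod_self_left, Nat.mod_eq_of_lt y.2, hem] at this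
      exact h (Fin.ext this.symm)
    · intro h h'
      refine h _ (w.symm p.2).2 ?_
      rw [he, h']
  · obtain ⟨T, hT, h⟩ := hc p q (by
      rw [hem, hem, Bool.not_eq_true', ← Bool.not_eq_true]
      exact fun h => hpq (Fin.ext (Nat.eq_of_beq_eq_true h)))
    obtain ⟨c, hc, rfl⟩ := List.getElem_of_mem hT
    have hcr : c / u < r := Nat.div_lt_of_lt_mul (by rwa [h1, mul_comm] at hc)
    refine ⟨⟨c % u, Nat.mod_lt _ hu⟩, ⟨c / u, hcr⟩, ?_⟩
    simpa only [Nat.mod_add_div] using h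

theorem frame_of_data {k u : ℕ} (hk : 0 < k) (hu : 0 < u) {D : List (List (List ℕ))}
    (h : checkFrame (Nat.beq k) u (2 * k) k D = true) : Frame k u := by
  have : NeZero k := ⟨hk.ne'⟩
  obtain ⟨F, hF, hc⟩ := frame_of_data_aux hu
    (finProdFinEquiv.symm.trans (Equiv.prodCongr (Equiv.refl (Fin 2)) (ZMod.finEquiv k).toEquiv)) h
  exact ⟨F, fun y c => (hF y c).mono fun m h => (Nat.eq_of_beq_eq_true h).symm, hc⟩

theorem twoFrame_of_data {K : ℕ → Bool} {u : ℕ} (hu : 0 < u) {D : List (List (List ℕ))}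
    (h : checkFrame K u 2 1 D = true) : TwoFrame (fun m => K m = true) u := by
  obtain ⟨F, hF, hc⟩ := frame_of_data_aux hu (Equiv.refl _) h
  refine ⟨fun y => F y 0, fun y => hF y 0, fun p q hpq => ?_⟩
  obtain ⟨y, c, h⟩ := hc p q hpq
  rw [Subsingleton.elim c 0] at h
  exact ⟨y, h⟩

theorem TwoFrame.mono {K K' : ℕ → Prop} {u : ℕ} (h : TwoFrame K u) (hK : ∀ m, K m → K' m) :
    TwoFrame K' u := by
  obtain ⟨T, hT, hc⟩ := h
  exact ⟨T, fun y => (hT y).mono hK, hc⟩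

theorem exists_three_three : Exists 3 3 :=
  exists_of_data (D := kmap (complete 19) (develop 9 18 9 [
    [[4, 13, 12], [11, 15, 9], [3, 2, 16], [18, 8, 14], [10, 7, 0], [17, 1, 6]]]))
    (H := complete 19
      [[0, 3, 6], [1, 4, 7], [2, 5, 8]])
    (by decide +kernel)

theorem exists_three_four : Exists 3 4 :=
  exists_of_data (D := kmap (complete 25) (develop 3 24 3 [
    [[5, 23, 9], [22, 15, 3], [6, 21, 16], [12, 1, 10], [24, 2, 7], [18, 17, 13], [11, 19, 8],
     [14, 4, 20]],
    [[1, 14, 23], [10, 4, 0], [7, 21, 9], [18, 22, 2], [17, 24, 11], [8, 5, 20], [16, 13, 15],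
     [19, 12, 6]],
    [[12, 11, 0], [22, 21, 14], [19, 10, 20], [1, 16, 18], [3, 23, 7], [2, 5, 15], [24, 13, 4],
     [9, 8, 17]],
    [[16, 5, 19], [22, 20, 24], [0, 18, 21], [1, 7, 15], [10, 23, 17], [4, 6, 2], [13, 8, 12],
     [3, 14, 11]]]))
    (H := complete 25
      [[0, 1, 2], [3, 4, 5], [6, 7, 8], [9, 10, 11]])
    (by decide +kernel)

theorem exists_three_five : Exists 3 5 :=
  exists_of_data (D := kmap (complete 31) (develop 15 30 15 [
    [[9, 20, 26], [24, 2, 1], [17, 28, 8], [11, 25, 0], [29, 21, 19], [14, 15, 27], [7, 5, 13],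
     [4, 23, 22], [3, 6, 18], [16, 30, 10]]]))
    (H := complete 31
      [[0, 5, 10], [1, 6, 11], [2, 7, 12], [3, 8, 13], [4, 9, 14]])
    (by decide +kernel)

theorem exists_three_six : Exists 3 6 :=
  exists_of_data (D := kmap (complete 37) (develop 9 36 9 [
    [[0, 28, 27], [13, 14, 18], [23, 20, 1], [30, 5, 17], [21, 6, 32], [11, 19, 34], [26, 36, 16],
     [7, 25, 24], [9, 3, 8], [15, 31, 22], [35, 2, 33], [29, 12, 10]],
    [[0, 9, 13], [30, 25, 20], [24, 31, 27], [36, 7, 28], [35, 18, 15], [32, 29, 14], [8, 22, 16],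
     [1, 12, 33], [19, 26, 17], [21, 34, 5], [11, 6, 4], [2, 3, 23]]]))
    (H := complete 37
      [[0, 3, 6], [1, 4, 7], [2, 5, 8], [9, 12, 15], [10, 13, 16], [11, 14, 17]])
    (by decide +kernel)

theorem exists_three_seven : Exists 3 7 :=
  exists_of_data (D := kmap (complete 43) (develop 21 42 21 [
    [[2, 4, 5], [20, 15, 25], [24, 21, 35], [40, 1, 23], [8, 27, 22], [12, 41, 32], [36, 38, 6],
     [13, 37, 29], [31, 30, 18], [17, 9, 0], [16, 33, 10], [3, 14, 39], [34, 7, 28], [19, 42, 26]]]))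
    (H := complete 43
      [[0, 7, 14], [1, 8, 15], [2, 9, 16], [3, 10, 17], [4, 11, 18], [5, 12, 19], [6, 13, 20]])
    (by decide +kernel)

theorem exists_three_eight : Exists 3 8 :=
  exists_of_data (D := kmap (complete 49) (develop 3 48 3 [
    [[43, 45, 47], [48, 32, 35], [44, 28, 25], [46, 10, 7], [11, 17, 13], [8, 14, 16],
     [12, 33, 22], [15, 30, 19], [21, 23, 36], [18, 20, 39], [4, 27, 0], [1, 24, 3], [37, 26, 9],
     [40, 29, 6], [5, 31, 38], [2, 34, 41]],
    [[44, 47, 48], [42, 22, 19], [43, 38, 41], [46, 16, 13], [17, 9, 20], [14, 6, 23],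
     [39, 31, 32], [36, 34, 35], [21, 4, 10], [18, 1, 7], [29, 37, 8], [26, 40, 11], [15, 5, 33],
     [12, 2, 30], [0, 28, 24], [3, 25, 27]],
    [[18, 42, 8], [14, 29, 46], [25, 21, 31], [36, 4, 33], [39, 41, 22], [9, 2, 28], [26, 35, 43],
     [6, 13, 24], [32, 23, 15], [16, 1, 47], [5, 30, 20], [19, 12, 37], [3, 48, 10], [7, 11, 38],
     [45, 27, 40], [44, 34, 17]],
    [[22, 14, 3], [11, 37, 44], [36, 41, 5], [33, 7, 29], [42, 13, 27], [15, 48, 38], [12, 1, 31],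
     [10, 45, 19], [35, 47, 23], [0, 18, 43], [4, 39, 9], [21, 46, 2], [17, 30, 8], [32, 24, 34],
     [40, 28, 16], [26, 25, 20]],
    [[8, 43, 31], [24, 14, 20], [46, 33, 6], [44, 38, 16], [41, 25, 15], [48, 23, 26],
     [47, 28, 37], [45, 39, 34], [35, 2, 11], [1, 42, 0], [10, 27, 32], [19, 9, 21], [29, 18, 4],
     [22, 30, 36], [17, 7, 5], [40, 13, 3]],
    [[21, 42, 11], [17, 26, 46], [28, 18, 34], [39, 1, 30], [36, 38, 19], [6, 5, 25], [29, 32, 43],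
     [9, 16, 27], [35, 20, 12], [13, 4, 47], [2, 33, 23], [22, 15, 40], [0, 48, 7], [10, 8, 41],
     [45, 24, 37], [44, 31, 14]],
    [[19, 17, 0], [8, 40, 44], [39, 38, 2], [30, 10, 26], [42, 16, 24], [12, 48, 41], [15, 4, 34],
     [7, 45, 22], [32, 47, 20], [3, 21, 43], [1, 36, 6], [18, 46, 5], [14, 33, 11], [35, 27, 31],
     [37, 25, 13], [29, 28, 23]],
    [[11, 43, 34], [27, 17, 23], [46, 30, 9], [44, 41, 13], [38, 28, 12], [48, 20, 29],
     [47, 25, 40], [45, 36, 31], [32, 5, 8], [4, 42, 3], [7, 24, 35], [22, 6, 18], [26, 21, 1],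
     [19, 33, 39], [14, 10, 2], [37, 16, 0]]]))
    (H := complete 49
      [[42, 43, 44], [45, 0, 3], [46, 4, 1], [47, 2, 5], [6, 8, 7], [10, 9, 11], [12, 14, 13],
       [16, 15, 17]])
    (by decide +kernel)

theorem exists_three_nine : Exists 3 9 :=
  exists_of_data (D := kmap (complete 55) (develop 27 54 27 [
    [[14, 3, 34], [18, 39, 25], [51, 15, 11], [19, 31, 37], [2, 8, 21], [1, 35, 6], [32, 4, 54],
     [42, 52, 27], [20, 22, 23], [5, 48, 29], [28, 44, 17], [45, 36, 10], [53, 40, 7], [26, 9, 41],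
     [30, 50, 0], [38, 16, 33], [24, 12, 49], [47, 43, 46]]]))
    (H := complete 55
      [[0, 9, 18], [1, 10, 19], [2, 11, 20], [3, 12, 21], [4, 13, 22], [5, 14, 23], [6, 15, 24],
       [7, 16, 25], [8, 17, 26]])
    (by decide +kernel)

theorem exists_three_ten : Exists 3 10 :=
  exists_of_data (D := kmap (complete 61) (develop 15 60 15 [
    [[34, 16, 0], [55, 29, 20], [46, 23, 43], [44, 50, 21], [5, 52, 2], [11, 59, 56], [53, 31, 60],
     [47, 22, 1], [48, 58, 35], [40, 7, 32], [37, 33, 24], [17, 8, 28], [30, 10, 6], [15, 42, 12],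
     [13, 54, 14], [49, 25, 27], [57, 41, 51], [18, 4, 19], [3, 26, 45], [36, 38, 39]],
    [[27, 55, 2], [44, 48, 18], [17, 13, 24], [56, 30, 20], [12, 25, 41], [50, 46, 7], [11, 9, 45],
     [21, 4, 36], [1, 39, 8], [60, 15, 3], [14, 42, 5], [16, 58, 38], [43, 33, 57], [0, 52, 59],
     [49, 34, 51], [26, 23, 40], [28, 6, 32], [37, 10, 31], [47, 29, 35], [22, 53, 54]]]))
    (H := complete 61
      [[0, 5, 10], [1, 6, 11], [2, 7, 12], [3, 8, 13], [4, 9, 14], [15, 20, 25], [16, 21, 26],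
       [17, 22, 27], [18, 23, 28], [19, 24, 29]])
    (by decide +kernel)

theorem exists_three_eleven : Exists 3 11 :=
  exists_of_data (D := kmap (complete 67) (develop 33 66 33 [
    [[46, 44, 36], [64, 61, 14], [33, 28, 20], [52, 19, 56], [60, 47, 53], [45, 40, 4],
     [29, 57, 26], [11, 10, 23], [12, 7, 39], [21, 27, 43], [0, 16, 58], [8, 31, 42], [15, 6, 13],
     [51, 62, 63], [1, 66, 54], [25, 55, 37], [30, 65, 48], [34, 5, 24], [9, 35, 49], [59, 50, 2],
     [32, 17, 38], [41, 18, 22]]]))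
    (H := complete 67
      [[0, 11, 22], [1, 12, 23], [2, 13, 24], [3, 14, 25], [4, 15, 26], [5, 16, 27], [6, 17, 28],
       [7, 18, 29], [8, 19, 30], [9, 20, 31], [10, 21, 32]])
    (by decide +kernel)

theorem exists_three_thirteen : Exists 3 13 :=
  exists_of_data (D := kmap (complete 79) (develop 39 78 39 [
    [[4, 20, 75], [33, 18, 0], [8, 65, 22], [46, 52, 39], [12, 15, 17], [64, 55, 19], [59, 54, 34],
     [31, 45, 14], [68, 50, 24], [57, 5, 53], [62, 38, 77], [7, 73, 26], [30, 63, 21],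
     [44, 27, 23], [28, 36, 29], [41, 11, 69], [6, 16, 67], [66, 74, 25], [42, 78, 35],
     [51, 13, 1], [56, 76, 2], [72, 49, 47], [60, 61, 32], [43, 3, 40], [70, 48, 58], [37, 71, 9]]]))
    (H := complete 79
      [[0, 13, 26], [1, 14, 27], [2, 15, 28], [3, 16, 29], [4, 17, 30], [5, 18, 31], [6, 19, 32],
       [7, 20, 33], [8, 21, 34], [9, 22, 35], [10, 23, 36], [11, 24, 37], [12, 25, 38]])
    (by decide +kernel)

theorem exists_three_fourteen : Exists 3 14 :=
  exists_of_data (D := kmap (complete 85) (develop 21 84 21 [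
    [[34, 81, 2], [19, 3, 4], [7, 45, 77], [55, 25, 42], [59, 53, 9], [28, 8, 12], [72, 11, 24],
     [5, 67, 38], [31, 56, 30], [17, 20, 52], [60, 14, 62], [43, 6, 36], [54, 78, 13], [29, 1, 50],
     [57, 41, 15], [18, 35, 49], [70, 10, 74], [71, 68, 16], [27, 69, 46], [48, 21, 76],
     [40, 23, 75], [65, 84, 32], [44, 79, 33], [58, 66, 22], [73, 82, 51], [61, 80, 37],
     [63, 39, 47], [26, 64, 83]],
    [[64, 69, 13], [27, 78, 37], [12, 14, 80], [67, 4, 47], [30, 39, 15], [9, 48, 18],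
     [58, 76, 46], [49, 29, 52], [81, 60, 73], [65, 33, 11], [0, 23, 57], [19, 6, 25],
     [53, 68, 43], [61, 54, 66], [34, 3, 74], [28, 36, 7], [45, 35, 72], [8, 26, 75], [2, 82, 71],
     [63, 83, 77], [70, 17, 31], [20, 44, 10], [38, 32, 50], [5, 84, 59], [41, 42, 16],
     [56, 51, 55], [22, 40, 24], [79, 1, 62]]]))
    (H := complete 85
      [[0, 7, 14], [1, 8, 15], [2, 9, 16], [3, 10, 17], [4, 11, 18], [5, 12, 19], [6, 13, 20],
       [21, 28, 35], [22, 29, 36], [23, 30, 37], [24, 31, 38], [25, 32, 39], [26, 33, 40],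
       [27, 34, 41]])
    (by decide +kernel)

theorem exists_three_fifteen : Exists 3 15 :=
  exists_of_data (D := kmap (complete 91) (develop 45 90 45 [
    [[43, 52, 41], [57, 42, 25], [19, 15, 29], [65, 89, 88], [63, 58, 34], [17, 12, 18],
     [80, 68, 33], [76, 70, 6], [13, 38, 4], [35, 84, 22], [60, 69, 14], [36, 7, 49], [1, 27, 66],
     [86, 0, 48], [28, 16, 54], [79, 11, 45], [50, 75, 47], [74, 23, 30], [51, 20, 44],
     [90, 32, 77], [37, 10, 67], [56, 40, 3], [61, 46, 24], [59, 9, 31], [85, 26, 53],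
     [39, 82, 72], [5, 8, 71], [73, 81, 55], [87, 83, 2], [78, 62, 64]]]))
    (H := complete 91
      [[0, 15, 30], [1, 16, 31], [2, 17, 32], [3, 18, 33], [4, 19, 34], [5, 20, 35], [6, 21, 36],
       [7, 22, 37], [8, 23, 38], [9, 24, 39], [10, 25, 40], [11, 26, 41], [12, 27, 42],
       [13, 28, 43], [14, 29, 44]])
    (by decide +kernel)

theorem exists_three_seventeen : Exists 3 17 :=
  exists_of_data (D := kmap (complete 103) (develop 51 102 51 [
    [[87, 1, 39], [55, 11, 102], [83, 50, 64], [54, 81, 88], [77, 27, 86], [65, 68, 41],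
     [32, 94, 3], [63, 48, 43], [15, 52, 7], [96, 59, 100], [56, 67, 9], [60, 72, 4],
     [19, 101, 93], [58, 79, 49], [26, 90, 89], [85, 91, 42], [71, 84, 69], [78, 73, 21],
     [82, 51, 5], [92, 12, 66], [62, 97, 28], [80, 8, 98], [75, 53, 37], [99, 76, 6], [17, 38, 70],
     [36, 25, 61], [46, 74, 23], [40, 22, 95], [16, 47, 57], [2, 14, 18], [13, 20, 45],
     [24, 34, 10], [44, 35, 29], [30, 31, 33]]]))
    (H := complete 103
      [[0, 17, 34], [1, 18, 35], [2, 19, 36], [3, 20, 37], [4, 21, 38], [5, 22, 39], [6, 23, 40],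
       [7, 24, 41], [8, 25, 42], [9, 26, 43], [10, 27, 44], [11, 28, 45], [12, 29, 46],
       [13, 30, 47], [14, 31, 48], [15, 32, 49], [16, 33, 50]])
    (by decide +kernel)

theorem exists_three_eighteen : Exists 3 18 :=
  exists_of_data (D := kmap (complete 109) (develop 27 108 27 [
    [[34, 99, 41], [52, 42, 7], [83, 24, 25], [108, 103, 72], [43, 67, 21], [9, 100, 20],
     [36, 86, 17], [10, 98, 82], [95, 75, 1], [59, 85, 22], [35, 18, 74], [87, 16, 3],
     [38, 76, 55], [14, 29, 58], [28, 47, 50], [4, 91, 81], [48, 69, 19], [80, 79, 45],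
     [27, 106, 102], [51, 64, 93], [11, 66, 44], [13, 5, 73], [96, 94, 49], [101, 46, 31],
     [60, 90, 8], [92, 32, 78], [37, 53, 88], [39, 15, 57], [105, 68, 56], [107, 65, 26],
     [77, 63, 84], [97, 62, 54], [70, 89, 40], [12, 33, 104], [61, 30, 71], [2, 23, 6]],
    [[16, 92, 19], [49, 35, 8], [12, 5, 44], [36, 38, 95], [82, 81, 100], [56, 29, 20],
     [30, 98, 31], [53, 1, 73], [97, 14, 72], [105, 51, 90], [74, 86, 106], [104, 68, 101],
     [102, 23, 89], [87, 25, 93], [10, 107, 85], [103, 58, 42], [57, 47, 84], [43, 79, 96],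
     [64, 32, 88], [28, 91, 17], [99, 21, 61], [48, 94, 54], [60, 55, 83], [41, 37, 7],
     [45, 108, 22], [6, 46, 18], [40, 24, 34], [2, 59, 33], [3, 50, 65], [9, 70, 11], [15, 66, 63],
     [80, 0, 76], [52, 75, 77], [39, 67, 13], [26, 4, 69], [78, 71, 62]]]))
    (H := complete 109
      [[0, 9, 18], [1, 10, 19], [2, 11, 20], [3, 12, 21], [4, 13, 22], [5, 14, 23], [6, 15, 24],
       [7, 16, 25], [8, 17, 26], [27, 36, 45], [28, 37, 46], [29, 38, 47], [30, 39, 48],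
       [31, 40, 49], [32, 41, 50], [33, 42, 51], [34, 43, 52], [35, 44, 53]])
    (by decide +kernel)

theorem exists_three_twentyOne : Exists 3 21 :=
  exists_of_data (D := kmap (complete 127) (develop 63 126 63 [
    [[66, 87, 72], [32, 108, 82], [74, 25, 117], [115, 43, 122], [75, 58, 38], [94, 52, 54],
     [21, 116, 34], [63, 16, 118], [81, 47, 113], [12, 80, 90], [78, 18, 45], [11, 70, 119],
     [31, 98, 50], [100, 10, 48], [1, 56, 76], [28, 89, 91], [85, 55, 73], [101, 44, 7],
     [23, 67, 14], [15, 102, 86], [83, 37, 60], [106, 77, 107], [114, 79, 96], [120, 22, 95],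
     [99, 112, 103], [36, 121, 110], [111, 71, 57], [125, 65, 84], [68, 27, 92], [33, 88, 124],
     [13, 64, 69], [104, 42, 20], [51, 40, 109], [93, 29, 126], [59, 8, 97], [17, 105, 62],
     [123, 24, 53], [46, 49, 39], [35, 19, 5], [26, 9, 41], [61, 3, 4], [30, 2, 6]]]))
    (H := complete 127
      [[0, 21, 42], [1, 22, 43], [2, 23, 44], [3, 24, 45], [4, 25, 46], [5, 26, 47], [6, 27, 48],
       [7, 28, 49], [8, 29, 50], [9, 30, 51], [10, 31, 52], [11, 32, 53], [12, 33, 54],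
       [13, 34, 55], [14, 35, 56], [15, 36, 57], [16, 37, 58], [17, 38, 59], [18, 39, 60],
       [19, 40, 61], [20, 41, 62]])
    (by decide +kernel)

theorem exists_three_twentyTwo : Exists 3 22 :=
  exists_of_data (D := kmap (complete 133) (develop 33 132 33 [
    [[84, 107, 41], [38, 7, 76], [42, 13, 77], [111, 44, 67], [94, 83, 61], [74, 35, 69],
     [4, 127, 103], [50, 90, 49], [112, 10, 92], [55, 130, 39], [15, 99, 120], [18, 16, 54],
     [20, 73, 3], [108, 109, 28], [63, 17, 12], [70, 23, 82], [8, 97, 106], [34, 87, 32],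
     [131, 22, 9], [56, 124, 6], [126, 2, 57], [101, 117, 80], [81, 89, 53], [71, 62, 91],
     [116, 123, 110], [65, 24, 58], [105, 119, 79], [121, 27, 51], [115, 132, 72], [98, 30, 88],
     [64, 25, 104], [78, 33, 125], [96, 48, 129], [1, 43, 122], [11, 68, 26], [14, 21, 40],
     [102, 37, 5], [45, 47, 59], [52, 19, 31], [46, 118, 128], [66, 93, 75], [85, 86, 114],
     [29, 100, 95], [36, 113, 60]],
    [[124, 36, 32], [108, 7, 26], [115, 88, 28], [22, 23, 130], [119, 13, 67], [84, 21, 11],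
     [71, 20, 116], [127, 125, 63], [96, 15, 24], [78, 54, 80], [77, 6, 50], [89, 40, 92],
     [107, 12, 73], [1, 61, 5], [110, 69, 99], [29, 57, 4], [16, 95, 10], [14, 17, 62],
     [98, 0, 47], [85, 8, 38], [27, 68, 94], [25, 75, 111], [74, 31, 93], [113, 30, 37],
     [102, 9, 120], [103, 81, 3], [105, 45, 2], [132, 18, 34], [44, 19, 129], [114, 90, 106],
     [79, 104, 48], [82, 100, 128], [101, 70, 86], [66, 53, 131], [97, 39, 43], [91, 87, 126],
     [83, 46, 51], [59, 65, 76], [122, 72, 42], [121, 117, 60], [41, 64, 56], [58, 109, 112],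
     [52, 49, 123], [55, 35, 118]]]))
    (H := complete 133
      [[0, 11, 22], [1, 12, 23], [2, 13, 24], [3, 14, 25], [4, 15, 26], [5, 16, 27], [6, 17, 28],
       [7, 18, 29], [8, 19, 30], [9, 20, 31], [10, 21, 32], [33, 44, 55], [34, 45, 56],
       [35, 46, 57], [36, 47, 58], [37, 48, 59], [38, 49, 60], [39, 50, 61], [40, 51, 62],
       [41, 52, 63], [42, 53, 64], [43, 54, 65]])
    (by decide +kernel)

theorem exists_four_two : Exists 4 2 :=
  exists_of_data (D := kmap (complete 17) (develop 1 16 1 [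
    [[12, 7, 1, 16], [10, 14, 4, 6], [11, 0, 8, 13], [9, 5, 3, 15]],
    [[7, 14, 6, 9], [11, 8, 2, 5], [3, 16, 13, 1], [0, 15, 10, 12]],
    [[11, 15, 12, 2], [8, 1, 10, 3], [13, 7, 16, 4], [5, 14, 9, 0]],
    [[14, 3, 13, 0], [15, 16, 8, 7], [9, 2, 4, 10], [6, 12, 1, 11]],
    [[4, 0, 6, 8], [2, 10, 5, 15], [11, 7, 3, 12], [14, 13, 9, 16]],
    [[9, 1, 4, 11], [10, 7, 0, 16], [6, 15, 14, 2], [8, 5, 13, 12]],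
    [[16, 5, 7, 2], [4, 12, 9, 3], [13, 6, 1, 15], [8, 10, 11, 14]],
    [[2, 0, 10, 13], [4, 15, 8, 9], [3, 11, 16, 6], [1, 5, 12, 14]]]))
    (H := complete 17
      [[0, 1, 2, 3], [4, 5, 6, 7]])
    (by decide +kernel)

theorem exists_four_three : Exists 4 3 :=
  exists_of_data (D := kmap (complete 25) (develop 3 24 3 [
    [[6, 21, 7, 20], [17, 19, 24, 1], [12, 13, 8, 3], [5, 23, 18, 0], [22, 15, 16, 2],
     [4, 11, 14, 10]],
    [[18, 9, 11, 17], [20, 21, 4, 8], [13, 24, 15, 3], [19, 0, 1, 5], [16, 14, 22, 12],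
     [23, 10, 6, 7]],
    [[22, 1, 14, 19], [24, 9, 4, 5], [16, 3, 18, 11], [12, 10, 8, 15], [0, 6, 13, 20],
     [21, 23, 17, 2]],
    [[12, 6, 15, 4], [14, 2, 7, 0], [21, 16, 8, 24], [3, 22, 13, 19], [20, 18, 10, 17],
     [23, 9, 1, 11]]]))
    (H := complete 25
      [[0, 3, 6, 9], [1, 4, 7, 10], [2, 5, 8, 11]])
    (by decide +kernel)

theorem exists_four_four : Exists 4 4 :=
  exists_of_data (D := kmap (complete 33) (develop 1 32 1 [
    [[26, 28, 30, 29], [27, 9, 25, 8], [31, 4, 32, 5], [10, 11, 16, 17], [12, 20, 1, 3],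
     [13, 21, 0, 2], [14, 22, 18, 6], [15, 23, 19, 7]],
    [[24, 29, 31, 32], [26, 16, 30, 17], [28, 3, 27, 2], [18, 19, 21, 20], [4, 6, 1, 22],
     [5, 7, 0, 23], [10, 15, 8, 13], [11, 14, 9, 12]],
    [[27, 29, 28, 31], [32, 10, 24, 11], [25, 5, 30, 4], [12, 13, 23, 22], [16, 14, 0, 20],
     [17, 15, 1, 21], [2, 19, 6, 9], [3, 18, 7, 8]],
    [[24, 26, 30, 31], [25, 28, 32, 29], [1, 16, 10, 4], [0, 17, 11, 5], [7, 13, 19, 3],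
     [6, 12, 18, 2], [14, 21, 8, 23], [15, 20, 9, 22]],
    [[25, 27, 32, 30], [29, 3, 24, 2], [31, 18, 26, 19], [0, 1, 14, 15], [5, 9, 17, 13],
     [4, 8, 16, 12], [22, 11, 20, 7], [23, 10, 21, 6]],
    [[24, 28, 27, 30], [25, 31, 26, 32], [23, 12, 14, 2], [22, 13, 15, 3], [11, 21, 4, 7],
     [10, 20, 5, 6], [1, 17, 18, 8], [0, 16, 19, 9]],
    [[21, 12, 17, 7], [24, 5, 16, 18], [14, 20, 8, 19], [28, 9, 32, 6], [10, 29, 23, 3],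
     [31, 1, 30, 22], [27, 4, 26, 13], [11, 25, 2, 15]],
    [[20, 13, 16, 6], [24, 4, 17, 19], [15, 21, 9, 18], [28, 8, 32, 7], [11, 29, 22, 2],
     [31, 0, 30, 23], [27, 5, 26, 12], [10, 25, 3, 14]],
    [[25, 7, 1, 19], [24, 13, 4, 16], [8, 0, 12, 31], [10, 30, 15, 9], [27, 11, 26, 22],
     [17, 6, 29, 14], [32, 23, 20, 3], [28, 5, 21, 18]],
    [[25, 6, 0, 18], [24, 12, 5, 17], [9, 1, 13, 31], [11, 30, 14, 8], [27, 10, 26, 23],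
     [16, 7, 29, 15], [32, 22, 21, 2], [28, 4, 20, 19]],
    [[20, 31, 16, 22], [23, 7, 10, 1], [19, 27, 0, 32], [9, 30, 6, 26], [28, 11, 3, 17],
     [25, 21, 24, 15], [29, 12, 2, 8], [14, 5, 18, 13]],
    [[21, 31, 17, 23], [22, 6, 11, 0], [18, 27, 1, 32], [8, 30, 7, 26], [28, 10, 2, 16],
     [25, 20, 24, 14], [29, 13, 3, 9], [15, 4, 19, 12]],
    [[28, 23, 9, 13], [29, 18, 14, 4], [21, 26, 0, 3], [11, 19, 5, 1], [7, 31, 15, 27],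
     [25, 12, 32, 16], [20, 30, 2, 17], [24, 22, 10, 8]],
    [[28, 22, 8, 12], [29, 19, 15, 5], [20, 26, 1, 2], [10, 18, 4, 0], [6, 31, 14, 27],
     [25, 13, 32, 17], [21, 30, 3, 16], [24, 23, 11, 9]],
    [[5, 10, 31, 2], [7, 24, 1, 12], [25, 0, 19, 22], [29, 21, 27, 17], [23, 4, 9, 16],
     [6, 3, 26, 15], [11, 18, 30, 13], [28, 14, 32, 20]],
    [[4, 11, 31, 3], [6, 24, 0, 13], [25, 1, 18, 23], [29, 20, 27, 16], [22, 5, 8, 17],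
     [7, 2, 26, 14], [10, 19, 30, 12], [28, 15, 32, 21]]]))
    (H := complete 33
      [[24, 25, 26, 27], [28, 0, 29, 1], [2, 3, 5, 4], [6, 7, 9, 8]])
    (by decide +kernel)

theorem exists_four_five : Exists 4 5 :=
  exists_of_data (D := kmap (complete 41) (develop 5 40 5 [
    [[30, 5, 40, 33], [37, 21, 2, 3], [26, 18, 19, 13], [15, 32, 28, 38], [16, 20, 9, 8],
     [6, 34, 4, 17], [12, 24, 29, 22], [23, 27, 25, 1], [36, 14, 39, 7], [10, 31, 35, 11]],
    [[26, 20, 37, 11], [36, 33, 28, 31], [1, 21, 34, 3], [35, 15, 40, 27], [38, 2, 39, 17],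
     [9, 12, 0, 19], [29, 8, 30, 6], [24, 10, 13, 7], [16, 14, 18, 23], [25, 4, 22, 32]],
    [[15, 31, 18, 29], [36, 30, 11, 40], [32, 12, 28, 39], [22, 35, 21, 20], [8, 4, 33, 1],
     [23, 2, 19, 34], [0, 25, 26, 14], [13, 9, 7, 16], [37, 38, 3, 6], [27, 24, 5, 17]],
    [[9, 22, 19, 3], [35, 2, 29, 5], [37, 28, 16, 18], [4, 14, 7, 27], [33, 24, 13, 0],
     [1, 40, 20, 12], [11, 25, 8, 34], [6, 39, 36, 21], [30, 23, 17, 31], [38, 10, 32, 26]]]))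
    (H := complete 41
      [[0, 5, 10, 15], [1, 6, 11, 16], [2, 7, 12, 17], [3, 8, 13, 18], [4, 9, 14, 19]])
    (by decide +kernel)

theorem exists_four_seven : Exists 4 7 :=
  exists_of_data (D := kmap (complete 57) (develop 7 56 7 [
    [[42, 51, 8, 5], [32, 3, 19, 14], [17, 49, 2, 22], [31, 45, 24, 26], [16, 33, 37, 1],
     [34, 43, 55, 41], [18, 27, 30, 9], [6, 39, 50, 20], [23, 15, 48, 12], [44, 35, 21, 40],
     [7, 11, 56, 52], [4, 47, 53, 54], [10, 28, 46, 36], [38, 13, 29, 25]],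
    [[24, 32, 41, 49], [3, 1, 54, 21], [17, 52, 34, 44], [16, 29, 30, 38], [56, 5, 27, 37],
     [26, 33, 0, 45], [13, 40, 15, 2], [48, 6, 31, 43], [25, 14, 55, 11], [28, 22, 10, 4],
     [19, 50, 23, 47], [36, 53, 51, 35], [39, 46, 8, 18], [9, 42, 12, 20]],
    [[4, 55, 45, 15], [22, 53, 12, 52], [0, 47, 41, 3], [31, 19, 13, 7], [32, 10, 2, 29],
     [54, 33, 28, 5], [42, 18, 56, 48], [27, 17, 50, 11], [30, 16, 35, 43], [26, 9, 24, 46],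
     [44, 39, 37, 21], [6, 38, 23, 51], [1, 25, 36, 49], [8, 20, 40, 34]],
    [[45, 27, 26, 20], [54, 25, 22, 31], [23, 4, 32, 56], [2, 1, 24, 11], [6, 47, 12, 36],
     [19, 0, 17, 16], [8, 50, 42, 3], [39, 10, 40, 5], [7, 9, 43, 46], [15, 44, 29, 51],
     [34, 37, 49, 53], [52, 48, 55, 28], [38, 35, 30, 14], [18, 41, 13, 33]]]))
    (H := complete 57
      [[0, 7, 14, 21], [1, 8, 15, 22], [2, 9, 16, 23], [3, 10, 17, 24], [4, 11, 18, 25],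
       [5, 12, 19, 26], [6, 13, 20, 27]])
    (by decide +kernel)

theorem exists_six_one : Exists 6 1 :=
  exists_of_data (D := kmap (complete 13) (develop 3 12 3 [
    [[1, 10, 8, 9, 3, 11], [4, 0, 6, 2, 12, 7]],
    [[12, 10, 2, 1, 6, 4], [8, 7, 3, 5, 9, 11]]]))
    (H := complete 13
      [[0, 3, 1, 4, 2, 5]])
    (by decide +kernel)

theorem exists_six_two : Exists 6 2 :=
  exists_of_data (D := kmap (complete 25) (develop 3 24 3 [
    [[10, 0, 21, 13, 2, 6], [23, 18, 24, 15, 16, 20], [7, 8, 5, 4, 11, 12], [22, 9, 19, 14, 1, 17]],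
    [[16, 7, 17, 11, 9, 4], [13, 14, 5, 21, 12, 15], [20, 8, 18, 3, 24, 2], [0, 19, 10, 22, 23, 1]],
    [[22, 12, 16, 5, 11, 15], [14, 24, 6, 17, 20, 9], [3, 21, 10, 1, 13, 7], [8, 23, 19, 18, 4, 0]],
    [[5, 18, 12, 4, 14, 7], [2, 19, 17, 23, 3, 16], [22, 8, 21, 1, 9, 24], [13, 10, 15, 0, 6, 20]]]))
    (H := complete 25
      [[0, 3, 1, 4, 2, 5], [6, 9, 7, 10, 8, 11]])
    (by decide +kernel)

theorem exists_eight_one : Exists 8 1 :=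
  exists_of_data (D := kmap (complete 17) (develop 1 16 1 [
    [[7, 2, 16, 9, 6, 11, 13, 5], [10, 14, 12, 8, 0, 4, 15, 3]],
    [[16, 15, 14, 2, 11, 3, 12, 1], [8, 6, 0, 9, 5, 10, 7, 13]],
    [[16, 13, 10, 6, 1, 15, 8, 4], [0, 3, 14, 9, 2, 12, 7, 11]],
    [[5, 14, 13, 9, 1, 8, 2, 0], [16, 3, 6, 15, 10, 11, 4, 12]],
    [[16, 5, 3, 13, 15, 7, 8, 11], [14, 1, 10, 12, 9, 4, 2, 6]],
    [[7, 3, 9, 15, 11, 14, 8, 16], [2, 13, 0, 12, 5, 1, 4, 10]],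
    [[0, 10, 8, 9, 7, 4, 14, 16], [2, 5, 11, 1, 13, 6, 12, 15]],
    [[7, 14, 0, 15, 5, 8, 3, 1], [9, 10, 16, 6, 4, 13, 12, 11]]]))
    (H := complete 17
      [[0, 1, 2, 3, 4, 5, 6, 7]])
    (by decide +kernel)

theorem exists_ten_one : Exists 10 1 :=
  exists_of_data (D := kmap (complete 21) (develop 5 20 5 [
    [[5, 16, 14, 17, 3, 11, 12, 6, 9, 13], [7, 19, 20, 1, 18, 8, 10, 0, 2, 15]],
    [[15, 17, 16, 1, 2, 18, 14, 12, 3, 10], [0, 7, 4, 5, 19, 13, 8, 9, 20, 11]]]))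
    (H := complete 21
      [[0, 5, 1, 6, 2, 7, 3, 8, 4, 9]])
    (by decide +kernel)

theorem exists_ten_two : Exists 10 2 :=
  exists_of_data (D := kmap (complete 41) (develop 5 40 5 [
    [[14, 4, 37, 39, 31, 1, 34, 2, 5, 8], [24, 36, 12, 19, 38, 3, 20, 32, 17, 21],
     [18, 23, 25, 13, 16, 6, 40, 11, 22, 30], [15, 33, 26, 9, 35, 27, 28, 10, 29, 0]],
    [[33, 6, 20, 8, 19, 40, 23, 34, 18, 25], [10, 13, 2, 11, 7, 1, 22, 3, 32, 26],
     [38, 39, 17, 28, 0, 37, 21, 15, 36, 31], [12, 24, 9, 27, 29, 4, 30, 14, 35, 5]],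
    [[40, 3, 1, 24, 37, 14, 36, 26, 16, 25], [33, 30, 12, 0, 19, 6, 22, 21, 29, 34],
     [39, 27, 31, 11, 17, 20, 18, 9, 28, 7], [8, 15, 4, 35, 10, 23, 38, 5, 13, 32]],
    [[22, 9, 2, 28, 8, 31, 5, 39, 30, 36], [3, 23, 29, 14, 13, 0, 1, 18, 15, 16],
     [19, 33, 40, 37, 17, 35, 26, 4, 38, 27], [24, 34, 20, 25, 21, 11, 6, 7, 32, 10]]]))
    (H := complete 41
      [[0, 5, 1, 6, 2, 7, 3, 8, 4, 9], [10, 15, 11, 16, 12, 17, 13, 18, 14, 19]])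
    (by decide +kernel)

theorem exists_fourteen_one : Exists 14 1 :=
  exists_of_data (D := kmap (complete 29) (develop 7 28 7 [
    [[5, 25, 11, 6, 21, 19, 4, 16, 27, 26, 9, 28, 22, 24],
     [15, 20, 13, 3, 2, 10, 12, 1, 17, 14, 0, 18, 7, 23]],
    [[18, 19, 22, 9, 14, 21, 0, 23, 17, 28, 1, 5, 3, 12],
     [15, 27, 24, 6, 16, 8, 7, 25, 13, 10, 20, 11, 26, 2]]]))
    (H := complete 29
      [[0, 7, 1, 8, 2, 9, 3, 10, 4, 11, 5, 12, 6, 13]])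
    (by decide +kernel)

theorem exists_five_one : Exists 5 1 :=
  exists_of_data (D := kmap (complete 11) (develop 5 10 5 [
    [[4, 5, 0, 7, 8], [9, 6, 3, 1, 10]]]))
    (H := complete 11
      [[0, 1, 2, 3, 4]])
    (by decide +kernel)

theorem exists_five_two : Exists 5 2 :=
  exists_of_data (D := kmap (complete 21) (develop 5 20 5 [
    [[8, 15, 10, 0, 16], [9, 12, 4, 3, 6], [5, 11, 18, 7, 1], [19, 20, 2, 14, 13]],
    [[17, 14, 18, 3, 16], [19, 2, 4, 13, 9], [10, 8, 7, 0, 5], [12, 20, 6, 15, 1]]]))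
    (H := complete 21
      [[10, 12, 14, 11, 13], [15, 17, 19, 16, 18]])
    (by decide +kernel)

theorem exists_five_three : Exists 5 3 :=
  exists_of_data (D := kmap (complete 31) (develop 5 30 5 [
    [[26, 1, 21, 13, 17], [18, 4, 6, 14, 20], [15, 25, 22, 9, 16], [30, 12, 3, 27, 29],
     [11, 10, 5, 28, 7], [24, 8, 23, 19, 2]],
    [[16, 6, 26, 3, 22], [23, 9, 11, 4, 25], [20, 15, 27, 14, 21], [30, 2, 8, 17, 19],
     [1, 0, 10, 18, 12], [29, 13, 28, 24, 7]],
    [[21, 11, 16, 8, 27], [28, 14, 1, 9, 15], [25, 20, 17, 4, 26], [30, 7, 13, 22, 24],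
     [6, 5, 0, 23, 2], [19, 3, 18, 29, 12]]]))
    (H := complete 31
      [[0, 2, 4, 1, 3], [5, 7, 9, 6, 8], [10, 12, 14, 11, 13]])
    (by decide +kernel)

theorem gadget_three_four : Gadget 3 4 :=
  gadget_of_data (by decide) (D := kmap (complete 12) (develop 2 12 2 [
    [[11, 5, 10, 1], [7, 0, 6, 3], [2, 9, 4, 8]],
    [[10, 3, 5, 2], [1, 4, 0, 9], [8, 7, 11, 6]]]))
    (by decide +kernel)

theorem gadget_three_six : Gadget 3 6 :=
  gadget_of_data (by decide) (D := kmap (complete 18) (develop 3 18 3 [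
    [[6, 12, 5, 17, 11, 1], [2, 8, 13, 0, 7, 16], [14, 9, 4, 15, 10, 3]],
    [[2, 15, 7, 3, 9, 13], [14, 5, 8, 12, 0, 11], [4, 6, 16, 1, 10, 17]]]))
    (by decide +kernel)

theorem gadget_three_eight : Gadget 3 8 :=
  gadget_of_data (by decide) (D := kmap (complete 24) (develop 8 24 8 [
    [[14, 4, 17, 13, 0, 11, 3, 22], [9, 20, 5, 12, 21, 15, 1, 19], [8, 23, 10, 6, 18, 2, 16, 7]]]))
    (by decide +kernel)

theorem gadget_three_ten : Gadget 3 10 :=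
  gadget_of_data (by decide) (D := kmap (complete 30) (develop 5 30 5 [
    [[7, 20, 0, 19, 21, 4, 26, 3, 10, 29], [13, 8, 27, 11, 1, 18, 9, 25, 15, 24],
     [6, 12, 22, 16, 5, 17, 28, 2, 23, 14]],
    [[24, 9, 29, 15, 7, 23, 6, 20, 1, 16], [11, 0, 25, 10, 2, 18, 8, 12, 5, 28],
     [26, 13, 4, 17, 22, 14, 21, 3, 27, 19]]]))
    (by decide +kernel)

theorem gadget_three_fourteen : Gadget 3 14 :=
  gadget_of_data (by decide) (D := kmap (complete 42) (develop 7 42 7 [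
    [[37, 6, 17, 32, 4, 22, 38, 5, 29, 24, 36, 20, 40, 15],
     [34, 12, 33, 26, 3, 27, 1, 35, 18, 13, 25, 9, 19, 2],
     [0, 39, 7, 14, 31, 23, 8, 41, 11, 28, 10, 21, 30, 16]],
    [[3, 40, 11, 35, 8, 17, 38, 25, 39, 21, 36, 1, 37, 18],
     [24, 2, 32, 20, 29, 26, 30, 19, 6, 27, 0, 14, 13, 41],
     [22, 12, 16, 4, 31, 5, 34, 7, 33, 10, 23, 9, 15, 28]]]))
    (by decide +kernel)

theorem gadget_four_four : Gadget 4 4 :=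
  gadget_of_data (by decide) (D := kmap (complete 16) (develop 4 16 4 [
    [[11, 4, 9, 5], [7, 0, 6, 2], [12, 8, 13, 10], [1, 14, 3, 15]]]))
    (by decide +kernel)

theorem gadget_four_six : Gadget 4 6 :=
  gadget_of_data (by decide) (D := kmap (complete 24) (develop 6 24 6 [
    [[19, 12, 22, 1, 21, 2], [10, 3, 7, 14, 8, 13], [5, 11, 0, 9, 17, 23], [18, 16, 6, 4, 20, 15]]]))
    (by decide +kernel)

theorem gadget_four_eight : Gadget 4 8 :=
  gadget_of_data (by decide) (D := kmap (complete 32) (develop 8 32 8 [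
    [[29, 17, 11, 5, 14, 22, 24, 18], [12, 7, 25, 2, 27, 3, 13, 23], [1, 9, 16, 31, 4, 15, 0, 30],
     [8, 21, 26, 6, 10, 19, 28, 20]]]))
    (by decide +kernel)

theorem gadget_four_ten : Gadget 4 10 :=
  gadget_of_data (by decide) (D := kmap (complete 40) (develop 10 40 10 [
    [[39, 6, 12, 5, 37, 3, 15, 2, 13, 8], [20, 38, 27, 11, 21, 16, 25, 35, 7, 33],
     [17, 24, 36, 9, 34, 4, 14, 0, 18, 29], [26, 31, 22, 19, 23, 30, 1, 10, 28, 32]]]))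
    (by decide +kernel)

theorem gadget_four_fourteen : Gadget 4 14 :=
  gadget_of_data (by decide) (D := kmap (complete 56) (develop 14 56 14 [
    [[46, 39, 48, 32, 14, 40, 44, 30, 21, 7, 24, 5, 15, 36],
     [10, 23, 31, 17, 6, 26, 11, 47, 34, 42, 9, 16, 29, 19],
     [43, 13, 25, 41, 22, 37, 20, 12, 51, 3, 52, 35, 54, 28],
     [18, 0, 55, 1, 53, 33, 27, 38, 49, 4, 50, 8, 45, 2]]]))
    (by decide +kernel)

theorem gadget_five_four : Gadget 5 4 :=
  gadget_of_data (by decide) (D := kmap (complete 20) (develop 2 20 2 [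
    [[12, 11, 15, 10], [5, 9, 7, 8], [3, 18, 0, 16], [19, 13, 17, 14], [1, 4, 2, 6]],
    [[12, 17, 15, 19], [13, 9, 14, 8], [18, 1, 16, 2], [4, 3, 6, 0], [7, 11, 5, 10]]]))
    (by decide +kernel)

theorem gadget_five_six : Gadget 5 6 :=
  gadget_of_data (by decide) (D := kmap (complete 30) (develop 3 30 3 [
    [[0, 6, 3, 26, 1, 29], [27, 23, 13, 8, 14, 20], [9, 5, 7, 16, 10, 2], [12, 11, 15, 21, 17, 19],
     [24, 22, 28, 4, 25, 18]],
    [[17, 6, 1, 10, 4, 9], [7, 3, 28, 5, 24, 0], [11, 14, 19, 27, 22, 13], [26, 23, 12, 8, 15, 18],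
     [20, 29, 2, 25, 21, 16]]]))
    (by decide +kernel)

theorem gadget_five_eight : Gadget 5 8 :=
  gadget_of_data (by decide) (D := kmap (complete 40) (develop 8 40 8 [
    [[23, 30, 16, 27, 37, 25, 36, 28], [9, 4, 15, 18, 13, 19, 29, 21],
     [14, 0, 8, 17, 10, 20, 12, 5], [26, 22, 31, 38, 24, 33, 3, 39], [6, 32, 1, 11, 7, 34, 2, 35]]]))
    (by decide +kernel)

theorem gadget_five_ten : Gadget 5 10 :=
  gadget_of_data (by decide) (D := kmap (complete 50) (develop 5 50 5 [
    [[33, 43, 8, 16, 0, 41, 7, 48, 39, 42], [27, 34, 22, 17, 23, 10, 20, 38, 49, 30],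
     [6, 14, 3, 40, 35, 28, 13, 29, 37, 44], [21, 12, 2, 11, 25, 18, 1, 15, 24, 36],
     [5, 45, 32, 26, 31, 46, 4, 19, 9, 47]],
    [[13, 24, 35, 21, 31, 47, 39, 40, 33, 20], [4, 17, 6, 15, 22, 19, 25, 16, 9, 48],
     [32, 28, 18, 26, 37, 27, 36, 46, 34, 23], [12, 5, 10, 2, 14, 8, 44, 7, 11, 29],
     [42, 3, 49, 1, 41, 30, 43, 0, 45, 38]]]))
    (by decide +kernel)

theorem gadget_five_fourteen : Gadget 5 14 :=
  gadget_of_data (by decide) (D := kmap (complete 70) (develop 7 70 7 [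
    [[18, 5, 24, 35, 21, 41, 14, 32, 16, 6, 26, 12, 25, 8],
     [31, 22, 10, 62, 0, 59, 13, 20, 34, 27, 2, 23, 40, 43],
     [47, 39, 48, 61, 3, 15, 30, 17, 38, 45, 64, 7, 19, 36],
     [1, 67, 50, 56, 46, 68, 44, 28, 54, 37, 42, 57, 4, 69],
     [33, 51, 63, 49, 58, 11, 66, 55, 60, 9, 65, 52, 29, 53]],
    [[39, 17, 29, 25, 31, 42, 63, 45, 28, 43, 30, 51, 61, 54],
     [65, 2, 20, 6, 15, 40, 52, 38, 19, 4, 26, 8, 57, 3],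
     [1, 58, 10, 16, 33, 21, 36, 27, 11, 64, 49, 34, 48, 68],
     [47, 41, 18, 7, 66, 50, 37, 53, 35, 23, 0, 56, 55, 59],
     [69, 5, 22, 32, 24, 9, 67, 13, 14, 12, 62, 44, 60, 46]]]))
    (by decide +kernel)

theorem gadget_three_three : Gadget 3 3 :=
  gadget_of_data (by decide) (D := kmap (complete 9) (develop 1 9 1 [
    [[0, 3, 6], [1, 4, 7], [2, 5, 8]],
    [[0, 4, 8], [1, 5, 6], [2, 3, 7]],
    [[0, 5, 7], [1, 3, 8], [2, 4, 6]]]))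
    (by decide +kernel)

theorem gadget_three_five : Gadget 3 5 :=
  gadget_of_data (by decide) (D := kmap (complete 15) (develop 1 15 1 [
    [[0, 11, 7, 2, 13], [12, 6, 14, 5, 1], [8, 4, 9, 3, 10]],
    [[3, 7, 13, 5, 11], [8, 12, 4, 10, 1], [9, 2, 6, 0, 14]],
    [[3, 8, 2, 11, 6], [1, 14, 4, 13, 9], [0, 7, 10, 5, 12]],
    [[7, 12, 3, 13, 1], [14, 2, 5, 0, 8], [6, 10, 9, 11, 4]],
    [[6, 1, 11, 8, 13], [10, 2, 12, 9, 0], [5, 3, 14, 7, 4]]]))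
    (by decide +kernel)

theorem gadget_five_seven : Gadget 5 7 :=
  gadget_of_data (by decide) (D := kmap (complete 35) (develop 1 35 1 [
    [[31, 1, 8, 19, 21, 15, 24], [7, 16, 27, 32, 23, 29, 2], [13, 0, 30, 26, 17, 9, 14],
     [4, 28, 5, 33, 25, 18, 10], [6, 34, 22, 20, 12, 3, 11]],
    [[10, 2, 34, 24, 33, 21, 20], [28, 0, 12, 5, 11, 15, 25], [14, 8, 4, 29, 22, 16, 26],
     [7, 18, 9, 1, 30, 23, 17], [27, 19, 13, 6, 32, 3, 31]],
    [[29, 25, 17, 21, 16, 8, 5], [11, 14, 22, 31, 6, 7, 19], [15, 23, 34, 4, 9, 0, 10],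
     [24, 30, 3, 33, 2, 12, 18], [13, 1, 32, 26, 28, 27, 20]],
    [[3, 9, 19, 25, 34, 5, 13], [21, 28, 1, 11, 16, 23, 31], [29, 26, 18, 27, 14, 10, 6],
     [0, 7, 20, 24, 32, 4, 33], [15, 12, 17, 22, 30, 2, 8]],
    [[12, 19, 24, 14, 23, 33, 1], [4, 30, 25, 20, 11, 2, 31], [8, 0, 34, 26, 15, 7, 3],
     [10, 5, 32, 21, 29, 27, 17], [28, 6, 9, 16, 13, 18, 22]],
    [[18, 23, 19, 22, 33, 6, 8], [12, 14, 21, 34, 1, 10, 16], [9, 20, 26, 31, 25, 32, 2],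
     [28, 3, 29, 0, 11, 17, 24], [7, 5, 30, 27, 15, 13, 4]],
    [[21, 30, 6, 12, 4, 11, 18], [24, 29, 1, 7, 14, 25, 16], [2, 28, 23, 20, 8, 17, 13],
     [5, 31, 0, 32, 22, 15, 9], [33, 27, 34, 3, 10, 19, 26]]]))
    (by decide +kernel)

theorem gadget_three_seven : Gadget 3 7 :=
  gadget_of_data (by decide) (D := kmap (complete 21) (develop 7 21 7 [
    [[15, 13, 20, 4, 11, 0, 10], [12, 16, 3, 14, 6, 8, 18], [5, 19, 2, 7, 1, 9, 17]]]))
    (by decide +kernel)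

theorem gadget_five_five : Gadget 5 5 :=
  gadget_of_data (by decide) (D := kmap (complete 25) (develop 5 25 5 [
    [[2, 22, 15, 11, 7], [4, 20, 16, 14, 6], [13, 8, 0, 24, 19], [23, 17, 12, 5, 1],
     [21, 18, 10, 9, 3]]]))
    (by decide +kernel)

theorem gadget_five_nine : Gadget 5 9 :=
  gadget_of_data (by decide) (D := kmap (complete 45) (develop 9 45 9 [
    [[40, 28, 20, 33, 43, 8, 17, 24, 35], [19, 31, 37, 7, 10, 22, 16, 1, 9],
     [4, 41, 0, 42, 29, 23, 15, 2, 38], [5, 12, 21, 30, 39, 32, 18, 34, 36],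
     [13, 26, 27, 44, 6, 11, 25, 14, 3]]]))
    (by decide +kernel)

theorem gadget_five_eleven : Gadget 5 11 :=
  gadget_of_data (by decide) (D := kmap (complete 55) (develop 11 55 11 [
    [[36, 47, 10, 18, 0, 14, 5, 20, 28, 37, 45], [43, 25, 12, 6, 52, 2, 46, 40, 53, 38, 32],
     [24, 39, 31, 34, 44, 41, 48, 7, 50, 1, 17], [4, 51, 9, 21, 8, 19, 30, 35, 23, 33, 49],
     [3, 54, 42, 29, 15, 27, 11, 26, 16, 22, 13]]]))
    (by decide +kernel)

theorem twoFrame_three_four : TwoFrame (fun m => Nat.beq 4 m = true) 3 :=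
  twoFrame_of_data (K := (Nat.beq 4)) (by decide)
    (D := kmap (complete 6) (develop 3 6 3 [
    [[5, 4, 2, 1]]]))
    (by decide +kernel)

theorem twoFrame_five_four : TwoFrame (fun m => Nat.beq 4 m = true) 5 :=
  twoFrame_of_data (K := (Nat.beq 4)) (by decide)
    (D := kmap (complete 10) (develop 5 10 5 [
    [[9, 8, 1, 7], [4, 3, 6, 2]]]))
    (by decide +kernel)

theorem twoFrame_four_three : TwoFrame (fun m => Nat.beq 3 m = true) 4 :=
  twoFrame_of_data (K := (Nat.beq 3)) (by decide)
    (D := kmap (complete 8) (develop 8 8 4 [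
    [[1, 2, 7], [5, 6, 3]]]))
    (by decide +kernel)

theorem twoFrame_seven : TwoFrame (fun m => (Nat.beq 3 m || Nat.beq 5 m) = true) 7 :=
  twoFrame_of_data (K := (fun m => Nat.beq 3 m || Nat.beq 5 m)) (by decide)
    (D := kmap (complete 14) (develop 7 14 7 [
    [[1, 4, 2], [8, 12, 3], [10, 6, 9], [11, 13, 5]]]))
    (by decide +kernel)

theorem twoFrame_eight : TwoFrame (fun m => (Nat.beq 3 m || Nat.beq 5 m) = true) 8 :=
  twoFrame_of_data (K := (fun m => Nat.beq 3 m || Nat.beq 5 m)) (by decide)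
    (D := kmap (complete 16) (develop 1 16 1 [
    [[9, 15, 12], [4, 10, 6], [2, 5, 7], [3, 13, 11, 1, 14]],
    [[15, 2, 14], [0, 4, 11], [7, 3, 6], [10, 8, 13, 12, 5]],
    [[6, 11, 9], [0, 14, 12], [8, 3, 5], [7, 4, 15, 13, 1]],
    [[0, 7, 10], [6, 5, 15], [13, 14, 4], [1, 12, 2, 9, 8]],
    [[14, 8, 7], [2, 6, 13], [10, 15, 11], [1, 3, 0, 9, 5]],
    [[6, 0, 1], [11, 12, 7], [9, 10, 14], [15, 3, 2, 4, 8]],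
    [[2, 8, 11], [12, 10, 3], [13, 7, 9], [1, 15, 0, 5, 4]],
    [[14, 11, 5], [3, 9, 4], [6, 8, 12], [2, 1, 10, 13, 0]]]))
    (by decide +kernel)

theorem twoFrame_nine : TwoFrame (fun m => (Nat.beq 3 m || Nat.beq 5 m) = true) 9 :=
  twoFrame_of_data (K := (fun m => Nat.beq 3 m || Nat.beq 5 m)) (by decide)
    (D := kmap (complete 18) (develop 9 18 9 [
    [[8, 7, 5, 15, 11], [17, 2, 6, 10, 3], [14, 13, 16], [1, 12, 4]]]))
    (by decide +kernel)

theorem twoFrame_twelve : TwoFrame (fun m => (Nat.beq 3 m || Nat.beq 5 m) = true) 12 :=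
  twoFrame_of_data (K := (fun m => Nat.beq 3 m || Nat.beq 5 m)) (by decide)
    (D := kmap (complete 24) (develop 24 24 12 [
    [[1, 2, 4, 7, 20], [3, 18, 10], [5, 9, 23], [13, 14, 16, 19, 8], [15, 6, 22], [17, 21, 11]]]))
    (by decide +kernel)

theorem twoFrame_six_five : TwoFrame (fun m => Nat.beq 5 m = true) 6 :=
  twoFrame_of_data (K := (Nat.beq 5)) (by decide)
    (D := kmap (complete 12) (develop 1 12 1 [
    [[1, 10, 8, 7, 4], [2, 3, 5, 9, 11]],
    [[11, 4, 8, 9, 0], [5, 2, 6, 3, 10]],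
    [[3, 11, 1, 6, 4], [0, 10, 9, 7, 5]],
    [[8, 11, 10, 2, 1], [6, 5, 4, 0, 7]],
    [[11, 7, 2, 9, 6], [8, 0, 3, 1, 5]],
    [[0, 2, 4, 9, 1], [8, 3, 7, 10, 6]]]))
    (by decide +kernel)

theorem twoFrame_ten : TwoFrame (fun m => (Nat.beq 3 m || Nat.beq 5 m) = true) 10 :=
  twoFrame_of_data (K := (fun m => Nat.beq 3 m || Nat.beq 5 m)) (by decide)
    (D := kmap (complete 20) (develop 5 20 5 [
    [[4, 8, 6], [19, 18, 5], [14, 7, 13], [3, 15, 1], [16, 12, 9], [17, 2, 11]],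
    [[2, 13, 1], [19, 14, 11], [4, 12, 7], [18, 16, 0], [9, 3, 8], [6, 17, 10]]]))
    (by decide +kernel)

theorem twoFrame_eleven : TwoFrame (fun m => (Nat.beq 3 m || Nat.beq 5 m) = true) 11 :=
  twoFrame_of_data (K := (fun m => Nat.beq 3 m || Nat.beq 5 m)) (by decide)
    (D := kmap (complete 22) (develop 11 22 11 [
    [[12, 16, 2, 19, 3], [9, 6, 7], [8, 21, 15], [13, 5, 1], [20, 17, 18], [4, 14, 10]]]))
    (by decide +kernel)

theorem twoFrame_thirteen : TwoFrame (fun m => (Nat.beq 3 m || Nat.beq 5 m) = true) 13 :=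
  twoFrame_of_data (K := (fun m => Nat.beq 3 m || Nat.beq 5 m)) (by decide)
    (D := kmap (complete 26) (develop 13 26 13 [
    [[5, 19, 2], [22, 15, 7], [21, 3, 12], [14, 24, 23], [9, 10, 16], [17, 1, 25], [6, 11, 4],
     [8, 20, 18]]]))
    (by decide +kernel)

theorem twoFrame_fourteen : TwoFrame (fun m => (Nat.beq 3 m || Nat.beq 5 m) = true) 14 :=
  twoFrame_of_data (K := (fun m => Nat.beq 3 m || Nat.beq 5 m)) (by decide)
    (D := kmap (complete 28) (develop 7 28 7 [
    [[4, 11, 9, 13, 12], [8, 24, 19], [17, 1, 25], [20, 23, 26], [3, 7, 2], [5, 16, 18],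
     [15, 22, 10], [27, 6, 21]],
    [[10, 25, 14, 20, 16], [22, 24, 11], [1, 27, 4], [26, 17, 9], [6, 18, 8], [12, 2, 19],
     [13, 15, 0], [23, 3, 5]]]))
    (by decide +kernel)

theorem twoFrame_fifteen : TwoFrame (fun m => (Nat.beq 3 m || Nat.beq 5 m) = true) 15 :=
  twoFrame_of_data (K := (fun m => Nat.beq 3 m || Nat.beq 5 m)) (by decide)
    (D := kmap (complete 30) (develop 15 30 15 [
    [[22, 19, 18, 5, 29], [3, 24, 10, 17, 7], [27, 21, 25], [6, 13, 4], [23, 12, 28], [26, 14, 9],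
     [11, 8, 16], [1, 20, 2]]]))
    (by decide +kernel)

theorem frame_three_five : Frame 3 5 :=
  frame_of_data (by decide) (by decide)
    (D := kmap (complete 30) (develop 15 30 15 [
    [[1, 18, 29], [17, 14, 8], [6, 4, 7], [11, 3, 22], [16, 2, 23], [26, 24, 27], [28, 12, 19],
     [9, 13, 21]]]))
    (by decide +kernel)

theorem frame_three_six : Frame 3 6 :=
  frame_of_data (by decide) (by decide)
    (D := kmap (complete 36) (develop 1 36 1 [
    [[17, 10, 31], [7, 11, 28], [34, 33, 26], [1, 4, 32], [35, 13, 9], [22, 20, 15], [23, 19, 2],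
     [27, 14, 16], [5, 21, 25], [3, 8, 29]],
    [[17, 6, 32], [8, 11, 24], [30, 34, 27], [2, 0, 33], [35, 14, 10], [18, 21, 16], [23, 20, 3],
     [28, 15, 12], [5, 22, 26], [4, 9, 29]],
    [[17, 7, 33], [9, 11, 25], [31, 30, 28], [3, 1, 34], [35, 15, 6], [19, 22, 12], [23, 21, 4],
     [24, 16, 13], [5, 18, 27], [0, 10, 29]],
    [[17, 8, 34], [10, 11, 26], [32, 31, 24], [4, 2, 30], [35, 16, 7], [20, 18, 13], [23, 22, 0],
     [25, 12, 14], [5, 19, 28], [1, 6, 29]],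
    [[17, 9, 30], [6, 11, 27], [33, 32, 25], [0, 3, 31], [35, 12, 8], [21, 19, 14], [23, 18, 1],
     [26, 13, 15], [5, 20, 24], [2, 7, 29]],
    [[8, 27, 4], [33, 16, 19], [9, 28, 0], [34, 12, 20], [10, 24, 1], [30, 13, 21], [6, 25, 2],
     [31, 14, 22], [7, 26, 3], [32, 15, 18]],
    [[21, 34, 35], [9, 19, 20], [28, 8, 25], [29, 33, 13], [7, 15, 10], [11, 4, 14], [2, 3, 22],
     [26, 31, 23], [16, 5, 32], [1, 27, 17]],
    [[22, 30, 35], [10, 20, 21], [24, 9, 26], [29, 34, 14], [8, 16, 6], [11, 0, 15], [3, 4, 18],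
     [27, 32, 23], [12, 5, 33], [2, 28, 17]],
    [[18, 31, 35], [6, 21, 22], [25, 10, 27], [29, 30, 15], [9, 12, 7], [11, 1, 16], [4, 0, 19],
     [28, 33, 23], [13, 5, 34], [3, 24, 17]],
    [[19, 32, 35], [7, 22, 18], [26, 6, 28], [29, 31, 16], [10, 13, 8], [11, 2, 12], [0, 1, 20],
     [24, 34, 23], [14, 5, 30], [4, 25, 17]],
    [[20, 33, 35], [8, 18, 19], [27, 7, 24], [29, 32, 12], [6, 14, 9], [11, 3, 13], [1, 2, 21],
     [25, 30, 23], [15, 5, 31], [0, 26, 17]],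
    [[14, 28, 3], [10, 19, 30], [15, 24, 4], [6, 20, 31], [16, 25, 0], [7, 21, 32], [12, 26, 1],
     [8, 22, 33], [13, 27, 2], [9, 18, 34]],
    [[2, 16, 15], [9, 32, 10], [13, 22, 17], [19, 34, 11], [33, 4, 31], [23, 14, 7], [3, 25, 35],
     [28, 20, 27], [8, 5, 1], [29, 26, 21]],
    [[3, 12, 16], [10, 33, 6], [14, 18, 17], [20, 30, 11], [34, 0, 32], [23, 15, 8], [4, 26, 35],
     [24, 21, 28], [9, 5, 2], [29, 27, 22]],
    [[4, 13, 12], [6, 34, 7], [15, 19, 17], [21, 31, 11], [30, 1, 33], [23, 16, 9], [0, 27, 35],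
     [25, 22, 24], [10, 5, 3], [29, 28, 18]],
    [[0, 14, 13], [7, 30, 8], [16, 20, 17], [22, 32, 11], [31, 2, 34], [23, 12, 10], [1, 28, 35],
     [26, 18, 25], [6, 5, 4], [29, 24, 19]],
    [[1, 15, 14], [8, 31, 9], [12, 21, 17], [18, 33, 11], [32, 3, 30], [23, 13, 6], [2, 24, 35],
     [27, 19, 26], [7, 5, 0], [29, 25, 20]],
    [[18, 2, 10], [30, 16, 26], [19, 3, 6], [31, 12, 27], [20, 4, 7], [32, 13, 28], [21, 0, 8],
     [33, 14, 24], [22, 1, 9], [34, 15, 25]]]))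
    (by decide +kernel)

theorem frame_five_five : Frame 5 5 :=
  frame_of_data (by decide) (by decide)
    (D := kmap (complete 50) (develop 5 50 5 [
    [[28, 36, 4, 21, 29], [23, 12, 11, 9, 7], [33, 26, 42, 38, 2], [43, 32, 14, 27, 49],
     [44, 17, 41, 24, 3], [34, 31, 22, 48, 6], [19, 13, 1, 39, 46], [8, 47, 18, 37, 16]],
    [[33, 41, 9, 1, 34], [3, 17, 16, 14, 12], [38, 31, 47, 43, 7], [48, 37, 19, 32, 29],
     [49, 22, 46, 4, 8], [39, 36, 2, 28, 11], [24, 18, 6, 44, 26], [13, 27, 23, 42, 21]],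
    [[38, 46, 14, 6, 39], [8, 22, 21, 19, 17], [43, 36, 27, 48, 12], [28, 42, 24, 37, 34],
     [29, 2, 26, 9, 13], [44, 41, 7, 33, 16], [4, 23, 11, 49, 31], [18, 32, 3, 47, 1]],
    [[43, 26, 19, 11, 44], [13, 2, 1, 24, 22], [48, 41, 32, 28, 17], [33, 47, 4, 42, 39],
     [34, 7, 31, 14, 18], [49, 46, 12, 38, 21], [9, 3, 16, 29, 36], [23, 37, 8, 27, 6]],
    [[48, 31, 24, 16, 49], [18, 7, 6, 4, 2], [28, 46, 37, 33, 22], [38, 27, 9, 47, 44],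
     [39, 12, 36, 19, 23], [29, 26, 17, 43, 1], [14, 8, 21, 34, 41], [3, 42, 13, 32, 11]]]))
    (by decide +kernel)

/-! ### Families of systems that depend linearly on a parameter

A pair `(u, v)` of integers stands for the linear form `u * h + v` in a parameter `h`. -/

/-- The value of a linear form. -/
def lin (h : ℤ) (l : ℤ × ℤ) : ℤ := l.1 * h + l.2

/-- A sufficient condition for one linear form to be at most another for all `h ≥ h₀`. -/
def linLE (h₀ : ℤ) (l m : ℤ × ℤ) : Bool := l.1 ≤ m.1 && lin h₀ l ≤ lin h₀ m

theorem linLE_spec {h₀ h : ℤ} (hh : h₀ ≤ h) {l m : ℤ × ℤ} (hlm : linLE h₀ l m = true) :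
    lin h l ≤ lin h m := by
  rw [linLE, Bool.and_eq_true, decide_eq_true_eq, decide_eq_true_eq] at hlm
  obtain ⟨h1, h2⟩ := hlm
  simp only [lin] at *
  nlinarith

theorem lin_add (h : ℤ) (l m : ℤ × ℤ) : lin h (l + m) = lin h l + lin h m := by
  simp only [lin, Prod.fst_add, Prod.snd_add]; ring

theorem lin_sub (h : ℤ) (l m : ℤ × ℤ) : lin h (l - m) = lin h l - lin h m := by
  simp only [lin, Prod.fst_sub, Prod.snd_sub]; ring

theorem lin_neg (h : ℤ) (l : ℤ × ℤ) : lin h (-l) = -lin h l := by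
  simp only [lin, Prod.fst_neg, Prod.snd_neg]; ring

theorem lin_const (h c : ℤ) : lin h (0, c) = c := by simp [lin]

/-- The integer `x` lies in one of the intervals in `I`. -/
def InSome (h : ℤ) (I : List ((ℤ × ℤ) × (ℤ × ℤ))) (x : ℤ) : Prop :=
  ∃ J ∈ I, lin h J.1 ≤ x ∧ x ≤ lin h J.2

/-- A greedy check that the intervals in `I` cover everything from `f` up to `M`. -/
def reaches (h₀ : ℤ) (M : ℤ × ℤ) (I : List ((ℤ × ℤ) × (ℤ × ℤ))) : ℕ → ℤ × ℤ → Bool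
  | 0, f => linLE h₀ M f
  | n + 1, f => linLE h₀ M f || match I.find? fun J => linLE h₀ J.1 f && linLE h₀ f J.2 with
    | some J => reaches h₀ M I n (J.2 + (0, 1))
    | none => false

theorem reaches_spec {h₀ h : ℤ} (hh : h₀ ≤ h) {M : ℤ × ℤ} {I : List ((ℤ × ℤ) × (ℤ × ℤ))} :
    ∀ {n : ℕ} {f : ℤ × ℤ}, reaches h₀ M I n f = true → ∀ x, lin h f ≤ x → x < lin h M →
      InSome h I x := by
  intro n
  induction n with
  | zero =>
    intro f hf x h1 h2
    have := linLE_spec hh hf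
    omega
  | succ n ih =>
    intro f hf x h1 h2
    rw [reaches, Bool.or_eq_true] at hf
    rcases hf with hf | hf
    · have := linLE_spec hh hf
      omega
    · split at hf
      case h_2 => exact absurd hf (by simp)
      case h_1 J hJ =>
        have h3 := List.find?_some hJ
        rw [Bool.and_eq_true] at h3
        have h4 := linLE_spec hh h3.1
        by_cases hx : x ≤ lin h J.2
        · exact ⟨J, List.mem_of_find?_eq_some hJ, by omega, hx⟩
        · refine ih hf x ?_ h2
          rw [lin_add, lin_const]
          omega

/-- A check that the intervals in `I` cover all residues modulo `M`. -/
def covered (h₀ : ℤ) (M : ℤ × ℤ) (I : List ((ℤ × ℤ) × (ℤ × ℤ))) : Bool :=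
  reaches h₀ M ([0, 1, -1, 2, -2].flatMap fun c : ℤ => I.map fun J =>
    (J.1 + (c * M.1, c * M.2), J.2 + (c * M.1, c * M.2))) (6 * I.length) (0, 0)

theorem covered_spec {h₀ h : ℤ} (hh : h₀ ≤ h) {M : ℤ × ℤ} {N : ℕ} [NeZero N]
    (hN : (N : ℤ) = lin h M) {I : List ((ℤ × ℤ) × (ℤ × ℤ))} (hI : covered h₀ M I = true)
    (d : ZMod N) : ∃ x : ℤ, InSome h I x ∧ (x : ZMod N) = d := by
  obtain ⟨J, hJ, h1, h2⟩ := reaches_spec hh hI (d.val : ℤ)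
    (by rw [lin_const]; exact Int.natCast_nonneg _)
    (by rw [← hN]; exact_mod_cast d.val_lt)
  obtain ⟨c, -, hJ⟩ := List.mem_flatMap.1 hJ
  obtain ⟨J, hJ', rfl⟩ := List.mem_map.1 hJ
  have h3 : lin h (c * M.1, c * M.2) = c * N := by rw [hN]; simp only [lin]; ring
  simp only [lin_add, h3] at h1 h2
  refine ⟨d.val - c * N, ⟨J, hJ', by omega, by omega⟩, ?_⟩
  simp

/-- The list `p, q, p + s, q - s, p + 2 * s, q - 2 * s, …` of length `n`, where the shifts are in
the second component. -/
def zig : ℕ → ℕ × ℤ → ℕ × ℤ → ℤ → List (ℕ × ℤ)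
  | 0, _, _, _ => []
  | n + 1, p, q, s => p :: zig n q (p.1, p.2 + s) (-s)

/-- `x` and `y` are consecutive in `L`, in one of the two orders. -/
def Adj {V : Type*} (L : List V) (x y : V) : Prop := [x, y] <:+: L ∨ [y, x] <:+: L

theorem Adj.symm {V : Type*} {L : List V} {x y : V} (h : Adj L x y) : Adj L y x := Or.symm h

theorem Adj.mono {V : Type*} {L M : List V} {x y : V} (h : Adj L x y) (hL : L <:+: M) :
    Adj M x y := h.imp (·.trans hL) (·.trans hL)

theorem Adj.map {V W : Type*} {L : List V} {x y : V} (h : Adj L x y) (f : V → W) :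
    Adj (L.map f) (f x) (f y) := h.imp (·.map f) (·.map f)

theorem length_zig (n : ℕ) (p q : ℕ × ℤ) (s : ℤ) : (zig n p q s).length = n := by
  induction n generalizing p q s with
  | zero => rfl
  | succ n ih => rw [zig, List.length_cons, ih]

theorem mem_zig (n : ℕ) (p q : ℕ × ℤ) (s : ℤ) (j : ℕ) :
    (2 * j < n → (p.1, p.2 + s * j) ∈ zig n p q s) ∧
      (2 * j + 1 < n → (q.1, q.2 - s * j) ∈ zig n p q s) := by
  induction n generalizing p q s j with
  | zero => simp
  | succ n ih =>
    rw [zig]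
    constructor
    · intro hj
      rcases j with _ | j
      · simp
      · have := (ih q (p.1, p.2 + s) (-s) j).2 (by omega)
        apply List.mem_cons_of_mem
        convert this using 2
        push_cast
        ring
    · intro hj
      have := (ih q (p.1, p.2 + s) (-s) j).1 (by omega)
      apply List.mem_cons_of_mem
      convert this using 2
      ring

theorem adj_zig (n : ℕ) (p q : ℕ × ℤ) (s : ℤ) (j : ℕ) (hj : j + 1 < n) :
    ∃ a, Adj (zig n p q s) (p.1, a) (q.1, a + (q.2 - p.2 - s * j)) := by
  induction n generalizing p q s j with
  | zero => omega
  | succ n ih =>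
    rcases j with _ | j
    · obtain ⟨n, rfl⟩ : ∃ m, n = m + 1 := ⟨n - 1, by omega⟩
      refine ⟨p.2, .inl ⟨[], zig n (p.1, p.2 + s) (q.1, q.2 + -s) (- -s), ?_⟩⟩
      rw [zig, zig, show p.2 + (q.2 - p.2 - s * (0 : ℕ)) = q.2 by push_cast; ring]
      rfl
    · obtain ⟨a, ha⟩ := ih q (p.1, p.2 + s) (-s) j (by omega)
      refine ⟨a + (p.2 + s - q.2 + s * j), ?_⟩
      rw [zig]
      convert ha.symm.mono (List.suffix_cons p _).isInfix using 2
      · simp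
      · push_cast
        ring

theorem zig_eq_append (m : ℕ) (p q : ℕ × ℤ) (s : ℤ) :
    (∃ l, zig (2 * m + 1) p q s = l ++ [(p.1, p.2 + s * m)]) ∧
      ∃ l, zig (2 * m + 2) p q s = l ++ [(q.1, q.2 - s * m)] := by
  induction m generalizing p q s with
  | zero => exact ⟨⟨[], by simp [zig]⟩, ⟨[p], by simp [zig]⟩⟩
  | succ m ih =>
    obtain ⟨⟨l, hl⟩, l', hl'⟩ := ih (p.1, p.2 + s) (q.1, q.2 + -s) (- -s)
    constructor
    · refine ⟨p :: q :: l, ?_⟩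
      rw [show 2 * (m + 1) + 1 = 2 * m + 1 + 1 + 1 by ring, zig, zig, hl]
      simp only [List.cons_append]
      congr 4
      push_cast
      ring_nf
    · refine ⟨p :: q :: l', ?_⟩
      rw [show 2 * (m + 1) + 2 = 2 * m + 2 + 1 + 1 by ring, zig, zig, hl']
      simp only [List.cons_append]
      congr 4
      push_cast
      ring_nf

/-- A segment of a cycle: `n` points alternating between the levels `X` and `Y`, starting from
the points `a` and `b` and moving in opposite directions by steps of one. -/
structure Seg where
  /-- The first level. -/
  X : ℕ
  /-- The first point on the first level. -/
  a : ℤ × ℤ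
  /-- The second level. -/
  Y : ℕ
  /-- The first point on the second level. -/
  b : ℤ × ℤ
  /-- Whether the points on the first level are increasing. -/
  up : Bool
  /-- The number of points. -/
  n : ℤ × ℤ

namespace Seg

/-- The segment with a single point. -/
def pt (X : ℕ) (u v : ℤ) : Seg := ⟨X, (u, v), X, (u, v), true, (0, 1)⟩

/-- The points of a segment. -/
def expand (h : ℤ) (g : Seg) : List (ℕ × ℤ) :=
  zig (lin h g.n).toNat (g.X, lin h g.a) (g.Y, lin h g.b) (bif g.up then 1 else -1)

/-- The segment is not empty, and the parity of its length does not depend on `h`. -/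
def ok (h₀ : ℤ) (g : Seg) : Bool := linLE h₀ (0, 1) g.n && g.n.1 % 2 == 0

/-- The index of the last point on the first level. -/
def lastX (g : Seg) : ℤ × ℤ := (g.n.1 / 2, (g.n.2 - 1) / 2)

/-- The index of the last point on the second level. -/
def lastY (g : Seg) : ℤ × ℤ := (g.n.1 / 2, g.n.2 / 2 - 1)

/-- The interval from `a` moving up or down by `m`. -/
def ival (up : Bool) (a m : ℤ × ℤ) : (ℤ × ℤ) × (ℤ × ℤ) := bif up then (a, a + m) else (a - m, a)

/-- The intervals occupied on the two levels. -/
def verts (g : Seg) : List (ℕ × (ℤ × ℤ) × (ℤ × ℤ)) :=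
  [(g.X, ival g.up g.a g.lastX), (g.Y, ival (!g.up) g.b g.lastY)]

/-- The last point. -/
def last (g : Seg) : ℕ × (ℤ × ℤ) :=
  bif g.n.2 % 2 == 1 then (g.X, bif g.up then g.a + g.lastX else g.a - g.lastX)
  else (g.Y, bif g.up then g.b - g.lastY else g.b + g.lastY)

/-- The differences between consecutive points. -/
def inner (g : Seg) : ℕ × ℕ × (ℤ × ℤ) × (ℤ × ℤ) :=
  (g.X, g.Y, ival (!g.up) (g.b - g.a) (g.n - (0, 2)))

theorem mem_ival {h : ℤ} {up : Bool} {a m : ℤ × ℤ} {x : ℤ} (h1 : lin h (ival up a m).1 ≤ x)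
    (h2 : x ≤ lin h (ival up a m).2) :
    ∃ j : ℕ, (j : ℤ) ≤ lin h m ∧ x = lin h a + (bif up then 1 else -1) * j := by
  cases up
  · simp only [ival, cond_false, lin_sub] at *
    exact ⟨(lin h a - x).toNat, by omega, by omega⟩
  · simp only [ival, cond_true, lin_add] at *
    exact ⟨(x - lin h a).toNat, by omega, by omega⟩

theorem ok_spec {h₀ h : ℤ} (hh : h₀ ≤ h) {g : Seg} (hg : g.ok h₀ = true) :
    1 ≤ lin h g.n ∧ lin h g.n = 2 * (g.n.1 / 2 * h) + g.n.2 := by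
  simp only [ok, Bool.and_eq_true, beq_iff_eq] at hg
  have h1 := linLE_spec hh hg.1
  rw [lin_const] at h1
  refine ⟨h1, ?_⟩
  have h2 : g.n.1 = 2 * (g.n.1 / 2) := by omega
  rw [lin]
  conv_lhs => rw [h2]
  ring

theorem mem_expand_of_mem_verts {h₀ h : ℤ} (hh : h₀ ≤ h) {g : Seg} (hg : g.ok h₀ = true)
    {I : ℕ × (ℤ × ℤ) × (ℤ × ℤ)} (hI : I ∈ g.verts) {x : ℤ} (h1 : lin h I.2.1 ≤ x)
    (h2 : x ≤ lin h I.2.2) : (I.1, x) ∈ g.expand h := by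
  obtain ⟨hn, hn'⟩ := ok_spec hh hg
  simp only [verts, List.mem_cons, List.not_mem_nil, or_false] at hI
  rcases hI with rfl | rfl
  · obtain ⟨j, hj, rfl⟩ := mem_ival h1 h2
    refine (mem_zig _ _ (g.Y, lin h g.b) _ j).1 ?_
    simp only [lin, lastX] at hj hn hn'
    simp only [lin]
    omega
  · obtain ⟨j, hj, rfl⟩ := mem_ival h1 h2
    have := (mem_zig (lin h g.n).toNat (g.X, lin h g.a) (g.Y, lin h g.b)
      (bif g.up then 1 else -1) j).2 (by
        simp only [lin, lastY] at hj hn hn'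
        simp only [lin]
        omega)
    have h3 : lin h g.b + (bif !g.up then 1 else -1) * (j : ℤ) =
        lin h g.b - (bif g.up then 1 else -1) * j := by
      cases g.up <;> simp [sub_eq_add_neg]
    rw [h3]
    exact this

theorem adj_expand_of_inner {h : ℤ} {g : Seg} {d : ℤ} (h1 : lin h g.inner.2.2.1 ≤ d)
    (h2 : d ≤ lin h g.inner.2.2.2) :
    ∃ a, Adj (g.expand h) (g.inner.1, a) (g.inner.2.1, a + d) := by
  obtain ⟨j, hj, rfl⟩ := mem_ival h1 h2
  rw [lin_sub, lin_const] at hj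
  obtain ⟨a, ha⟩ := adj_zig (lin h g.n).toNat (g.X, lin h g.a) (g.Y, lin h g.b)
    (bif g.up then 1 else -1) j (by omega)
  refine ⟨a, ?_⟩
  have h3 : lin h (g.b - g.a) + (bif !g.up then 1 else -1) * (j : ℤ) =
      lin h g.b - lin h g.a - (bif g.up then 1 else -1) * j := by
    rw [lin_sub]
    cases g.up <;> simp [sub_eq_add_neg]
  simp only [inner]
  rw [h3]
  exact ha

theorem expand_eq_append {h₀ h : ℤ} (hh : h₀ ≤ h) {g : Seg} (hg : g.ok h₀ = true) :
    ∃ l, g.expand h = l ++ [(g.last.1, lin h g.last.2)] := by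
  obtain ⟨hn, hn'⟩ := ok_spec hh hg
  by_cases hp : g.n.2 % 2 = 1
  · have hm : lin h g.lastX = g.n.1 / 2 * h + (g.n.2 - 1) / 2 := rfl
    obtain ⟨l, hl⟩ := (zig_eq_append (lin h g.lastX).toNat (g.X, lin h g.a) (g.Y, lin h g.b)
      (bif g.up then 1 else -1)).1
    refine ⟨l, ?_⟩
    rw [expand, show (lin h g.n).toNat = 2 * (lin h g.lastX).toNat + 1 by omega, hl]
    have : ((lin h g.lastX).toNat : ℤ) = lin h g.lastX := by omega
    rw [this]
    simp only [last, hp, beq_self_eq_true, cond_true]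
    cases g.up <;> simp [lin_add, lin_sub]; ring
  · have hm : lin h g.lastY = g.n.1 / 2 * h + (g.n.2 / 2 - 1) := rfl
    obtain ⟨l, hl⟩ := (zig_eq_append (lin h g.lastY).toNat (g.X, lin h g.a) (g.Y, lin h g.b)
      (bif g.up then 1 else -1)).2
    refine ⟨l, ?_⟩
    rw [expand, show (lin h g.n).toNat = 2 * (lin h g.lastY).toNat + 2 by omega, hl]
    have : ((lin h g.lastY).toNat : ℤ) = lin h g.lastY := by omega
    rw [this]
    simp only [last, beq_eq_false_iff_ne.2 hp, cond_false]
    cases g.up <;> simp [lin_add, lin_sub]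

theorem expand_eq_cons {h₀ h : ℤ} (hh : h₀ ≤ h) {g : Seg} (hg : g.ok h₀ = true) :
    ∃ l, g.expand h = (g.X, lin h g.a) :: l := by
  obtain ⟨hn, -⟩ := ok_spec hh hg
  obtain ⟨m, hm⟩ : ∃ m, (lin h g.n).toNat = m + 1 := ⟨(lin h g.n).toNat - 1, by omega⟩
  exact ⟨_, by rw [expand, hm, zig]⟩

end Seg

/-- The differences between consecutive points in a sequence of segments. -/
def edges : List Seg → List (ℕ × ℕ × (ℤ × ℤ) × (ℤ × ℤ))
  | [] => []
  | g :: l => g.inner :: match l with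
    | [] => []
    | g' :: _ => (g.last.1, g'.X, g'.a - g.last.2, g'.a - g.last.2) :: edges l

theorem adj_of_mem_edges {h₀ h : ℤ} (hh : h₀ ≤ h) {S : List Seg} (hS : ∀ g ∈ S, g.ok h₀ = true)
    {E : ℕ × ℕ × (ℤ × ℤ) × (ℤ × ℤ)} (hE : E ∈ edges S) {d : ℤ} (h1 : lin h E.2.2.1 ≤ d)
    (h2 : d ≤ lin h E.2.2.2) :
    ∃ a, Adj (S.flatMap (Seg.expand h)) (E.1, a) (E.2.1, a + d) := by
  induction S with
  | nil => simp [edges] at hE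
  | cons g l ih =>
    rw [List.flatMap_cons]
    have hin : E = g.inner → ∃ a, Adj (g.expand h ++ l.flatMap (Seg.expand h)) (E.1, a)
        (E.2.1, a + d) := by
      rintro rfl
      obtain ⟨a, ha⟩ := Seg.adj_expand_of_inner h1 h2
      exact ⟨a, ha.mono (List.prefix_append _ _).isInfix⟩
    rcases l with _ | ⟨g', l⟩
    · simp only [edges, List.mem_cons, List.not_mem_nil, or_false] at hE
      exact hin hE
    · rw [edges, List.mem_cons, List.mem_cons] at hE
      rcases hE with hE | rfl | hE
      · exact hin hE
      · obtain ⟨l₁, h₁⟩ := Seg.expand_eq_append hh (hS g List.mem_cons_self)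
        obtain ⟨l₂, h₂⟩ := Seg.expand_eq_cons hh
          (hS g' (List.mem_cons_of_mem _ List.mem_cons_self))
        refine ⟨lin h g.last.2, .inl ⟨l₁, l₂ ++ l.flatMap (Seg.expand h), ?_⟩⟩
        rw [List.flatMap_cons, h₁, h₂]
        simp only [lin_sub] at h1 h2
        have : lin h g.last.2 + d = lin h g'.a := by omega
        simp [this]
      · obtain ⟨a, ha⟩ := ih (fun g hg => hS g (List.mem_cons_of_mem _ hg)) hE
        exact ⟨a, ha.mono (List.suffix_append _ _).isInfix⟩

/-- The differences between consecutive points of the cycle formed by some segments. -/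
def cycleEdges : List Seg → List (ℕ × ℕ × (ℤ × ℤ) × (ℤ × ℤ))
  | [] => []
  | g :: l => edges (g :: l ++ [{ g with n := (0, 1) }])

/-- The cycle formed by some segments, with second components reduced modulo `N`. -/
def toCycle (h : ℤ) (N : ℕ) (S : List Seg) : List (ℕ × ZMod N) :=
  (S.flatMap (Seg.expand h)).map fun p => (p.1, (p.2 : ZMod N))

theorem covers_of_mem_cycleEdges {h₀ h : ℤ} (hh : h₀ ≤ h) {N : ℕ} {S : List Seg}
    (hS : ∀ g ∈ S, g.ok h₀ = true) {E : ℕ × ℕ × (ℤ × ℤ) × (ℤ × ℤ)} (hE : E ∈ cycleEdges S)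
    {d : ℤ} (h1 : lin h E.2.2.1 ≤ d) (h2 : d ≤ lin h E.2.2.2) :
    ∃ a : ZMod N, Covers {toCycle h N S} (E.1, a) (E.2.1, a + d) := by
  rcases S with _ | ⟨g, l⟩
  · simp [cycleEdges] at hE
  · obtain ⟨m, hm⟩ := Seg.expand_eq_cons hh (hS g List.mem_cons_self)
    obtain ⟨a, ha⟩ := adj_of_mem_edges (S := g :: l ++ [{ g with n := (0, 1) }]) hh
      (fun g' hg' => by
        rw [List.mem_append, List.mem_singleton] at hg'
        rcases hg' with hg' | rfl
        · exact hS g' hg'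
        · simp [Seg.ok, linLE]) hE h1 h2
    refine ⟨a, _, rfl, ?_⟩
    have := ha.map fun p => (p.1, (p.2 : ZMod N))
    rw [List.flatMap_append, List.map_append] at this
    simp only [Int.cast_add] at this
    have h3 : (toCycle h N (g :: l)).take 1 =
        ([{ g with n := (0, 1) }].flatMap (Seg.expand h)).map fun p => (p.1, (p.2 : ZMod N)) := by
      rw [toCycle, List.flatMap_cons, hm]
      simp [Seg.expand, lin_const, zig]
    rw [← h3] at this
    exact this

theorem length_toCycle {h₀ h : ℤ} (hh : h₀ ≤ h) {N : ℕ} {S : List Seg}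
    (hS : ∀ g ∈ S, g.ok h₀ = true) :
    ((toCycle h N S).length : ℤ) = lin h (S.map Seg.n).sum := by
  rw [toCycle, List.length_map]
  induction S with
  | nil => simp [lin]
  | cons g S ih =>
    have h1 := (Seg.ok_spec hh (hS g List.mem_cons_self)).1
    rw [List.flatMap_cons, List.length_append, List.map_cons, List.sum_cons, lin_add, ← ih
      fun g hg => hS g (List.mem_cons_of_mem _ hg), Seg.expand, length_zig]
    push_cast
    omega

/-- A check that some cycles have length `M` and, together with the points in `hole`, visit all
points on the levels in `lv`. -/
def classCheck (h₀ : ℤ) (M : ℤ × ℤ) (lv : List ℕ) (hole : List (ℕ × (ℤ × ℤ)))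
    (C : List (List Seg)) : Bool :=
  (C.all fun S => S.all (Seg.ok h₀) && (S.map Seg.n).sum == M) &&
    lv.all fun l => covered h₀ M ((hole.filter (·.1 == l)).map (fun p => (p.2, p.2)) ++
      ((C.flatten.flatMap Seg.verts).filter (·.1 == l)).map (·.2))

section classCheck

variable {h₀ h : ℤ} {M : ℤ × ℤ} {N : ℕ} {lv : List ℕ} {hole : List (ℕ × (ℤ × ℤ))}
  {C : List (List Seg)}

theorem ok_of_classCheck (hC : classCheck h₀ M lv hole C = true) :
    ∀ S ∈ C, ∀ g ∈ S, g.ok h₀ = true := by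
  simp only [classCheck, Bool.and_eq_true, List.all_eq_true] at hC
  exact fun S hS => (hC.1 S hS).1

theorem length_of_classCheck (hh : h₀ ≤ h) (hN : (N : ℤ) = lin h M)
    (hC : classCheck h₀ M lv hole C = true) : ∀ S ∈ C, (toCycle h N S).length = N := by
  intro S hS
  have h1 := length_toCycle (N := N) hh (ok_of_classCheck hC S hS)
  simp only [classCheck, Bool.and_eq_true, List.all_eq_true, beq_iff_eq] at hC
  rw [(hC.1 S hS).2, ← hN] at h1
  exact_mod_cast h1

theorem mem_of_classCheck [NeZero N] (hh : h₀ ≤ h) (hN : (N : ℤ) = lin h M)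
    (hC : classCheck h₀ M lv hole C = true) {l : ℕ} (hl : l ∈ lv) (x : ZMod N) :
    (∃ p ∈ hole, p.1 = l ∧ (lin h p.2 : ZMod N) = x) ∨ ∃ S ∈ C, (l, x) ∈ toCycle h N S := by
  have hok := ok_of_classCheck hC
  simp only [classCheck, Bool.and_eq_true, List.all_eq_true] at hC
  obtain ⟨y, ⟨J, hJ, h1, h2⟩, rfl⟩ := covered_spec hh hN (hC.2 l hl) x
  rcases List.mem_append.1 hJ with hJ | hJ
  · obtain ⟨p, hp, rfl⟩ := List.mem_map.1 hJ
    rw [List.mem_filter, beq_iff_eq] at hp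
    exact .inl ⟨p, hp.1, hp.2, by rw [le_antisymm h1 h2]⟩
  · obtain ⟨I, hI, rfl⟩ := List.mem_map.1 hJ
    rw [List.mem_filter, beq_iff_eq] at hI
    obtain ⟨hI, rfl⟩ := hI
    obtain ⟨g, hg, hI⟩ := List.mem_flatMap.1 hI
    obtain ⟨S, hS, hg⟩ := List.mem_flatten.1 hg
    exact .inr ⟨S, hS, List.mem_map.2 ⟨(I.1, y), List.mem_flatMap.2
      ⟨g, hg, Seg.mem_expand_of_mem_verts hh (hok S hS g hg) hI h1 h2⟩, rfl⟩⟩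

/-- The image of a list of cycles. -/
def imageCycles {V : Type} (h : ℤ) (N : ℕ) (C : List (List Seg)) (f : ℕ × ZMod N → V) :
    Set (List V) := {L | L ∈ C.map fun S => (toCycle h N S).map f}

theorem isFactor_of_classCheck (hh : h₀ ≤ h) (hN : (N : ℤ) = lin h M)
    (hC : classCheck h₀ M lv hole C = true) {V : Type} {f : ℕ × ZMod N → V} {S : Finset V}
    (hcard : C.length * N ≤ S.card)
    (hcov : ∀ v ∈ S, ∃ s ∈ C, ∃ p ∈ toCycle h N s, f p = v) :
    IsFactor (· = N) (imageCycles h N C f) (S : Set V) := by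
  have hlen := length_of_classCheck hh hN hC
  refine IsFactor.of_card ?_ ?_ fun v hv => ?_
  · intro L hL
    obtain ⟨s, hs, rfl⟩ := List.mem_map.1 hL
    rw [List.length_map]
    exact hlen s hs
  · rw [List.length_flatten, List.map_map, List.map_congr_left (g := fun _ => N)
      fun s hs => by simp [hlen s hs]]
    simpa using hcard
  · obtain ⟨s, hs, p, hp, rfl⟩ := hcov v hv
    exact List.mem_flatten.2 ⟨_, List.mem_map_of_mem hs, List.mem_map_of_mem hp⟩

theorem Covers.imageCycles {S : List Seg} (hS : S ∈ C) {p q : ℕ × ZMod N}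
    (h' : Covers {toCycle h N S} p q) {V : Type} (f : ℕ × ZMod N → V) :
    Covers (imageCycles h N C f) (f p) (f q) := by
  refine (h'.image f).mono ?_
  rw [Set.image_singleton, Set.singleton_subset_iff]
  exact List.mem_map.2 ⟨S, hS, rfl⟩

end classCheck

/-- Level `X` belongs to block `L`, level `Y` belongs to block `K`, and their positions in blocks
of size `q` differ by `δ`. -/
def isKey (q L K δ X Y : ℕ) : Bool :=
  X / q == L && Y / q == K && (Y % q + q - X % q) % q == δ

/-- The differences between consecutive points for which the levels satisfy `isKey`. -/
def keyDiffs (q L K δ : ℕ) (S : List Seg) : List ((ℤ × ℤ) × (ℤ × ℤ)) :=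
  (cycleEdges S).flatMap fun E =>
    (bif isKey q L K δ E.1 E.2.1 then [E.2.2] else []) ++
      bif isKey q L K δ E.2.1 E.1 then [(-E.2.2.2, -E.2.2.1)] else []

theorem covers_of_keyDiffs {h₀ h : ℤ} (hh : h₀ ≤ h) {M : ℤ × ℤ} {N : ℕ} [NeZero N]
    (hN : (N : ℤ) = lin h M) {q L K δ : ℕ} {ex : List ((ℤ × ℤ) × (ℤ × ℤ))}
    {R : List (List Seg)} (hR : ∀ S ∈ R, ∀ g ∈ S, g.ok h₀ = true)
    (hc : covered h₀ M (ex ++ R.flatMap (keyDiffs q L K δ)) = true) (d : ZMod N) :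
    (∃ x : ℤ, InSome h ex x ∧ (x : ZMod N) = d) ∨
      ∃ S ∈ R, ∃ X Y a, isKey q L K δ X Y = true ∧ Covers {toCycle h N S} (X, a) (Y, a + d) := by
  obtain ⟨x, ⟨J, hJ, h1, h2⟩, rfl⟩ := covered_spec hh hN hc d
  rcases List.mem_append.1 hJ with hJ | hJ
  · exact .inl ⟨x, ⟨J, hJ, h1, h2⟩, rfl⟩
  · obtain ⟨S, hS, hJ⟩ := List.mem_flatMap.1 hJ
    obtain ⟨E, hE, hJ⟩ := List.mem_flatMap.1 hJ
    refine .inr ⟨S, hS, ?_⟩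
    rcases List.mem_append.1 hJ with hJ | hJ
    · cases hk : isKey q L K δ E.1 E.2.1 with
      | false => simp [hk] at hJ
      | true =>
        simp only [hk, cond_true, List.mem_singleton] at hJ
        subst hJ
        obtain ⟨a, ha⟩ := covers_of_mem_cycleEdges (N := N) hh (hR S hS) hE h1 h2
        exact ⟨_, _, a, hk, ha⟩
    · cases hk : isKey q L K δ E.2.1 E.1 with
      | false => simp [hk] at hJ
      | true =>
        simp only [hk, cond_true, List.mem_singleton] at hJ
        subst hJ
        rw [lin_neg] at h1 h2
        obtain ⟨a, ha⟩ := covers_of_mem_cycleEdges (N := N) hh (hR S hS) hE (d := -x)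
          (by omega) (by omega)
        refine ⟨_, _, a + ((-x : ℤ) : ZMod N), hk, ?_⟩
        convert ha.symm using 2
        push_cast
        ring

theorem isKey_spec {q L K X Y : ℕ} [NeZero q] {i j : ZMod q}
    (hk : isKey q L K (j - i).val X Y = true) :
    X / q = L ∧ Y / q = K ∧ (Y : ZMod q) + (i - (X : ZMod q)) = j := by
  simp only [isKey, Bool.and_eq_true, beq_iff_eq] at hk
  obtain ⟨⟨h1, h2⟩, h3⟩ := hk
  refine ⟨h1, h2, ?_⟩
  have h4 := congrArg (Nat.cast : ℕ → ZMod q) h3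
  have h5 : X % q ≤ Y % q + q := (Nat.mod_lt X (NeZero.pos q)).le.trans (Nat.le_add_left _ _)
  simp only [ZMod.natCast_mod, ZMod.natCast_zmod_val, Nat.cast_sub h5, Nat.cast_add,
    CharP.cast_eq_zero, add_zero] at h4
  linear_combination h4

/-! ### Gadgets -/

/-- A check that the translates of a base class form a gadget. -/
def checkSymGadget (h₀ : ℤ) (M : ℤ × ℤ) (m : ℕ) (C : List (List Seg)) : Bool :=
  C.length == m && classCheck h₀ M (List.range m) [] C &&
    (List.range m).all fun i => covered h₀ M ([] ++ C.flatMap (keyDiffs 1 i ((i + 1) % m) 0))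

theorem gadget_of_checkSym {h₀ h : ℤ} (hh : h₀ ≤ h) {M : ℤ × ℤ} {k m : ℕ} (hk : 0 < k)
    (hkM : (k : ℤ) = lin h M) {C : List (List Seg)} (hC : checkSymGadget h₀ M m C = true) :
    Gadget m k := by
  rcases Nat.eq_zero_or_pos m with rfl | hm
  · exact ⟨fun _ => ∅, fun _ => ⟨by simp, by simp, by simp, fun x => x.1.elim0⟩,
      fun i hi => absurd hi (Nat.not_lt_zero i)⟩
  have : NeZero k := ⟨hk.ne'⟩
  have : NeZero m := ⟨hm.ne'⟩
  simp only [checkSymGadget, Bool.and_eq_true, beq_iff_eq, List.all_eq_true, List.mem_range] at hC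
  obtain ⟨⟨hlen, hC⟩, hp⟩ := hC
  let f : ZMod k → ℕ × ZMod k → Fin m × ZMod k := fun z p => (Fin.ofNat m p.1, p.2 + z)
  refine ⟨fun c => imageCycles h k C (f (c.val : ℕ)), fun c => ?_, fun i hi x y => ?_⟩
  · rw [← Finset.coe_univ]
    refine isFactor_of_classCheck hh hkM hC (by simp [hlen, ZMod.card]) fun v _ => ?_
    rcases mem_of_classCheck hh hkM hC (List.mem_range.2 v.1.2) (v.2 - (c.val : ℕ)) with
      ⟨p, hp, -⟩ | ⟨s, hs, hv⟩
    · simp at hp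
    · exact ⟨s, hs, _, hv, by simp [f]⟩
  · rcases covers_of_keyDiffs hh hkM (ok_of_classCheck hC) (hp i hi) (y - x) with
      ⟨_, ⟨J, hJ, -⟩, -⟩ | ⟨s, hs, X, Y, a, hk, ha⟩
    · simp at hJ
    · simp only [isKey, Nat.div_one, Bool.and_eq_true, beq_iff_eq] at hk
      obtain ⟨⟨rfl, rfl⟩, -⟩ := hk
      refine ⟨⟨(x - a).val, ZMod.val_lt _⟩, ?_⟩
      have := ha.imageCycles hs (f (x - a))
      simp only [ZMod.natCast_zmod_val]
      convert this using 2
      · exact Fin.ext (Nat.mod_eq_of_lt hi).symm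
      · simp
      · exact Fin.ext (Nat.mod_mod _ _).symm
      · ring

/-! ### Frames with five groups -/

/-- A check that the translates of a base class form a frame with five groups; the group of
a level is its residue modulo five, and the base class avoids the first group. -/
def checkSymFrame (h₀ : ℤ) (M : ℤ × ℤ) (C : List (List Seg)) : Bool :=
  C.length == 8 && classCheck h₀ M ((List.range 10).filter fun l => l % 5 != 0) [] C &&
    (List.range 2).all fun L => (List.range 2).all fun K => (List.range 5).all fun δ =>
      δ == 0 || covered h₀ M ([] ++ C.flatMap (keyDiffs 5 L K δ))

theorem frame_of_checkSym {h₀ h : ℤ} (hh : h₀ ≤ h) {M : ℤ × ℤ} {k : ℕ} (hk : 0 < k)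
    (hkM : (k : ℤ) = lin h M) {C : List (List Seg)} (hC : checkSymFrame h₀ M C = true) :
    Frame k 5 := by
  have : NeZero k := ⟨hk.ne'⟩
  simp only [checkSymFrame, Bool.and_eq_true, beq_iff_eq, List.all_eq_true, List.mem_range,
    Bool.or_eq_true] at hC
  obtain ⟨⟨hlen, hC⟩, hp⟩ := hC
  let f : ZMod 5 → ZMod k → ℕ × ZMod k → ZMod 5 × Fin 2 × ZMod k := fun y z p =>
    ((p.1 : ZMod 5) + y, Fin.ofNat 2 (p.1 / 5), p.2 + z)
  show IsFrame k (ZMod 5)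
  refine ⟨fun y c => imageCycles h k C (f y (c.val : ℕ)), fun y c => ?_, ?_⟩
  · have := isFactor_of_classCheck (f := f y (c.val : ℕ))
      (S := (Finset.univ.filter (· ≠ y)) ×ˢ Finset.univ) hh hkM hC ?_ ?_
    · convert this using 1
      ext p
      simp
    · rw [Finset.card_product, Finset.filter_ne', Finset.card_erase_of_mem (Finset.mem_univ _)]
      simp [hlen, ZMod.card]
      omega
    · rintro ⟨i, L, x⟩ hv
      have hi : i - y ≠ 0 := by simpa [sub_eq_zero] using hv
      have hlt := (i - y).val_lt
      have hL := L.2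
      rcases mem_of_classCheck hh hkM hC (l := 5 * L.val + (i - y).val) (by
        rw [List.mem_filter, List.mem_range]
        have : (i - y).val ≠ 0 := by simpa using hi
        refine ⟨by omega, ?_⟩
        rw [bne_iff_ne]
        omega) (x - (c.val : ℕ)) with ⟨p, hp, -⟩ | ⟨s, hs, hv⟩
      · simp at hp
      · refine ⟨s, hs, _, hv, ?_⟩
        have h1 : (5 * L.val + (i - y).val) / 5 = L.val := by omega
        have h2 : ((5 * L.val + (i - y).val : ℕ) : ZMod 5) = i - y := by
          have : (5 : ZMod 5) = 0 := rfl
          push_cast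
          simp [this]
        simp [f, h1, h2]
  · rintro ⟨i, L, x⟩ ⟨j, K, x'⟩ hij
    have hδ : (j - i).val ≠ 0 := by
      simpa [sub_eq_zero] using Ne.symm hij
    rcases covers_of_keyDiffs hh hkM (ok_of_classCheck hC)
      ((hp L L.2 K K.2 (j - i).val (ZMod.val_lt _)).resolve_left hδ) (x' - x) with
      ⟨_, ⟨J, hJ, -⟩, -⟩ | ⟨s, hs, X, Y, a, hk, ha⟩
    · simp at hJ
    · refine ⟨i - (X : ZMod 5), ⟨(x - a).val, ZMod.val_lt _⟩, ?_⟩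
      have := ha.imageCycles hs (f (i - (X : ZMod 5)) (x - a))
      simp only [ZMod.natCast_zmod_val]
      obtain ⟨h1, h2, h3⟩ := isKey_spec (i := i) (j := j) hk
      have e1 : f (i - (X : ZMod 5)) (x - a) (X, a) = (i, L, x) := by simp [f, h1]
      have e2 : f (i - (X : ZMod 5)) (x - a) (Y, a + (x' - x)) = (j, K, x') := by
        simp only [f, h2, h3, Fin.ofNat_val_eq_self, Prod.mk.injEq, true_and]
        ring
      rwa [e1, e2] at this

/-! ### Almost resolvable systems -/

theorem follows_map_range {V : Type} {n : ℕ} {f : ℕ → V} (hf : f n = f 0) {j : ℕ} (hj : j < n) :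
    Follows ((List.range n).map f) (f j) (f (j + 1)) := by
  have h1 : (List.range n).map f ++ ((List.range n).map f).take 1 = (List.range (n + 1)).map f := by
    obtain ⟨m, rfl⟩ : ∃ m, n = m + 1 := ⟨n - 1, by omega⟩
    rw [List.range_succ (n := m + 1), List.map_append, List.range_succ_eq_map]
    simp [hf]
  rw [Follows, h1]
  have h2 : [j, j + 1] <:+: List.range (n + 1) := by
    refine ⟨List.range j, (List.range (n + 1 - (j + 2))).map (j + 2 + ·), ?_⟩
    have h3 : n + 1 = j + 2 + (n + 1 - (j + 2)) := by omega
    conv_rhs => rw [h3, List.range_add, List.range_succ, List.range_succ]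
    simp
  exact h2.map f

/-- The cycle joining all points at distance `d`. -/
def circle {V : Type} {k : ℕ} (p : ZMod k → V) (d : ZMod k) : List V :=
  (List.range k).map fun j : ℕ => p (j * d)

theorem isFactor_circle {V : Type} {k : ℕ} [NeZero k] {p : ZMod k → V} (hp : p.Injective)
    {d u : ZMod k} (hd : d * u = 1) : IsFactor (· = k) {circle p d} (Set.range p) := by
  have h1 : {circle p d} = {L | L ∈ [circle p d]} := by ext; simp
  rw [h1]
  refine IsFactor.of_nodup_flatten (by simp [circle]) ?_ fun x => ?_
  · simp only [List.flatten_cons, List.flatten_nil, List.append_nil, circle]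
    refine List.Nodup.map_on (fun a ha b hb hab => ?_) List.nodup_range
    have := congrArg (· * u) (hp hab)
    simp only [mul_assoc, hd, mul_one] at this
    have := congrArg ZMod.val this
    rwa [ZMod.val_natCast_of_lt (List.mem_range.1 ha),
      ZMod.val_natCast_of_lt (List.mem_range.1 hb)] at this
  · simp only [Set.mem_range, circle, List.flatten_cons, List.flatten_nil, List.append_nil,
      List.mem_map, List.mem_range]
    constructor
    · rintro ⟨y, rfl⟩
      refine ⟨(y * u).val, ZMod.val_lt _, ?_⟩
      rw [ZMod.natCast_zmod_val, mul_assoc, mul_comm u, hd, mul_one]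
    · rintro ⟨j, -, rfl⟩
      exact ⟨_, rfl⟩

theorem covers_circle {V : Type} {k : ℕ} [NeZero k] (p : ZMod k → V)
    {d u : ZMod k} (hd : d * u = 1) (x : ZMod k) : Covers {circle p d} (p x) (p (x + d)) := by
  refine ⟨_, rfl, .inl ?_⟩
  have h1 := follows_map_range (f := fun j : ℕ => p (j * d)) (n := k) (by simp)
    (j := (x * u).val) (ZMod.val_lt _)
  have h2 : ((x * u).val : ZMod k) * d = x := by
    rw [ZMod.natCast_zmod_val, mul_assoc, mul_comm u, hd, mul_one]
  have h3 : (((x * u).val + 1 : ℕ) : ZMod k) * d = x + d := by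
    push_cast
    rw [add_mul, h2, one_mul]
  simp only [h2, h3] at h1
  exact h1

/-- The differences within blocks that do not have to be covered by the almost parallel classes. -/
def exempt (r : ℕ) (d : ℤ × ℤ) (L K δ : ℕ) : List ((ℤ × ℤ) × (ℤ × ℤ)) :=
  bif L == K && δ == 0 then (0, 0) :: bif Nat.blt L r then [(d, d), (-d, -d)] else [] else []

/-- Some edge joins level `Z` to a level belonging to block `L`. -/
def hasEdge (h₀ : ℤ) (q Z L : ℕ) (S : List Seg) : Bool :=
  (cycleEdges S).any fun E => linLE h₀ E.2.2.1 E.2.2.2 &&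
    ((E.1 == Z && E.2.1 / q == L) || (E.2.1 == Z && E.1 / q == L))

theorem covers_of_hasEdge {h₀ h : ℤ} (hh : h₀ ≤ h) {N : ℕ} {q Z L : ℕ} {S : List Seg}
    (hS : ∀ g ∈ S, g.ok h₀ = true) (hE : hasEdge h₀ q Z L S = true) :
    ∃ (Y : ℕ) (a b : ZMod N), Y / q = L ∧ Covers {toCycle h N S} (Z, a) (Y, b) := by
  simp only [hasEdge, List.any_eq_true, Bool.and_eq_true, Bool.or_eq_true, beq_iff_eq] at hE
  obtain ⟨E, hE, hle, h1⟩ := hE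
  obtain ⟨a, ha⟩ := covers_of_mem_cycleEdges (N := N) hh hS hE le_rfl (linLE_spec hh hle)
  rcases h1 with ⟨rfl, h1⟩ | ⟨rfl, h1⟩
  · exact ⟨_, _, _, h1, ha⟩
  · exact ⟨_, _, _, h1, ha.symm⟩

/-- A check that the translates of `r` base classes are the almost parallel classes of a system,
the half-parallel class of which consists of the differences `d` on half of the levels.
There are `2 * r` blocks of `q` levels, and the extra point has its own level. -/
def checkSymExists (h₀ : ℤ) (M : ℤ × ℤ) (r q : ℕ) (d : ℤ × ℤ)
    (R : List ((ℕ × (ℤ × ℤ)) × List (List Seg))) : Bool :=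
  R.length == r && (R.all fun C => C.2.length == 2 * r * q &&
      classCheck h₀ M (List.range (2 * r * q)) [C.1] C.2 &&
      C.2.any fun S => S.any fun g => g.X == 2 * r * q) &&
    ((List.range (2 * r)).all fun L => (List.range (2 * r)).all fun K => (List.range q).all fun δ =>
      covered h₀ M (exempt r d L K δ ++ (R.flatMap (·.2)).flatMap (keyDiffs q L K δ))) &&
    (List.range (2 * r)).all fun L => (R.flatMap (·.2)).any (hasEdge h₀ q (2 * r * q) L)

theorem exists_of_checkSym {h₀ h : ℤ} (hh : h₀ ≤ h) {M : ℤ × ℤ} {k r q : ℕ} (hk : 0 < k)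
    (hr : 0 < r) (hq : 0 < q) (hkM : (k : ℤ) = lin h M) {d : ℤ × ℤ} {u : ZMod k}
    (hd : (lin h d : ZMod k) * u = 1) {R : List ((ℕ × (ℤ × ℤ)) × List (List Seg))}
    (hR : checkSymExists h₀ M r q d R = true) : Exists k (r * q) := by
  have : NeZero k := ⟨hk.ne'⟩
  have : NeZero q := ⟨hq.ne'⟩
  have : NeZero (2 * r) := ⟨by omega⟩
  simp only [checkSymExists, Bool.and_eq_true, beq_iff_eq, List.all_eq_true, List.mem_range,
    List.any_eq_true] at hR
  obtain ⟨⟨⟨rfl, hC⟩, hp⟩, hinf⟩ := hR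
  have hok : ∀ S ∈ R.flatMap (·.2), ∀ g ∈ S, g.ok h₀ = true := fun S hS => by
    obtain ⟨C, hCR, hS⟩ := List.mem_flatMap.1 hS
    exact ok_of_classCheck (hC C hCR).1.2 S hS
  let V := Option (Fin (2 * R.length) × ZMod q × ZMod k)
  let f : ZMod q → ZMod k → ℕ × ZMod k → V := fun y z p =>
    if p.1 = 2 * R.length * q then none else some (Fin.ofNat (2 * R.length) (p.1 / q), p.1 + y, p.2 + z)
  let P : Fin R.length × ZMod q → ZMod k → V := fun i x => some (⟨i.1, by omega⟩, i.2, x)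
  have hV : Nat.card V = 2 * k * (R.length * q) + 1 := by
    simp [V, Nat.card_eq_fintype_card, ZMod.card]
    ring
  have hPinj : Function.Injective fun p : (Fin R.length × ZMod q) × ZMod k => P p.1 p.2 := by
    rintro ⟨⟨L, i⟩, x⟩ ⟨⟨K, j⟩, y⟩ h
    simpa [Fin.ext_iff, and_assoc] using Option.some.inj h
  refine ⟨V, Fin R.length × ZMod q × ZMod k, inferInstance, inferInstance, ⋃ i, Set.range (P i), hV,
    ?_, ?_, fun c => imageCycles h k R[c.1].2 (f c.2.1 c.2.2),
    ⋃ i, {circle (P i) (lin h d : ZMod k)}, fun c => ?_,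
    IsFactor.iUnion (fun i => isFactor_circle (fun x y h => ?_) hd) ?_, ?_⟩
  · simp [Nat.card_eq_fintype_card, ZMod.card]
    ring
  · have : ⋃ i, Set.range (P i) = Set.range fun p : (Fin R.length × ZMod q) × ZMod k => P p.1 p.2 := by
      ext v
      simp
    rw [this, ← Set.image_univ, Set.ncard_image_of_injective _ hPinj, Set.ncard_univ]
    simp [Nat.card_eq_fintype_card, ZMod.card]
    ring
  · obtain ⟨⟨hCl, hCc⟩, S₀, hS₀, g, hg, hgX⟩ := hC R[c.1] (List.getElem_mem c.1.2)
    classical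
    set C := R[c.1]
    refine ⟨f c.2.1 c.2.2 (C.1.1, (lin h C.1.2 : ZMod k)), ?_⟩
    have := isFactor_of_classCheck (f := f c.2.1 c.2.2)
      (S := Finset.univ.erase (f c.2.1 c.2.2 (C.1.1, (lin h C.1.2 : ZMod k)))) hh hkM hCc ?_ ?_
    · convert this using 1
      ext p
      simp
    · rw [Finset.card_erase_of_mem (Finset.mem_univ _), Finset.card_univ,
        ← Nat.card_eq_fintype_card, hV, hCl]
      apply le_of_eq
      rw [Nat.add_sub_cancel]
      ring
    · rintro (_ | ⟨L, i, x⟩) hv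
      · obtain ⟨l, hl⟩ := Seg.expand_eq_cons hh (ok_of_classCheck hCc S₀ hS₀ g hg)
        refine ⟨S₀, hS₀, (g.X, (lin h g.a : ZMod k)), List.mem_map.2
          ⟨(g.X, lin h g.a), List.mem_flatMap.2 ⟨g, hg, by rw [hl]; exact List.mem_cons_self⟩,
            rfl⟩, ?_⟩
        simp [f, hgX]
      · have hlt := (i - c.2.1).val_lt
        have h1 : q * L.val + (i - c.2.1).val < 2 * R.length * q := by
          calc _ < q * L.val + q := by omega
            _ = (L.val + 1) * q := by ring
            _ ≤ _ := Nat.mul_le_mul_right _ L.2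
        have h2 : (q * L.val + (i - c.2.1).val) / q = L.val := by
          rw [Nat.mul_add_div hq, Nat.div_eq_of_lt hlt, add_zero]
        have h3 : f c.2.1 c.2.2 (q * L.val + (i - c.2.1).val, x - c.2.2) = some (L, i, x) := by
          simp only [f, h2, h1.ne, if_false]
          simp
        rcases mem_of_classCheck hh hkM hCc (List.mem_range.2 h1) (x - c.2.2) with
          ⟨p, hp, h4, h5⟩ | ⟨s, hs, hv⟩
        · rw [List.mem_singleton] at hp
          subst hp
          rw [← h3, ← h4, ← h5] at hv
          simp at hv
        · exact ⟨s, hs, _, hv, h3⟩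
  · exact (Prod.mk.inj (@hPinj (i, x) (i, y) h)).2
  · rintro i j _ ⟨x, rfl⟩ ⟨y, h⟩
    exact (Prod.mk.inj (@hPinj (j, y) (i, x) h)).1.symm
  · have hcov : ∀ S ∈ R.flatMap (·.2), ∀ p p' : ℕ × ZMod k, Covers {toCycle h k S} p p' →
        ∀ y z, ∃ c : Fin R.length × ZMod q × ZMod k, Covers (imageCycles h k
          R[c.1].2 (f c.2.1 c.2.2)) (f y z p) (f y z p') := by
      intro S hS p p' hp y z
      obtain ⟨C, hCR, hS⟩ := List.mem_flatMap.1 hS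
      obtain ⟨j, hj, rfl⟩ := List.getElem_of_mem hCR
      exact ⟨(⟨j, hj⟩, y, z), hp.imageCycles hS (f y z)⟩
    have hfin : ∀ (L : Fin (2 * R.length)) (X : ℕ) (y : ZMod q) (z a : ZMod k), X / q = L →
        f y z (X, a) = some (L, X + y, a + z) := by
      intro L X y z a hX
      have h1 : X ≠ 2 * R.length * q := by
        rintro rfl
        rw [Nat.mul_div_cancel _ hq] at hX
        exact L.2.ne' hX
      simp only [f, h1, if_false, hX, Fin.ofNat_val_eq_self]
    have hnone : ∀ (y : ZMod q) (z a : ZMod k), f y z (2 * R.length * q, a) = none := fun y z a => by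
      simp [f]
    have hinf' : ∀ (L : Fin (2 * R.length)) (i : ZMod q) (x : ZMod k), ∃ c : Fin R.length × ZMod q × ZMod k,
        Covers (imageCycles h k R[c.1].2 (f c.2.1 c.2.2)) none
          (some (L, i, x)) := by
      intro L i x
      obtain ⟨S, hS, hE⟩ := hinf L L.2
      obtain ⟨Y, a, b, hY, ha⟩ := covers_of_hasEdge (N := k) hh (hok S hS) hE
      obtain ⟨c, hc⟩ := hcov S hS _ _ ha (i - (Y : ZMod q)) (x - b)
      rw [hnone, hfin L Y _ _ _ hY, add_sub_cancel, add_sub_cancel] at hc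
      exact ⟨c, hc⟩
    have hhalf : ∀ (L : Fin (2 * R.length)) (i : ZMod q) (x : ZMod k), L.val < R.length →
        Covers (⋃ i, {circle (P i) (lin h d : ZMod k)}) (some (L, i, x))
          (some (L, i, x + lin h d)) := fun L i x hL =>
      (covers_circle (P (⟨L, hL⟩, i)) hd x).mono
        (Set.subset_iUnion (fun i => {circle (P i) (lin h d : ZMod k)}) (⟨L, hL⟩, i))
    rintro (_ | ⟨L, i, x⟩) (_ | ⟨K, j, x'⟩) hne
    · exact absurd rfl hne
    · exact .inl (hinf' K j x')
    · obtain ⟨c, hc⟩ := hinf' L i x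
      exact .inl ⟨c, hc.symm⟩
    · rcases covers_of_keyDiffs hh hkM hok (hp L L.2 K K.2 (j - i).val (ZMod.val_lt _))
        (x' - x) with ⟨w, ⟨J, hJ, h1, h2⟩, hw⟩ | ⟨S, hS, X, Y, a, hk, ha⟩
      · rw [exempt] at hJ
        cases hLK : L.val == K.val && (j - i).val == 0 with
        | false => simp [hLK] at hJ
        | true =>
          simp only [Bool.and_eq_true, beq_iff_eq, ZMod.val_eq_zero, sub_eq_zero] at hLK
          obtain ⟨hLK, rfl⟩ := hLK
          obtain rfl := Fin.ext hLK
          simp only [beq_self_eq_true, sub_self, ZMod.val_zero, Bool.and_self, cond_true,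
            List.mem_cons] at hJ
          rcases hJ with rfl | hJ
          · have : w = 0 := by simpa [lin] using le_antisymm h2 h1
            rw [this, Int.cast_zero] at hw
            rw [sub_eq_zero.1 hw.symm] at hne
            exact absurd rfl hne
          · cases hL : Nat.blt L R.length with
            | false => simp [hL] at hJ
            | true =>
              simp only [hL, cond_true, List.mem_cons, List.not_mem_nil, or_false] at hJ
              rw [Nat.blt_eq] at hL
              right
              rcases hJ with rfl | rfl
              · obtain rfl := le_antisymm h2 h1
                convert hhalf L j x hL using 4
                rw [hw]
                ring
              · obtain rfl := le_antisymm h2 h1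
                refine Covers.symm ?_
                convert hhalf L j x' hL using 4
                rw [lin_neg, Int.cast_neg] at hw
                linear_combination hw
      · obtain ⟨h1, h2, h3⟩ := isKey_spec hk
        obtain ⟨c, hc⟩ := hcov S hS _ _ ha (i - (X : ZMod q)) (x - a)
        rw [hfin L X _ _ _ h1, hfin K Y _ _ _ h2, h3] at hc
        rw [add_sub_cancel, add_sub_cancel, show a + (x' - x) + (x - a) = x' by ring] at hc
        exact .inl ⟨c, hc⟩

/-! ### Data for all odd cycle lengths -/

theorem exists_one_of_four_mul_add_one {h k : ℕ} (hh : 2 ≤ h) (hk : k = 4 * h + 1) :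
    Exists k 1 :=
  exists_of_checkSym (r := 1) (q := 1) (h₀ := 2) (h := h) (M := (4, 1)) (by omega) (by omega) (by decide) (by decide)
    (by simp only [hk, lin]; push_cast; ring) (d := (0, 1)) (u := 1)
    (by simp [lin])
    (R := [
      ((0, (1, 0)), [
        [.pt 0 0 0, .pt 1 2 (-1), .pt 0 2 0, ⟨0, (4, 0), 1, (2, 1), false, (2, -1)⟩,
         ⟨0, (1, -1), 0, (1, 1), false, (2, -2)⟩, .pt 1 2 0],
        [⟨0, (2, 1), 1, (4, -1), true, (2, -2)⟩, .pt 1 1 (-1), .pt 1 3 0, .pt 0 3 0,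
         ⟨1, (1, 0), 1, (1, -2), true, (2, -2)⟩, .pt 1 4 0, .pt 2 0 0]])])
    (by decide +kernel)

theorem exists_one_of_four_mul_add_three {h k : ℕ} (hh : 1 ≤ h) (hk : k = 4 * h + 3) :
    Exists k 1 :=
  exists_of_checkSym (r := 1) (q := 1) (h₀ := 1) (h := h) (M := (4, 3)) (by omega) (by omega) (by decide) (by decide)
    (by simp only [hk, lin]; push_cast; ring) (d := (0, 1)) (u := 1)
    (by simp [lin])
    (R := [
      ((0, (1, 0)), [
        [.pt 1 4 2, .pt 2 0 0, .pt 0 2 1, ⟨1, (2, 1), 0, (4, 2), true, (2, 0)⟩,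
         ⟨0, (1, 1), 0, (1, -1), true, (2, 0)⟩],
        [⟨1, (2, 0), 1, (0, 0), false, (2, 0)⟩, .pt 0 3 2, .pt 1 1 0, .pt 1 3 1,
         ⟨1, (3, 2), 0, (3, 1), true, (2, 0)⟩]])])
    (by decide +kernel)

theorem exists_two_of_four_mul_add_one {h k : ℕ} (hh : 3 ≤ h) (hk : k = 4 * h + 1) :
    Exists k 2 :=
  exists_of_checkSym (r := 2) (q := 1) (h₀ := 3) (h := h) (M := (4, 1)) (by omega) (by omega) (by decide) (by decide)
    (by simp only [hk, lin]; push_cast; ring) (d := (2, 0)) (u := -2)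
    (by
      have h1 : ((4 * h + 1 : ℕ) : ZMod k) = 0 := by rw [← hk, ZMod.natCast_self]
      push_cast at h1
      simp only [lin]
      push_cast
      linear_combination -h1)
    (R := [
      ((0, (4, 0)), [
        [.pt 3 4 0, ⟨3, (2, 0), 3, (0, 1), false, (2, 0)⟩, .pt 4 0 0,
         ⟨2, (1, -2), 2, (1, -3), true, (2, -1)⟩],
        [.pt 2 2 (-2), .pt 0 4 (-1), ⟨1, (4, -1), 0, (0, 1), false, (4, -1)⟩],
        [.pt 2 2 (-1), ⟨2, (4, -1), 0, (2, 0), false, (4, -1)⟩, .pt 1 2 (-1)],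
        [.pt 3 0 0, .pt 1 4 0, .pt 0 0 0, ⟨3, (2, 1), 1, (2, -2), true, (4, -2)⟩]]),
      ((1, (4, 0)), [
        [.pt 2 0 0, .pt 0 2 (-1), .pt 2 4 0, .pt 3 2 0, ⟨2, (0, 1), 1, (4, -2), true, (4, -4)⟩,
         .pt 1 4 (-1)],
        [.pt 2 2 (-1), .pt 1 2 0, ⟨3, (2, -1), 0, (0, 0), false, (4, -1)⟩],
        [.pt 2 2 0, ⟨2, (4, -1), 3, (2, 2), false, (4, -3)⟩, .pt 1 2 (-2), .pt 0 2 0, .pt 3 4 0],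
        [.pt 3 2 1, .pt 1 2 (-1), ⟨1, (0, 0), 1, (2, -3), true, (2, -2)⟩, .pt 4 0 0,
         ⟨0, (3, 0), 0, (3, 1), false, (2, 0)⟩]])])
    (by decide +kernel)

theorem exists_two_of_four_mul_add_three {h k : ℕ} (hh : 2 ≤ h) (hk : k = 4 * h + 3) :
    Exists k 2 :=
  exists_of_checkSym (r := 2) (q := 1) (h₀ := 2) (h := h) (M := (4, 3)) (by omega) (by omega) (by decide) (by decide)
    (by simp only [hk, lin]; push_cast; ring) (d := (2, 1)) (u := -2)
    (by
      have h1 : ((4 * h + 3 : ℕ) : ZMod k) = 0 := by rw [← hk, ZMod.natCast_self]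
      push_cast at h1
      simp only [lin]
      push_cast
      linear_combination -h1)
    (R := [
      ((0, (4, 2)), [
        [.pt 3 4 2, ⟨3, (2, 1), 3, (0, 1), false, (2, 1)⟩, .pt 4 0 0,
         ⟨2, (1, -2), 2, (1, -1), false, (2, 0)⟩],
        [.pt 2 2 (-1), .pt 0 4 1, ⟨1, (4, 1), 0, (0, 1), false, (4, 1)⟩],
        [.pt 2 2 0, ⟨2, (4, 1), 0, (2, 1), false, (4, 1)⟩, .pt 1 2 0],
        [.pt 3 0 0, .pt 1 4 2, .pt 0 0 0, ⟨3, (2, 2), 1, (2, -1), true, (4, 0)⟩]]),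
      ((1, (4, 2)), [
        [.pt 2 0 0, .pt 0 2 0, .pt 2 4 2, .pt 3 2 1, ⟨2, (0, 1), 1, (4, 0), true, (4, -2)⟩,
         .pt 1 4 1],
        [.pt 2 2 0, .pt 1 2 1, ⟨3, (2, 0), 0, (0, 0), false, (4, 1)⟩],
        [.pt 2 2 1, ⟨2, (4, 1), 3, (2, 3), false, (4, -1)⟩, .pt 1 2 (-1), .pt 0 2 1, .pt 3 4 2],
        [.pt 3 2 2, .pt 1 2 0, ⟨1, (0, 0), 1, (2, -2), true, (2, -1)⟩, .pt 4 0 0,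
         ⟨0, (3, 2), 0, (3, 1), true, (2, 1)⟩]])])
    (by decide +kernel)

theorem exists_three_of_four_mul_add_one {h k : ℕ} (hh : 2 ≤ h) (hk : k = 4 * h + 1) :
    Exists k 3 :=
  exists_of_checkSym (r := 1) (q := 3) (h₀ := 2) (h := h) (M := (4, 1)) (by omega) (by omega) (by decide) (by decide)
    (by simp only [hk, lin]; push_cast; ring) (d := (2, 0)) (u := -2)
    (by
      have h1 : ((4 * h + 1 : ℕ) : ZMod k) = 0 := by rw [← hk, ZMod.natCast_self]
      push_cast at h1
      simp only [lin]
      push_cast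
      linear_combination -h1)
    (R := [
      ((1, (4, 0)), [
        [.pt 0 0 0, .pt 2 0 0, .pt 0 4 (-2), ⟨0, (2, 0), 3, (2, -3), true, (4, -4)⟩, .pt 0 4 (-1),
         .pt 5 0 1],
        [.pt 0 0 1, .pt 3 4 0, .pt 0 4 0, ⟨2, (0, 1), 4, (4, -1), true, (4, -4)⟩, .pt 4 4 0,
         .pt 4 2 1],
        [.pt 1 0 0, .pt 2 4 0, ⟨1, (4, -1), 0, (0, 2), false, (4, -3)⟩, .pt 4 2 0, .pt 5 2 1],
        [.pt 1 2 0, .pt 3 2 (-2), .pt 1 2 (-1), .pt 3 2 (-1),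
         ⟨5, (2, -1), 5, (0, 2), false, (2, -2)⟩, .pt 6 0 0, ⟨1, (1, 0), 1, (1, -1), true, (2, -2)⟩],
        [.pt 2 2 (-1), .pt 5 2 0, ⟨5, (0, 0), 4, (0, 1), false, (4, -1)⟩],
        [.pt 4 0 0, ⟨3, (4, -1), 2, (2, 0), false, (4, 0)⟩]])])
    (by decide +kernel)

theorem exists_three_of_four_mul_add_three {h k : ℕ} (hh : 1 ≤ h) (hk : k = 4 * h + 3) :
    Exists k 3 :=
  exists_of_checkSym (r := 1) (q := 3) (h₀ := 1) (h := h) (M := (4, 3)) (by omega) (by omega) (by decide) (by decide)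
    (by simp only [hk, lin]; push_cast; ring) (d := (2, 1)) (u := -2)
    (by
      have h1 : ((4 * h + 3 : ℕ) : ZMod k) = 0 := by rw [← hk, ZMod.natCast_self]
      push_cast at h1
      simp only [lin]
      push_cast
      linear_combination -h1)
    (R := [
      ((0, (4, 1)), [
        [.pt 0 0 0, .pt 2 4 2, .pt 4 0 0, ⟨0, (2, 1), 3, (2, -2), true, (4, -2)⟩, .pt 0 4 2,
         .pt 3 4 1],
        [.pt 0 0 1, .pt 1 0 0, .pt 2 0 0, .pt 3 2 0, ⟨1, (2, 2), 0, (2, 0), true, (4, -2)⟩,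
         .pt 1 4 2],
        [.pt 0 4 0, .pt 3 4 2, .pt 4 4 2, ⟨4, (2, 2), 2, (2, 0), true, (4, 0)⟩],
        [.pt 3 2 (-1), .pt 2 4 1, ⟨5, (0, 1), 5, (2, 0), true, (2, 0)⟩, .pt 6 0 0,
         ⟨1, (1, 0), 1, (1, 1), false, (2, 0)⟩],
        [.pt 1 2 1, .pt 1 4 1, .pt 5 2 1, ⟨2, (2, 1), 3, (4, 0), true, (4, 0)⟩],
        [⟨5, (0, 0), 4, (0, 1), false, (4, 3)⟩]])])
    (by decide +kernel)

theorem frame_five_of_four_mul_add_one {h k : ℕ} (hh : 2 ≤ h) (hk : k = 4 * h + 1) :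
    Frame k 5 :=
  frame_of_checkSym (h₀ := 2) (h := h) (M := (4, 1)) (by omega) (by omega)
    (by simp only [hk, lin]; push_cast; ring)
    (C := [
      [.pt 1 2 (-1), .pt 2 4 0, .pt 4 2 1, .pt 8 0 1, ⟨1, (2, 0), 3, (4, -2), true, (4, -4)⟩,
       .pt 9 4 0],
      [.pt 1 4 (-2), .pt 2 2 (-1), .pt 3 4 (-1), ⟨1, (2, -2), 7, (0, 1), false, (4, -3)⟩, .pt 3 2 0],
      [.pt 1 4 (-1), .pt 7 2 1, .pt 9 0 0, ⟨3, (2, -1), 4, (0, 2), false, (4, -2)⟩],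
      [.pt 1 4 0, .pt 7 2 0, .pt 6 4 0, ⟨9, (2, -1), 8, (0, 2), false, (4, -2)⟩],
      [.pt 2 2 (-2), .pt 4 0 1, .pt 6 2 (-1), .pt 8 0 0, ⟨9, (2, 0), 2, (4, -2), true, (4, -3)⟩],
      [.pt 2 2 0, .pt 9 4 (-1), ⟨8, (2, 1), 6, (4, -1), true, (4, -1)⟩],
      [.pt 2 4 (-1), ⟨6, (2, -2), 2, (0, 0), false, (4, -3)⟩, .pt 7 2 (-1), .pt 3 0 0, .pt 6 2 0],
      [.pt 3 4 0, ⟨7, (2, 2), 4, (0, 0), true, (4, 0)⟩]])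
    (by decide +kernel)

theorem frame_five_of_four_mul_add_three {h k : ℕ} (hh : 2 ≤ h) (hk : k = 4 * h + 3) :
    Frame k 5 :=
  frame_of_checkSym (h₀ := 2) (h := h) (M := (4, 3)) (by omega) (by omega)
    (by simp only [hk, lin]; push_cast; ring)
    (C := [
      [.pt 1 0 0, ⟨4, (0, 0), 3, (2, -2), true, (4, -2)⟩, .pt 2 2 (-1), .pt 8 2 2, .pt 1 4 2,
       .pt 7 0 1],
      [.pt 4 2 (-1), .pt 1 2 1, .pt 7 2 1, ⟨3, (4, 2), 1, (0, 1), false, (4, 0)⟩],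
      [.pt 1 2 2, .pt 2 4 2, ⟨1, (2, 3), 7, (2, 0), true, (4, -2)⟩, .pt 3 2 (-1), .pt 4 4 2,
       .pt 3 2 1],
      [.pt 2 2 0, .pt 6 0 1, .pt 9 2 0, .pt 3 2 2, .pt 9 2 1, ⟨2, (0, 0), 6, (2, 0), true, (4, -2)⟩],
      [.pt 3 2 0, .pt 6 4 2, ⟨2, (2, 1), 9, (4, 1), true, (4, 1)⟩],
      [.pt 4 2 0, .pt 7 0 0, ⟨8, (2, 0), 9, (0, 0), false, (4, 1)⟩],
      [.pt 6 0 0, ⟨7, (2, 2), 4, (4, 1), true, (4, 2)⟩],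
      [⟨6, (2, 1), 8, (4, 2), true, (4, 1)⟩, .pt 8 2 1, .pt 9 4 2]])
    (by decide +kernel)

theorem gadget_three_of_four_mul_add_one {h k : ℕ} (hh : 3 ≤ h) (hk : k = 4 * h + 1) :
    Gadget 3 k :=
  gadget_of_checkSym (h₀ := 3) (h := h) (M := (4, 1)) (by omega) (by omega)
    (by simp only [hk, lin]; push_cast; ring)
    (C := [
      [.pt 0 1 (-1), .pt 1 3 (-1), .pt 0 1 0, .pt 2 3 0, .pt 0 3 0,
       ⟨1, (3, 0), 0, (1, -2), true, (2, -2)⟩, ⟨1, (4, 0), 2, (2, -2), true, (2, -2)⟩],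
      [.pt 1 1 (-2), ⟨2, (1, -1), 1, (1, 0), false, (2, -1)⟩, .pt 1 4 (-1),
       ⟨2, (2, 0), 0, (4, 0), true, (2, 0)⟩],
      [.pt 1 1 (-1), ⟨0, (1, 1), 1, (3, -2), true, (2, -2)⟩, .pt 2 4 0, .pt 1 2 (-1), .pt 2 2 (-1),
       ⟨0, (2, 0), 2, (4, -1), true, (2, -1)⟩]])
    (by decide +kernel)

theorem gadget_three_of_four_mul_add_three {h k : ℕ} (hh : 2 ≤ h) (hk : k = 4 * h + 3) :
    Gadget 3 k :=
  gadget_of_checkSym (h₀ := 2) (h := h) (M := (4, 3)) (by omega) (by omega)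
    (by simp only [hk, lin]; push_cast; ring)
    (C := [
      [.pt 0 0 0, ⟨2, (2, 2), 0, (4, 1), true, (2, 0)⟩, .pt 2 1 0, .pt 1 3 1,
       ⟨2, (1, -1), 1, (1, 0), false, (2, 0)⟩],
      [.pt 0 1 0, .pt 1 3 0, .pt 0 3 1, ⟨1, (3, -1), 0, (1, 1), false, (2, -2)⟩, .pt 2 4 2,
       .pt 0 4 2, ⟨1, (0, 0), 2, (2, 0), true, (2, 0)⟩],
      [.pt 0 2 0, .pt 1 2 0, .pt 2 2 1, ⟨1, (4, 1), 0, (0, 1), false, (2, -1)⟩,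
       ⟨2, (3, 2), 0, (3, 0), true, (2, 0)⟩, .pt 1 4 2]])
    (by decide +kernel)

theorem gadget_five_of_four_mul_add_one {h k : ℕ} (hh : 4 ≤ h) (hk : k = 4 * h + 1) :
    Gadget 5 k :=
  gadget_of_checkSym (h₀ := 4) (h := h) (M := (4, 1)) (by omega) (by omega)
    (by simp only [hk, lin]; push_cast; ring)
    (C := [
      [.pt 0 0 0, .pt 1 2 0, .pt 0 2 0, .pt 1 2 (-1), .pt 2 4 0, .pt 1 4 (-2),
       ⟨2, (2, -3), 3, (2, 2), false, (2, -3)⟩, ⟨3, (1, -2), 4, (3, 1), false, (2, -2)⟩],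
      [.pt 1 0 0, .pt 2 4 (-2), ⟨3, (2, -1), 4, (2, 2), false, (2, -3)⟩, .pt 2 1 (-3), .pt 3 3 1,
       .pt 4 1 0, .pt 0 3 0, .pt 4 3 0, ⟨0, (1, 0), 4, (1, -3), true, (2, -3)⟩],
      [.pt 0 2 (-1), .pt 4 2 0, .pt 3 4 0, .pt 4 4 0, ⟨3, (4, -1), 2, (0, 0), false, (2, -5)⟩,
       ⟨2, (3, -1), 1, (1, 0), false, (2, -2)⟩, .pt 2 2 (-1), .pt 1 2 1, .pt 0 4 0, .pt 4 2 1],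
      [.pt 1 1 (-1), .pt 2 1 (-2), .pt 3 1 (-1), .pt 4 1 1, .pt 3 3 0, .pt 4 1 (-2),
       ⟨0, (1, -1), 4, (1, 2), false, (2, -3)⟩, .pt 1 4 0, ⟨0, (2, 1), 1, (4, -3), true, (2, -3)⟩],
      [.pt 0 3 1, .pt 1 1 (-2), ⟨0, (3, 2), 1, (3, -1), true, (2, -4)⟩, .pt 2 2 (-2), .pt 3 2 0,
       .pt 2 2 0, .pt 1 4 (-1), .pt 2 4 (-1), .pt 3 2 1, ⟨2, (4, -3), 1, (0, 1), false, (2, -5)⟩,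
       .pt 3 1 0, .pt 4 1 (-1)]])
    (by decide +kernel)

theorem gadget_five_of_four_mul_add_three {h k : ℕ} (hh : 4 ≤ h) (hk : k = 4 * h + 3) :
    Gadget 5 k :=
  gadget_of_checkSym (h₀ := 4) (h := h) (M := (4, 3)) (by omega) (by omega)
    (by simp only [hk, lin]; push_cast; ring)
    (C := [
      [.pt 0 1 (-2), .pt 1 0 0, ⟨0, (3, -2), 4, (2, 1), false, (2, -2)⟩, .pt 3 3 2, .pt 4 1 1,
       .pt 3 3 1, .pt 4 3 0, .pt 3 1 0, .pt 2 2 1, ⟨1, (3, 3), 0, (2, -3), true, (2, -5)⟩,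
       .pt 0 3 1, .pt 4 4 1],
      [.pt 0 1 (-1), .pt 1 2 0, .pt 2 3 2, .pt 3 2 0, .pt 2 1 1, .pt 3 2 1, .pt 4 4 2, .pt 0 3 0,
       ⟨1, (0, 1), 0, (1, -3), true, (2, -4)⟩, ⟨1, (3, 0), 2, (2, 2), false, (2, -1)⟩],
      [.pt 0 1 0, .pt 1 4 1, .pt 2 3 1, ⟨3, (4, 2), 4, (0, 1), false, (2, -1)⟩, .pt 4 3 1,
       .pt 0 4 2, ⟨4, (1, 2), 0, (4, 0), true, (2, -2)⟩, .pt 1 4 2],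
      [.pt 0 2 (-2), .pt 4 1 0, .pt 3 1 (-1), .pt 2 0 1, .pt 1 3 1, .pt 2 4 2, .pt 1 1 0,
       ⟨2, (2, 0), 3, (1, 1), false, (2, -2)⟩, ⟨2, (3, 3), 1, (2, -1), true, (2, -2)⟩],
      [.pt 0 2 (-1), .pt 1 1 (-1), .pt 2 0 0, ⟨3, (3, 0), 2, (0, 2), false, (2, -2)⟩, .pt 3 0 0,
       .pt 4 0 0, .pt 0 3 (-1), ⟨4, (4, 0), 3, (0, 1), false, (2, -3)⟩, .pt 0 4 1, .pt 1 3 2]])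
    (by decide +kernel)

theorem exists_seven_two : Exists 7 2 :=
  exists_of_checkSym (r := 2) (q := 1) (h₀ := 0) (h := 0) (M := (0, 7)) (by decide) (by decide) (by decide) (by decide)
    (by decide) (d := (0, 3)) (u := -2) (by decide)
    (R := [
      ((0, (0, 6)), [
        [.pt 3 0 6, ⟨3, (0, 3), 3, (0, 1), false, (0, 3)⟩, .pt 4 0 0,
         ⟨2, (0, -1), 2, (0, 0), false, (0, 2)⟩],
        [.pt 2 0 1, .pt 0 0 5, ⟨1, (0, 5), 0, (0, 1), false, (0, 5)⟩],
        [.pt 2 0 2, ⟨2, (0, 5), 0, (0, 3), false, (0, 5)⟩, .pt 1 0 2],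
        [.pt 3 0 0, .pt 1 0 6, .pt 0 0 0, ⟨3, (0, 4), 1, (0, 1), true, (0, 4)⟩]]),
      ((1, (0, 6)), [
        [.pt 2 0 0, .pt 0 0 2, .pt 2 0 6, .pt 3 0 3, ⟨2, (0, 1), 1, (0, 4), true, (0, 2)⟩,
         .pt 1 0 5],
        [.pt 2 0 2, .pt 1 0 3, ⟨3, (0, 2), 0, (0, 0), false, (0, 5)⟩],
        [.pt 2 0 3, ⟨2, (0, 5), 3, (0, 5), false, (0, 3)⟩, .pt 1 0 1, .pt 0 0 3, .pt 3 0 6],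
        [.pt 3 0 4, .pt 1 0 2, ⟨1, (0, 0), 1, (0, 0), true, (0, 1)⟩, .pt 4 0 0,
         ⟨0, (0, 5), 0, (0, 4), true, (0, 3)⟩]])])
    (by decide +kernel)

theorem exists_nine_two : Exists 9 2 :=
  exists_of_checkSym (r := 2) (q := 1) (h₀ := 0) (h := 0) (M := (0, 9)) (by decide) (by decide) (by decide) (by decide)
    (by decide) (d := (0, 4)) (u := -2) (by decide)
    (R := [
      ((0, (0, 8)), [
        [.pt 3 0 8, ⟨3, (0, 4), 3, (0, 1), false, (0, 4)⟩, .pt 4 0 0,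
         ⟨2, (0, 0), 2, (0, -1), true, (0, 3)⟩],
        [.pt 2 0 2, .pt 0 0 7, ⟨1, (0, 7), 0, (0, 1), false, (0, 7)⟩],
        [.pt 2 0 3, ⟨2, (0, 7), 0, (0, 4), false, (0, 7)⟩, .pt 1 0 3],
        [.pt 3 0 0, .pt 1 0 8, .pt 0 0 0, ⟨3, (0, 5), 1, (0, 2), true, (0, 6)⟩]]),
      ((1, (0, 8)), [
        [.pt 2 0 0, .pt 0 0 3, .pt 2 0 8, .pt 3 0 4, ⟨2, (0, 1), 1, (0, 6), true, (0, 4)⟩,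
         .pt 1 0 7],
        [.pt 2 0 3, .pt 1 0 4, ⟨3, (0, 3), 0, (0, 0), false, (0, 7)⟩],
        [.pt 2 0 4, ⟨2, (0, 7), 3, (0, 6), false, (0, 5)⟩, .pt 1 0 2, .pt 0 0 4, .pt 3 0 8],
        [.pt 3 0 5, .pt 1 0 3, ⟨1, (0, 0), 1, (0, 1), true, (0, 2)⟩, .pt 4 0 0,
         ⟨0, (0, 6), 0, (0, 7), false, (0, 4)⟩]])])
    (by decide +kernel)

theorem frame_seven_five : Frame 7 5 :=
  frame_of_checkSym (h₀ := 0) (h := 0) (M := (0, 7)) (by decide) (by decide) (by decide)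
    (C := [
      [.pt 1 0 0, ⟨4, (0, 0), 3, (0, 0), true, (0, 2)⟩, .pt 2 0 1, .pt 8 0 4, .pt 1 0 6, .pt 7 0 1],
      [.pt 4 0 1, .pt 1 0 3, .pt 7 0 3, ⟨3, (0, 6), 1, (0, 1), false, (0, 4)⟩],
      [.pt 1 0 4, .pt 2 0 6, ⟨1, (0, 5), 7, (0, 2), true, (0, 2)⟩, .pt 3 0 1, .pt 4 0 6, .pt 3 0 3],
      [.pt 2 0 2, .pt 6 0 1, .pt 9 0 2, .pt 3 0 4, .pt 9 0 3, ⟨2, (0, 0), 6, (0, 2), true, (0, 2)⟩],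
      [.pt 3 0 2, .pt 6 0 6, ⟨2, (0, 3), 9, (0, 5), true, (0, 5)⟩],
      [.pt 4 0 2, .pt 7 0 0, ⟨8, (0, 2), 9, (0, 0), false, (0, 5)⟩],
      [.pt 6 0 0, ⟨7, (0, 4), 4, (0, 5), true, (0, 6)⟩],
      [⟨6, (0, 3), 8, (0, 6), true, (0, 5)⟩, .pt 8 0 3, .pt 9 0 6]])
    (by decide +kernel)

theorem gadget_three_nine : Gadget 3 9 :=
  gadget_of_checkSym (h₀ := 0) (h := 0) (M := (0, 9)) (by decide) (by decide) (by decide)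
    (C := [
      [.pt 0 0 1, .pt 1 0 5, .pt 0 0 2, .pt 2 0 6, .pt 0 0 6, ⟨1, (0, 6), 0, (0, 0), true, (0, 2)⟩,
       ⟨1, (0, 8), 2, (0, 2), true, (0, 2)⟩],
      [.pt 1 0 0, ⟨2, (0, 1), 1, (0, 2), false, (0, 3)⟩, .pt 1 0 7,
       ⟨2, (0, 4), 0, (0, 8), true, (0, 4)⟩],
      [.pt 1 0 1, ⟨0, (0, 3), 1, (0, 4), true, (0, 2)⟩, .pt 2 0 8, .pt 1 0 3, .pt 2 0 3,
       ⟨0, (0, 4), 2, (0, 7), true, (0, 3)⟩]])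
    (by decide +kernel)

theorem gadget_five_thirteen : Gadget 5 13 :=
  gadget_of_checkSym (h₀ := 0) (h := 0) (M := (0, 13)) (by decide) (by decide) (by decide)
    (C := [
      [.pt 0 0 0, .pt 1 0 6, .pt 0 0 6, .pt 1 0 5, .pt 2 0 12, .pt 1 0 10,
       ⟨2, (0, 3), 3, (0, 8), false, (0, 3)⟩, ⟨3, (0, 1), 4, (0, 10), false, (0, 4)⟩],
      [.pt 1 0 0, .pt 2 0 10, ⟨3, (0, 5), 4, (0, 8), false, (0, 3)⟩, .pt 2 0 0, .pt 3 0 10,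
       .pt 4 0 3, .pt 0 0 9, .pt 4 0 9, ⟨0, (0, 3), 4, (0, 0), true, (0, 3)⟩],
      [.pt 0 0 5, .pt 4 0 6, .pt 3 0 12, .pt 4 0 12, ⟨3, (0, 11), 2, (0, 0), false, (0, 1)⟩,
       ⟨2, (0, 8), 1, (0, 3), false, (0, 4)⟩, .pt 2 0 5, .pt 1 0 7, .pt 0 0 12, .pt 4 0 7],
      [.pt 1 0 2, .pt 2 0 1, .pt 3 0 2, .pt 4 0 4, .pt 3 0 9, .pt 4 0 1,
       ⟨0, (0, 2), 4, (0, 5), false, (0, 3)⟩, .pt 1 0 12, ⟨0, (0, 7), 1, (0, 9), true, (0, 3)⟩],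
      [.pt 0 0 10, .pt 1 0 1, ⟨0, (0, 11), 1, (0, 8), true, (0, 2)⟩, .pt 2 0 4, .pt 3 0 6,
       .pt 2 0 6, .pt 1 0 11, .pt 2 0 11, .pt 3 0 7, ⟨2, (0, 9), 1, (0, 1), false, (0, 1)⟩,
       .pt 3 0 3, .pt 4 0 2]])
    (by decide +kernel)

theorem gadget_five_fifteen : Gadget 5 15 :=
  gadget_of_checkSym (h₀ := 0) (h := 0) (M := (0, 15)) (by decide) (by decide) (by decide)
    (C := [
      [.pt 0 0 1, .pt 1 0 0, ⟨0, (0, 7), 4, (0, 7), false, (0, 4)⟩, .pt 3 0 11, .pt 4 0 4,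
       .pt 3 0 10, .pt 4 0 9, .pt 3 0 3, .pt 2 0 7, ⟨1, (0, 12), 0, (0, 3), true, (0, 1)⟩,
       .pt 0 0 10, .pt 4 0 13],
      [.pt 0 0 2, .pt 1 0 6, .pt 2 0 11, .pt 3 0 6, .pt 2 0 4, .pt 3 0 7, .pt 4 0 14, .pt 0 0 9,
       ⟨1, (0, 1), 0, (0, 0), true, (0, 2)⟩, ⟨1, (0, 9), 2, (0, 8), false, (0, 5)⟩],
      [.pt 0 0 3, .pt 1 0 13, .pt 2 0 10, ⟨3, (0, 14), 4, (0, 1), false, (0, 5)⟩, .pt 4 0 10,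
       .pt 0 0 14, ⟨4, (0, 5), 0, (0, 12), true, (0, 4)⟩, .pt 1 0 14],
      [.pt 0 0 4, .pt 4 0 3, .pt 3 0 2, .pt 2 0 1, .pt 1 0 10, .pt 2 0 14, .pt 1 0 3,
       ⟨2, (0, 6), 3, (0, 4), false, (0, 4)⟩, ⟨2, (0, 12), 1, (0, 5), true, (0, 4)⟩],
      [.pt 0 0 5, .pt 1 0 2, .pt 2 0 0, ⟨3, (0, 9), 2, (0, 2), false, (0, 4)⟩, .pt 3 0 0, .pt 4 0 0,
       .pt 0 0 8, ⟨4, (0, 12), 3, (0, 1), false, (0, 3)⟩, .pt 0 0 13, .pt 1 0 11]])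
    (by decide +kernel)

/-! ### Cycles of odd length at least five -/

section odd

variable {k : ℕ}

theorem eq_of_odd (hk : Odd k) : ∃ h, k = 4 * h + 1 ∨ k = 4 * h + 3 := by
  obtain ⟨j, rfl⟩ := hk
  exact ⟨j / 2, by omega⟩

theorem exists_one_of_odd (hk : Odd k) (h5 : 5 ≤ k) : Exists k 1 := by
  obtain ⟨h, hh | hh⟩ := eq_of_odd hk
  · rcases (by omega : k = 5 ∨ 2 ≤ h) with rfl | h2
    · exact exists_five_one
    · exact exists_one_of_four_mul_add_one h2 hh
  · exact exists_one_of_four_mul_add_three (by omega) hh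

theorem exists_two_of_odd (hk : Odd k) (h5 : 5 ≤ k) : Exists k 2 := by
  obtain ⟨h, hh | hh⟩ := eq_of_odd hk
  · rcases (by omega : k = 5 ∨ k = 9 ∨ 3 ≤ h) with rfl | rfl | h2
    · exact exists_five_two
    · exact exists_nine_two
    · exact exists_two_of_four_mul_add_one h2 hh
  · rcases (by omega : k = 7 ∨ 2 ≤ h) with rfl | h2
    · exact exists_seven_two
    · exact exists_two_of_four_mul_add_three h2 hh

theorem exists_three_of_odd (hk : Odd k) (h5 : 5 ≤ k) : Exists k 3 := by
  obtain ⟨h, hh | hh⟩ := eq_of_odd hk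
  · rcases (by omega : k = 5 ∨ 2 ≤ h) with rfl | h2
    · exact exists_five_three
    · exact exists_three_of_four_mul_add_one h2 hh
  · exact exists_three_of_four_mul_add_three (by omega) hh

theorem frame_five_of_odd (hk : Odd k) (h5 : 5 ≤ k) : Frame k 5 := by
  obtain ⟨h, hh | hh⟩ := eq_of_odd hk
  · rcases (by omega : k = 5 ∨ 2 ≤ h) with rfl | h2
    · exact frame_five_five
    · exact frame_five_of_four_mul_add_one h2 hh
  · rcases (by omega : k = 7 ∨ 2 ≤ h) with rfl | h2
    · exact frame_seven_five
    · exact frame_five_of_four_mul_add_three h2 hh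

theorem gadget_three_of_odd (hk : Odd k) (h5 : 5 ≤ k) : Gadget 3 k := by
  obtain ⟨h, hh | hh⟩ := eq_of_odd hk
  · rcases (by omega : k = 5 ∨ k = 9 ∨ 3 ≤ h) with rfl | rfl | h2
    · exact gadget_three_five
    · exact gadget_three_nine
    · exact gadget_three_of_four_mul_add_one h2 hh
  · rcases (by omega : k = 7 ∨ 2 ≤ h) with rfl | h2
    · exact gadget_three_seven
    · exact gadget_three_of_four_mul_add_three h2 hh

theorem gadget_five_of_odd (hk : Odd k) (h5 : 5 ≤ k) : Gadget 5 k := by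
  obtain ⟨h, hh | hh⟩ := eq_of_odd hk
  · rcases (by omega : k = 5 ∨ k = 9 ∨ k = 13 ∨ 4 ≤ h) with rfl | rfl | rfl | h2
    · exact gadget_five_five
    · exact gadget_five_nine
    · exact gadget_five_thirteen
    · exact gadget_five_of_four_mul_add_one h2 hh
  · rcases (by omega : k = 7 ∨ k = 11 ∨ k = 15 ∨ 4 ≤ h) with rfl | rfl | rfl | h2
    · exact gadget_five_seven
    · exact gadget_five_eleven
    · exact gadget_five_fifteen
    · exact gadget_five_of_four_mul_add_three h2 hh

end odd

/-! ### Assembly -/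

section gadgets

variable {k : ℕ}

theorem frame_of_gadget_three (h3 : Gadget 3 k) : Frame k 4 :=
  (twoFrame_four_three.mono fun _ hm => Nat.eq_of_beq_eq_true hm ▸ h3).frame

theorem frame_of_gadget_five (h5 : Gadget 5 k) : Frame k 6 :=
  (twoFrame_six_five.mono fun _ hm => Nat.eq_of_beq_eq_true hm ▸ h5).frame

theorem frame_three_of_gadget_four (h4 : Gadget 4 k) : Frame k 3 :=
  (twoFrame_three_four.mono fun _ hm => Nat.eq_of_beq_eq_true hm ▸ h4).frame

theorem frame_five_of_gadget_four (h4 : Gadget 4 k) : Frame k 5 :=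
  (twoFrame_five_four.mono fun _ hm => Nat.eq_of_beq_eq_true hm ▸ h4).frame

theorem frame_of_gadget_three_of_gadget_five (h3 : Gadget 3 k) (h5 : Gadget 5 k) {u : ℕ}
    (hu : 7 ≤ u) (hu' : u ≤ 15) : Frame k u := by
  suffices h : TwoFrame (fun m => (Nat.beq 3 m || Nat.beq 5 m) = true) u by
    refine (h.mono fun m hm => ?_).frame
    rcases Bool.or_eq_true _ _ |>.mp hm with hm | hm
    · exact Nat.eq_of_beq_eq_true hm ▸ h3
    · exact Nat.eq_of_beq_eq_true hm ▸ h5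
  interval_cases u
  exacts [twoFrame_seven, twoFrame_eight, twoFrame_nine, twoFrame_ten, twoFrame_eleven,
    twoFrame_twelve, twoFrame_thirteen, twoFrame_fourteen, twoFrame_fifteen]

theorem exists_of_gadgets (hk : 0 < k) (h3 : Gadget 3 k) (h5 : Gadget 5 k) (hF5 : Frame k 5)
    (e1 : Exists k 1) (e3 : Exists k 3) (e18 : Exists k 18) (t : ℕ) (ht : 3 ≤ t) :
    Exists k t := by
  have hF4 := frame_of_gadget_three h3
  have hF6 := frame_of_gadget_five h5
  refine exists_of_le_fifteen hk hF4 hF5 hF6 e1 (fun t ht ht' => ?_) e18 t ht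
  rcases (by omega : t = 3 ∨ t = 4 ∨ t = 5 ∨ t = 6 ∨ 7 ≤ t) with rfl | rfl | rfl | rfl | h7
  exacts [e3, hF4.exists hk e1, hF5.exists hk e1, hF6.exists hk e1,
    (frame_of_gadget_three_of_gadget_five h3 h5 h7 ht').exists hk e1]

theorem exists_of_gadget_four (hk : 0 < k) (h3 : Gadget 3 k) (h4 : Gadget 4 k) (h5 : Gadget 5 k)
    (e1 : Exists k 1) (t : ℕ) (ht : 3 ≤ t) : Exists k t := by
  have hF3 := frame_three_of_gadget_four h4
  have hF5 := frame_five_of_gadget_four h4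
  exact exists_of_gadgets hk h3 h5 hF5 e1 (hF3.exists hk e1)
    (exists_td_three hk hF3 (frame_of_gadget_three h3) hF5 (frame_of_gadget_five h5)
      (hasSlopes_coprime_six (by norm_num)) (by norm_num) (Nat.zero_le _) (Nat.zero_le _)
      (hF5.exists hk e1) (hF3.exists hk e1) (exists_zero k) (exists_zero k)) t ht

end gadgets

theorem exists_of_odd {k : ℕ} (hk : Odd k) (h5 : 5 ≤ k) : ∀ t, Exists k t
  | 0 => exists_zero k
  | 1 => exists_one_of_odd hk h5
  | 2 => exists_two_of_odd hk h5
  | t + 3 => by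
    have h0 : 0 < k := by omega
    have g3 := gadget_three_of_odd hk h5
    have e1 := exists_one_of_odd hk h5
    have hF4 := frame_of_gadget_three g3
    have hF5 := frame_five_of_odd hk h5
    exact exists_of_gadgets h0 g3 (gadget_five_of_odd hk h5) hF5 e1 (exists_three_of_odd hk h5)
      (exists_td_order_four h0 hF4 hF5 (by norm_num) (hF4.exists h0 e1) (exists_two_of_odd hk h5))
      (t + 3) (by omega)

theorem exists_three {t : ℕ} (ht : 3 ≤ t) : Exists 3 t := by
  have hk : 0 < 3 := by norm_num
  have hF4 := frame_of_gadget_three gadget_three_three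
  have h16 : ∀ x, x ≤ 4 → Exists 3 x → Exists 3 (16 + x) := fun x hx h =>
    exists_td_order_four hk hF4 frame_three_five hx exists_three_four h
  refine exists_of_le_twentyTwo hk hF4 frame_three_five frame_three_six (fun t ht ht' => ?_) t ht
  interval_cases t
  exacts [exists_three_three, exists_three_four, exists_three_five, exists_three_six,
    exists_three_seven, exists_three_eight, exists_three_nine, exists_three_ten,
    exists_three_eleven, exists_twelve hk hF4 exists_three_three, exists_three_thirteen,
    exists_three_fourteen, exists_three_fifteen, h16 0 (by norm_num) (exists_zero 3),
    exists_three_seventeen, exists_three_eighteen, h16 3 (by norm_num) exists_three_three,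
    h16 4 (by norm_num) exists_three_four, exists_three_twentyOne, exists_three_twentyTwo]

section four

theorem exists_four_of_gdd {t g m : ℕ} (grp : Fin t → Fin g) (B : Fin m → Finset (Fin t))
    (hB : ∀ x y, grp x ≠ grp y → ∃ b, x ∈ B b ∧ y ∈ B b)
    (hu : ∀ x y, x ≠ y → ∀ b b', x ∈ B b → y ∈ B b → x ∈ B b' → y ∈ B b' → b = b')
    (hi : ∀ b, ∀ x ∈ B b, ∀ y ∈ B b, grp x = grp y → x = y)
    (hc : ∀ b, (B b).card = 3 ∨ (B b).card = 4)
    (hg : ∀ j, (Finset.univ.filter fun x => grp x = j).card = 2 ∨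
      (Finset.univ.filter fun x => grp x = j).card = 3 ∨
      (Finset.univ.filter fun x => grp x = j).card = 4) : Exists 4 t := by
  refine exists_of_gdd_fin (by norm_num) grp B hB hu hi (fun b => ?_) fun j => ?_
  · rcases hc b with h | h <;> rw [h]
    exacts [frame_three_of_gadget_four gadget_four_four, frame_of_gadget_three gadget_three_four]
  · rcases hg j with h | h | h <;> rw [h]
    exacts [exists_four_two, exists_four_three, exists_four_four]

theorem exists_four_six : Exists 4 6 :=
  exists_four_of_gdd (g := 3) ![0, 0, 1, 1, 2, 2]
    ![{0, 2, 4}, {1, 2, 5}, {1, 3, 4}, {0, 3, 5}]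
    (by decide +kernel) (by decide +kernel) (by decide +kernel) (by decide +kernel)
    (by decide +kernel)

theorem exists_four_eight : Exists 4 8 :=
  exists_four_of_gdd (g := 4) ![0, 0, 1, 1, 2, 2, 3, 3]
    ![{0, 3, 4}, {1, 3, 7}, {3, 5, 6}, {1, 2, 5}, {0, 5, 7}, {0, 2, 6}, {1, 4, 6}, {2, 4, 7}]
    (by decide +kernel) (by decide +kernel) (by decide +kernel) (by decide +kernel)
    (by decide +kernel)

theorem exists_four_ten : Exists 4 10 :=
  exists_four_of_gdd (g := 4) ![0, 0, 1, 1, 2, 2, 3, 3, 3, 3]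
    ![{0, 4, 9}, {1, 3, 9}, {2, 5, 9}, {3, 4, 6}, {0, 3, 7}, {1, 5, 7}, {1, 2, 6}, {0, 2, 8},
      {0, 5, 6}, {1, 4, 8}, {2, 4, 7}, {3, 5, 8}]
    (by decide +kernel) (by decide +kernel) (by decide +kernel) (by decide +kernel)
    (by decide +kernel)

theorem exists_four_thirteen : Exists 4 13 :=
  exists_four_of_gdd (g := 4) ![0, 0, 0, 1, 1, 1, 2, 2, 2, 3, 3, 3, 3]
    ![{0, 3, 6, 12}, {1, 4, 7, 12}, {2, 5, 8, 12}, {0, 4, 8, 9}, {0, 5, 11}, {0, 7, 10},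
      {5, 7, 9}, {1, 3, 9}, {2, 6, 9}, {4, 6, 11}, {2, 4, 10}, {3, 8, 10}, {1, 8, 11},
      {2, 3, 7, 11}, {1, 5, 6, 10}]
    (by decide +kernel) (by decide +kernel) (by decide +kernel) (by decide +kernel)
    (by decide +kernel)

theorem exists_four {t : ℕ} (ht : 2 ≤ t) : Exists 4 t := by
  rcases ht.eq_or_lt with rfl | ht
  · exact exists_four_two
  have hk : 0 < 4 := by norm_num
  have hF3 := frame_three_of_gadget_four gadget_four_four
  have hF4 := frame_of_gadget_three gadget_three_four
  have hF5 := frame_five_of_gadget_four gadget_four_four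
  have hF6 := frame_of_gadget_five gadget_five_four
  have s5 : HasSlopes 5 5 := hasSlopes_coprime_six (by norm_num)
  have h0 := exists_zero 4
  have h9 : ∀ x, x ≤ 3 → Exists 4 x → Exists 4 (9 + x) := fun x hx h =>
    exists_td_order_three hk hF3 hF4 hx exists_four_three h
  have h12 : ∀ x y, x ≤ 4 → y ≤ 4 → Exists 4 x → Exists 4 y → Exists 4 (12 + x + y) :=
    fun x y hx hy h h' => exists_td_order_four_three hk hF3 hF4 hF5 hx hy exists_four_four h h'
  have h16 : ∀ x, x ≤ 4 → Exists 4 x → Exists 4 (16 + x) := fun x hx h =>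
    exists_td_order_four hk hF4 hF5 hx exists_four_four h
  refine exists_of_le_twentyTwo hk hF4 hF5 hF6 (fun t ht ht' => ?_) t ht
  interval_cases t
  · exact exists_four_three
  · exact exists_four_four
  · exact exists_four_five
  · exact exists_four_six
  · exact exists_four_seven
  · exact exists_four_eight
  · exact h9 0 (by norm_num) h0
  · exact exists_four_ten
  · exact h9 2 (by norm_num) exists_four_two
  · exact h9 3 (by norm_num) exists_four_three
  · exact exists_four_thirteen
  · exact h12 2 0 (by norm_num) (by norm_num) exists_four_two h0
  · exact h12 3 0 (by norm_num) (by norm_num) exists_four_three h0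
  · exact h16 0 (by norm_num) h0
  · exact h12 2 3 (by norm_num) (by norm_num) exists_four_two exists_four_three
  · exact h16 2 (by norm_num) exists_four_two
  · exact h16 3 (by norm_num) exists_four_three
  · exact h16 4 (by norm_num) exists_four_four
  · exact exists_td_three hk hF3 hF4 hF5 hF6 s5 (by norm_num) (by norm_num) (Nat.zero_le _)
      exists_four_five exists_four_two exists_four_four h0
  · exact exists_td_four hk hF4 hF5 hF6 s5 (by norm_num) (Nat.zero_le _) exists_four_five
      exists_four_two h0

end four

theorem exists_of_even {k t : ℕ} (hk : k = 6 ∨ k = 8 ∨ k = 10 ∨ k = 14)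
    (ht : t = 2 → k = 6 ∨ k = 10) : Exists k t := by
  match t with
  | 0 => exact exists_zero k
  | 1 =>
    rcases hk with rfl | rfl | rfl | rfl
    exacts [exists_six_one, exists_eight_one, exists_ten_one, exists_fourteen_one]
  | 2 =>
    rcases ht rfl with rfl | rfl
    exacts [exists_six_two, exists_ten_two]
  | t + 3 =>
    have h3 : 3 ≤ t + 3 := by omega
    rcases hk with rfl | rfl | rfl | rfl
    · exact exists_of_gadget_four (by norm_num) gadget_three_six gadget_four_six gadget_five_six
        exists_six_one _ h3
    · exact exists_of_gadget_four (by norm_num) gadget_three_eight gadget_four_eight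
        gadget_five_eight exists_eight_one _ h3
    · exact exists_of_gadget_four (by norm_num) gadget_three_ten gadget_four_ten gadget_five_ten
        exists_ten_one _ h3
    · exact exists_of_gadget_four (by norm_num) gadget_three_fourteen gadget_four_fourteen
        gadget_five_fourteen exists_fourteen_one _ h3

theorem exists_of_not_mem {k t : ℕ} (hk : (Odd k ∧ 3 ≤ k) ∨ k ∈ ({4, 6, 8, 10, 14} : Set ℕ))
    (h : (k, t) ∉ ({(3, 1), (3, 2), (4, 1), (8, 2), (14, 2)} : Set (ℕ × ℕ))) : Exists k t := by
  simp only [Set.mem_insert_iff, Set.mem_singleton_iff, Prod.mk.injEq, not_or, not_and] at h hk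
  rcases Nat.eq_zero_or_pos t with rfl | ht
  · exact exists_zero k
  rcases hk with ⟨hk, h3⟩ | rfl | hk
  · rcases h3.eq_or_lt with rfl | h3
    · exact exists_three (by omega)
    · exact exists_of_odd hk (by rcases hk with ⟨j, rfl⟩; omega) t
  · exact exists_four (by omega)
  · exact exists_of_even hk (by omega)

end ARCS

/-- Let `n ≡ 1 (mod 2k)`. There exists an almost resolvable `k`-cycle system of order
`n` for every odd `k ≥ 3` and every even `k ∈ {4, 6, 8, 10, 14}`, except for
`(k, n) ∈ {(3,7), (3,13), (4,9)}` and except possibly for `(k, n) ∈ {(8,33), (14,57)}`. -/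
theorem arcs_known (k n : ℕ) (hn : n % (2 * k) = 1)
    (hk : (Odd k ∧ 3 ≤ k) ∨ k ∈ ({4, 6, 8, 10, 14} : Set ℕ))
    (h1 : (k, n) ∉ ({(3, 7), (3, 13), (4, 9)} : Set (ℕ × ℕ)))
    (h2 : (k, n) ∉ ({(8, 33), (14, 57)} : Set (ℕ × ℕ))) :
    HasARCS k n := by
  obtain ⟨t, rfl⟩ : ∃ t, n = 2 * k * t + 1 :=
    ⟨n / (2 * k), by rw [← hn, Nat.div_add_mod]⟩
  have h3 : 3 ≤ k := by
    rcases hk with hk | hk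
    · exact hk.2
    · simp only [Set.mem_insert_iff, Set.mem_singleton_iff] at hk
      omega
  refine (ARCS.exists_of_not_mem hk fun h => ?_).hasARCS h3
  simp only [Set.mem_insert_iff, Set.mem_singleton_iff, Prod.mk.injEq] at h h1 h2
  rcases h with ⟨rfl, rfl⟩ | ⟨rfl, rfl⟩ | ⟨rfl, rfl⟩ | ⟨rfl, rfl⟩ | ⟨rfl, rfl⟩ <;> omega
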